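/- arXiv:1906.06817 — 2 statements merged into one kernel-verified Lean document; each statement's English description precedes it below -/
import Mathlib

section
/- Let X and Y be m × n matrices of distinct indeterminates, H = (X Y), V their vertical concatenation, and J = I_m(H) + I_n(V). Then R/J is reduced and Cohen-Macaulay. -/
/-! Statement 8: with X, Y generic m × n matrices, H = (X Y), V their vertical
concatenation and J = I_m(H) + I_n(V), the ring R/J is reduced and
Cohen-Macaulay (Cohen-Macaulay in the graded sense: there is a regular
sequence, inside the irrelevant maximal ideal, of length the Krull dimension). -/

open MvPolynomial

noncomputable section

/-- A term order on monomials (exponent vectors) in variables indexed by `σ`. -/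
structure TermOrder (σ : Type*) where
  lt : (σ →₀ ℕ) → (σ →₀ ℕ) → Prop
  trans : ∀ {a b c}, lt a b → lt b c → lt a c
  irrefl : ∀ a, ¬ lt a a
  total : ∀ a b, a ≠ b → lt a b ∨ lt b a
  zero_lt : ∀ a, a ≠ 0 → lt 0 a
  add_right : ∀ a b c, lt a b → lt (a + c) (b + c)

/-- `m` is the leading monomial of `f` with respect to the term order `tord`. -/
def IsLeadMono {σ K : Type*} [Field K] (tord : TermOrder σ) (f : MvPolynomial σ K)
    (m : σ →₀ ℕ) : Prop :=
  m ∈ f.support ∧ ∀ m' ∈ f.support, m' ≠ m → tord.lt m' m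

/-- The initial ideal of `I` with respect to the term order `tord`. -/
def initialIdeal {σ K : Type*} [Field K] (tord : TermOrder σ) (I : Ideal (MvPolynomial σ K)) :
    Ideal (MvPolynomial σ K) :=
  Ideal.span {g | ∃ f ∈ I, ∃ m, IsLeadMono tord f m ∧ g = monomial m (1 : K)}

/-- `G` is a Gröbner basis of `I` with respect to `tord`. -/
def IsGroebnerBasis {σ K : Type*} [Field K] (tord : TermOrder σ)
    (I : Ideal (MvPolynomial σ K)) (G : Set (MvPolynomial σ K)) : Prop :=
  G ⊆ (I : Set (MvPolynomial σ K)) ∧ Ideal.span G = I ∧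
    initialIdeal tord I = Ideal.span {g | ∃ f ∈ G, ∃ m, IsLeadMono tord f m ∧ g = monomial m (1 : K)}

/-- The set of `t × t` minors of a matrix. -/
def minorsSet {A : Type*} [CommRing A] (t a b : ℕ) (M : Matrix (Fin a) (Fin b) A) : Set A :=
  {d | ∃ (rs : Fin t → Fin a) (cs : Fin t → Fin b),
    StrictMono rs ∧ StrictMono cs ∧ d = (M.submatrix rs cs).det}

/-- The variable in row `i`, column `k` of the horizontal concatenation
`H = (X_1 ⋯ X_r)` of `r` generic `m × n` matrices. -/
def varH (r m n : ℕ) (hn : 0 < n) (i : Fin m) (k : Fin (r * n)) :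
    Fin r × Fin m × Fin n :=
  (⟨k.val / n, by
      have := k.isLt
      exact (Nat.div_lt_iff_lt_mul hn).mpr this⟩, i, ⟨k.val % n, Nat.mod_lt _ hn⟩)

/-- The variable in row `k`, column `j` of the vertical concatenation
`V` of `r` generic `m × n` matrices. -/
def varV (r m n : ℕ) (hm : 0 < m) (k : Fin (r * m)) (j : Fin n) :
    Fin r × Fin m × Fin n :=
  (⟨k.val / m, by
      have := k.isLt
      exact (Nat.div_lt_iff_lt_mul hm).mpr this⟩, ⟨k.val % m, Nat.mod_lt _ hm⟩, j)

/-- The horizontal concatenation `H` as a matrix of polynomials. -/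
def Hmat (K : Type*) [Field K] (r m n : ℕ) (hn : 0 < n) :
    Matrix (Fin m) (Fin (r * n)) (MvPolynomial (Fin r × Fin m × Fin n) K) :=
  Matrix.of fun i k => X (varH r m n hn i k)

/-- The vertical concatenation `V` as a matrix of polynomials. -/
def Vmat (K : Type*) [Field K] (r m n : ℕ) (hm : 0 < m) :
    Matrix (Fin (r * m)) (Fin n) (MvPolynomial (Fin r × Fin m × Fin n) K) :=
  Matrix.of fun k j => X (varV r m n hm k j)

/-- `tord` is a diagonal term order for the matrix of variables `v`: the leading
monomial of the determinant of every square submatrix (with strictly increasing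
rows and columns) is the product of its main diagonal entries. -/
def IsDiagonalFor (K : Type*) [Field K] {σ : Type*} (tord : TermOrder σ) {a b : ℕ}
    (v : Fin a → Fin b → σ) : Prop :=
  ∀ (t : ℕ) (rs : Fin t → Fin a) (cs : Fin t → Fin b), StrictMono rs → StrictMono cs →
    0 < t →
    IsLeadMono tord ((Matrix.of fun i j => (X (v (rs i) (cs j)) : MvPolynomial σ K)).det)
      (∑ i : Fin t, Finsupp.single (v (rs i) (cs i)) 1)

/-- A term order is diagonal for the double determinantal configuration if it is
diagonal for both the horizontal and the vertical concatenation. -/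
def IsDiagonalTermOrder (K : Type*) [Field K] (r m n : ℕ) (hm : 0 < m) (hn : 0 < n)
    (tord : TermOrder (Fin r × Fin m × Fin n)) : Prop :=
  IsDiagonalFor K tord (fun i k => varH r m n hn i k) ∧
    IsDiagonalFor K tord (fun k j => varV r m n hm k j)

/-- The double determinantal ideal `J = I_s(H) + I_t(V)`. -/
def doubleDetIdeal (K : Type*) [Field K] (r m n s t : ℕ) (hm : 0 < m) (hn : 0 < n) :
    Ideal (MvPolynomial (Fin r × Fin m × Fin n) K) :=
  Ideal.span (minorsSet s m (r * n) (Hmat K r m n hn) ∪ minorsSet t (r * m) n (Vmat K r m n hm))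

/-- `l` is a regular sequence on the ring `A`. -/
def IsRegSeq {A : Type*} [CommRing A] (l : List A) : Prop :=
  (∀ (i : ℕ) (h : i < l.length) (x : A),
      l.get ⟨i, h⟩ * x ∈ Ideal.span {a | a ∈ l.take i} →
      x ∈ Ideal.span {a | a ∈ l.take i}) ∧
  Ideal.span {a | a ∈ l} ≠ ⊤

/-- A quotient of a polynomial ring is (arithmetically) Cohen-Macaulay if it admits a
regular sequence, consisting of elements of the irrelevant maximal ideal, whose
length is the Krull dimension of the quotient. -/
def stdCM {σ K : Type*} [Field K] [Fintype σ] (I : Ideal (MvPolynomial σ K)) : Prop :=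
  ∃ l : List (MvPolynomial σ K ⧸ I),
    (∀ x ∈ l, x ∈ Ideal.map (Ideal.Quotient.mk I)
      (Ideal.span (Set.range (X : σ → MvPolynomial σ K)))) ∧
    IsRegSeq l ∧
    (l.length : WithBot ℕ∞) = ringKrullDim (MvPolynomial σ K ⧸ I)

noncomputable section

/-- leading diagonal -/
def Lead {σ : Type*} (ω : σ → ℕ) {t : ℕ} (v : Fin t → Fin t → σ) : Prop :=
  ∀ π : Equiv.Perm (Fin t), π ≠ 1 → ∑ i, ω (v i i) < ∑ i, ω (v (π i) i)

/-- tail of the determinant -/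
def GTail {σ S : Type*} [CommRing S] (ω : σ → ℕ) {t : ℕ} (v : Fin t → Fin t → σ)
    (τ : S) (y : σ → S) : S :=
  ∑ π ∈ (Finset.univ : Finset (Equiv.Perm (Fin t))).erase 1,
    ((Equiv.Perm.sign π : ℤ) : S) *
      (τ ^ (∑ i, ω (v (π i) i) - ∑ i, ω (v i i) - 1) * ∏ i, y (v (π i) i))

theorem map_GTail {σ S T : Type*} [CommRing S] [CommRing T] (q : S →+* T) (ω : σ → ℕ) {t : ℕ}
    (v : Fin t → Fin t → σ) (τ : S) (y : σ → S) :
    q (GTail ω v τ y) = GTail ω v (q τ) (fun s => q (y s)) := by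
  simp [GTail, map_sum, map_prod]

theorem det_lead {σ S : Type*} [CommRing S] (ω : σ → ℕ) {t : ℕ} (v : Fin t → Fin t → σ)
    (hv : Lead ω v) (τ : S) (y : σ → S) :
    (Matrix.of fun i j => τ ^ ω (v i j) * y (v i j)).det
      = τ ^ (∑ i, ω (v i i)) * (∏ i, y (v i i) + τ * GTail ω v τ y) := by
  rw [Matrix.det_apply', ← Finset.add_sum_erase _ _ (Finset.mem_univ 1), mul_add]
  congr 1
  · simp [Finset.prod_mul_distrib, Finset.prod_pow_eq_pow_sum]
  · rw [GTail, Finset.mul_sum, Finset.mul_sum]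
    refine Finset.sum_congr rfl fun π hπ => ?_
    have h := hv π (Finset.ne_of_mem_erase hπ)
    simp only [Matrix.of_apply, Finset.prod_mul_distrib, Finset.prod_pow_eq_pow_sum]
    have : ∑ i, ω (v (π i) i) = ∑ i, ω (v i i) +
      (1 + (∑ i, ω (v (π i) i) - ∑ i, ω (v i i) - 1)) := by omega
    rw [show τ ^ (∑ i, ω (v (π i) i)) = τ ^ (∑ i, ω (v i i)) * (τ *
      τ ^ (∑ i, ω (v (π i) i) - ∑ i, ω (v i i) - 1)) by
        rw [← pow_succ', ← pow_add]; congr 1; omega]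
    ring

theorem ps_fixed {C L : Type*} [Field L]
    (Φ : (C → PowerSeries L) → (C → PowerSeries L))
    (h : ∀ n w w', (∀ c, (PowerSeries.X : PowerSeries L) ^ n ∣ w c - w' c) →
      ∀ c, (PowerSeries.X : PowerSeries L) ^ (n + 1) ∣ Φ w c - Φ w' c) :
    ∃ w, Φ w = w := by
  let W : ℕ → C → PowerSeries L := fun k => Φ^[k] 0
  have hW : ∀ k, W (k+1) = Φ (W k) := fun k => Function.iterate_succ_apply' Φ k 0
  have h1 : ∀ k c, (PowerSeries.X : PowerSeries L) ^ k ∣ W (k+1) c - W k c := by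
    intro k
    induction k with
    | zero => intro c; simp
    | succ k ih => intro c; have := h _ _ _ ih c; rwa [← hW, ← hW] at this
  have h2 : ∀ k j c, (PowerSeries.X : PowerSeries L) ^ k ∣ W (k+j) c - W k c := by
    intro k j
    induction j with
    | zero => intro c; simp
    | succ j ih =>
      intro c
      have := dvd_add ((pow_dvd_pow _ (Nat.le_add_right k j)).trans (h1 (k+j) c)) (ih c)
      simpa [add_assoc] using this
  let w : C → PowerSeries L := fun c => PowerSeries.mk fun n => PowerSeries.coeff n (W (n+1) c)
  have h3 : ∀ n c, (PowerSeries.X : PowerSeries L) ^ n ∣ w c - W n c := by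
    intro n c
    rw [PowerSeries.X_pow_dvd_iff]
    intro j hj
    have := PowerSeries.X_pow_dvd_iff.1 (h2 (j+1) (n - (j+1)) c) j (by omega)
    rw [show j + 1 + (n - (j+1)) = n by omega] at this
    rw [map_sub, sub_eq_zero] at this ⊢
    rw [this]; simp [w]
  refine ⟨w, funext fun c => ?_⟩
  rw [← sub_eq_zero]
  ext n
  have a1 := h _ _ _ (h3 n) c
  rw [← hW] at a1
  have a2 := dvd_sub a1 (h3 (n+1) c)
  rw [sub_sub_sub_cancel_right] at a2
  simpa using PowerSeries.X_pow_dvd_iff.1 a2 n (by omega)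

theorem ps_lift {σ C L : Type*} [Field L] (ω : σ → ℕ) (cls : σ → Option C) (f : C → σ)
    (hf : ∀ c, cls (f c) = some c) (ξ : σ → L)
    (hξ : ∀ v c, cls v = some c → v ≠ f c → ξ v ≠ ξ (f c))
    (hξ0 : ∀ v, cls v = none → ξ v ≠ 0)
    (t : C → ℕ) (v : ∀ c, Fin (t c) → Fin (t c) → σ) (i0 : ∀ c, Fin (t c))
    (hlead : ∀ c, Lead ω (v c)) (hi0 : ∀ c, v c (i0 c) (i0 c) = f c)
    (hne : ∀ c i, i ≠ i0 c → ∀ c', v c i i ≠ f c') :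
    ∃ ζ : C → PowerSeries L, (∀ c, PowerSeries.constantCoeff (ζ c) = - ξ (f c)) ∧
      (∀ c, (Matrix.of fun i j => (PowerSeries.X : PowerSeries L) ^ ω (v c i j) *
        (PowerSeries.C (ξ (v c i j)) + (cls (v c i j)).elim 0 ζ)).det = 0) ∧
      (∀ s, (∀ c, s ≠ f c) →
        PowerSeries.constantCoeff (PowerSeries.C (ξ s) + (cls s).elim 0 ζ) ≠ 0) := by
  let Y : (C → PowerSeries L) → σ → PowerSeries L := fun w s =>
    PowerSeries.C (ξ s) + (cls s).elim 0 (fun c => PowerSeries.C (- ξ (f c)) + PowerSeries.X * w c)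
  have hY0 : ∀ w s, (∀ c, s ≠ f c) → PowerSeries.constantCoeff (Y w s) ≠ 0 := by
    intro w s hs
    cases hc : cls s with
    | none => simp only [Y, hc]; simpa using hξ0 s hc
    | some c =>
      simp only [Y, hc]
      simpa [← sub_eq_add_neg, sub_eq_zero] using hξ s c hc (hs c)
  let P : (C → PowerSeries L) → C → PowerSeries L := fun w c =>
    ∏ i ∈ Finset.univ.erase (i0 c), Y w (v c i i)
  have hP0 : ∀ w c, PowerSeries.constantCoeff (P w c) ≠ 0 := by
    intro w c
    rw [map_prod, Finset.prod_ne_zero_iff]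
    intro i hi
    exact hY0 w _ (hne c i (Finset.ne_of_mem_erase hi))
  let Φ : (C → PowerSeries L) → C → PowerSeries L := fun w c =>
    - GTail ω (v c) PowerSeries.X (Y w) * (P w c)⁻¹
  obtain ⟨w, hw⟩ := ps_fixed Φ (by
    intro n w w' hww c
    let q := Ideal.Quotient.mk (Ideal.span {(PowerSeries.X : PowerSeries L) ^ (n+1)})
    have hq : ∀ s, q (Y w s) = q (Y w' s) := by
      intro s
      rw [Ideal.Quotient.eq, Ideal.mem_span_singleton]
      cases hc : cls s with
      | none => simp [Y, hc]
      | some c =>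
        simp only [Y, hc, Option.elim_some]
        rw [show ∀ a b : PowerSeries L, a + (b + PowerSeries.X * w c) -
          (a + (b + PowerSeries.X * w' c)) = PowerSeries.X * (w c - w' c) by intros; ring, pow_succ']
        exact mul_dvd_mul_left _ (hww c)
    have hG : q (GTail ω (v c) PowerSeries.X (Y w)) = q (GTail ω (v c) PowerSeries.X (Y w')) := by
      rw [map_GTail, map_GTail]; simp only [hq]
    have hP : q (P w c) = q (P w' c) := by
      simp only [P, map_prod, hq]
    have e1 : q (P w c) * q (P w c)⁻¹ = 1 := by
      rw [← map_mul, PowerSeries.mul_inv_cancel _ (hP0 w c), map_one]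
    have e2 : q (P w' c) * q (P w' c)⁻¹ = 1 := by
      rw [← map_mul, PowerSeries.mul_inv_cancel _ (hP0 w' c), map_one]
    have hPi : q (P w c)⁻¹ = q (P w' c)⁻¹ := by
      calc q (P w c)⁻¹ = q (P w c)⁻¹ * (q (P w' c) * q (P w' c)⁻¹) := by rw [e2, mul_one]
        _ = (q (P w c) * q (P w c)⁻¹) * q (P w' c)⁻¹ := by rw [← hP]; ring
        _ = _ := by rw [e1, one_mul]
    rw [← Ideal.mem_span_singleton, ← Ideal.Quotient.eq]
    change q (Φ w c) = q (Φ w' c)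
    simp only [Φ, map_mul, map_neg, hG, hPi])
  refine ⟨fun c => PowerSeries.C (- ξ (f c)) + PowerSeries.X * w c, by intro c; simp, ?_, hY0 w⟩
  intro c
  have := det_lead ω (v c) (hlead c) PowerSeries.X (Y w)
  change (Matrix.of fun i j => (PowerSeries.X : PowerSeries L) ^ ω (v c i j) * Y w (v c i j)).det = 0
  rw [this]
  have e0 : Y w (f c) = PowerSeries.X * w c := by
    simp [Y, hf]
  rw [← Finset.mul_prod_erase _ _ (Finset.mem_univ (i0 c)), hi0, e0]
  have e1 : w c = - GTail ω (v c) PowerSeries.X (Y w) * (P w c)⁻¹ := (congrFun hw c).symm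
  have e2 : w c * P w c = - GTail ω (v c) PowerSeries.X (Y w) := by
    rw [e1, mul_assoc, PowerSeries.inv_mul_cancel _ (hP0 w c), mul_one]
  have : PowerSeries.X * w c * (∏ x ∈ Finset.univ.erase (i0 c), Y w (v c x x)) =
    PowerSeries.X * (w c * P w c) := by simp only [P]; ring
  rw [this, e2]; ring
end

noncomputable section

def NZI {R : Type*} [CommRing R] (y : R) (I : Ideal R) : Prop := ∀ a, y * a ∈ I → a ∈ I

def RS {R : Type*} [CommRing R] : Ideal R → List R → Prop
  | _, [] => True
  | I, x :: l => NZI x I ∧ RS (I ⊔ Ideal.span {x}) l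

def Good {R : Type*} [CommRing R] (y : R) : Ideal R → List R → Prop
  | _, [] => True
  | I, x :: l => NZI y I ∧ Good y (I ⊔ Ideal.span {x}) l

theorem exists_good {R : Type*} [CommRing R] [IsNoetherianRing R] (l : List R) :
    ∀ I : Ideal R, RS I l → ∃ F : Finset (Ideal R), (∀ p ∈ F, p.IsPrime) ∧
      (∀ p ∈ F, ∃ x ∈ l, x ∉ p) ∧ ∀ y, (∀ p ∈ F, y ∉ p) → Good y I l := by
  classical
  induction l with
  | nil => intro I _; exact ⟨∅, by simp, by simp, by intros; trivial⟩
  | cons x l ih =>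
    rintro I ⟨h1, h2⟩
    obtain ⟨F, hF1, hF2, hF3⟩ := ih _ h2
    have hfin := associatedPrimes.finite R (R ⧸ I)
    have key : ∀ y : R, (∀ p ∈ associatedPrimes R (R ⧸ I), y ∉ p) ↔ NZI y I := by
      intro y
      have := biUnion_associatedPrimes_eq_zero_divisors R (R ⧸ I)
      have h3 := Set.ext_iff.1 this y
      simp only [Set.mem_iUnion, SetLike.mem_coe, Set.mem_ofPred_eq, exists_prop] at h3
      rw [← not_iff_not]
      have : (¬ ∀ p ∈ associatedPrimes R (R ⧸ I), y ∉ p) ↔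
        ∃ p ∈ associatedPrimes R (R ⧸ I), y ∈ p := by push Not; rfl
      rw [this, h3]
      constructor
      · rintro ⟨a, ha, hya⟩ hc
        obtain ⟨a, rfl⟩ := Ideal.Quotient.mk_surjective a
        apply ha
        rw [Ideal.Quotient.eq_zero_iff_mem]
        apply hc
        rw [← Ideal.Quotient.eq_zero_iff_mem]
        exact hya
      · intro hc
        simp only [NZI, not_forall] at hc
        obtain ⟨a, ha, ha'⟩ := hc
        refine ⟨Ideal.Quotient.mk I a, ?_, ?_⟩
        · rwa [Ne, Ideal.Quotient.eq_zero_iff_mem]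
        · exact Ideal.Quotient.eq_zero_iff_mem.2 ha
    refine ⟨F ∪ hfin.toFinset, ?_, ?_, ?_⟩
    · intro p hp
      rcases Finset.mem_union.1 hp with hp | hp
      · exact hF1 p hp
      · rw [Set.Finite.mem_toFinset] at hp; exact hp.isPrime
    · intro p hp
      rcases Finset.mem_union.1 hp with hp | hp
      · obtain ⟨z, hz, hz'⟩ := hF2 p hp; exact ⟨z, List.mem_cons_of_mem _ hz, hz'⟩
      · rw [Set.Finite.mem_toFinset] at hp
        exact ⟨x, List.mem_cons_self, (key x).2 h1 p hp⟩
    · intro y hy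
      refine ⟨(key y).1 fun p hp => hy p (by simp [hp]), hF3 y fun p hp => hy p (by simp [hp])⟩

theorem rs_dropLast {R : Type*} [CommRing R] (y : R) (l : List R) :
    ∀ I : Ideal R, RS I l → Good y I l → RS (I ⊔ Ideal.span {y}) l.dropLast := by
  induction l with
  | nil => intros; trivial
  | cons x l ih =>
    rintro I ⟨h1, h2⟩ ⟨g1, g2⟩
    cases l with
    | nil => trivial
    | cons x2 l2 =>
      rw [List.dropLast_cons_cons]
      have h := ih _ h2 g2
      refine ⟨?_, by rwa [sup_right_comm]⟩
      intro a ha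
      have g3 := g2.1
      obtain ⟨i, hi, z, hz, e⟩ := Submodule.mem_sup.1 ha
      obtain ⟨b, rfl⟩ := Ideal.mem_span_singleton.1 hz
      have hb := g3 b (by
        rw [show y * b = x * a - i by rw [← e]; ring]
        exact sub_mem (Ideal.mul_mem_right _ _ (Ideal.mem_sup_right (Ideal.mem_span_singleton_self x)))
          (Ideal.mem_sup_left hi))
      obtain ⟨i', hi', z, hz, e'⟩ := Submodule.mem_sup.1 hb
      obtain ⟨c, rfl⟩ := Ideal.mem_span_singleton.1 hz
      have := h1 (a - y * c) (by
        rw [show x * (a - y * c) = i + y * i' by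
          rw [mul_sub, ← e, ← e']; ring]
        exact add_mem hi (Ideal.mul_mem_left _ _ hi'))
      rw [show a = (a - y * c) + y * c by ring]
      exact add_mem (Ideal.mem_sup_left this)
        (Ideal.mul_mem_right _ _ (Ideal.mem_sup_right (Ideal.mem_span_singleton_self y)))

theorem rs_descent {R R' : Type*} [CommRing R] [CommRing R'] [IsNoetherianRing R']
    (ι : R →+* R') (hc : ∀ (I : Ideal R) x, ι x ∈ I.map ι → x ∈ I) (m : Ideal R) (d : ℕ) :
    ∀ (I : Ideal R) (l' : List R'), l'.length = d → (∀ x ∈ l', x ∈ m.map ι) →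
      RS (I.map ι) l' → ∃ l : List R, l.length = d ∧ (∀ x ∈ l, x ∈ m) ∧ RS I l := by
  induction d with
  | zero => intro I l' _ _ _; exact ⟨[], rfl, by simp, trivial⟩
  | succ d ih =>
    intro I l' hl hm hrs
    obtain ⟨F, hF1, hF2, hF3⟩ := exists_good l' _ hrs
    have hav : ∃ y ∈ m, ∀ p ∈ F, ι y ∉ p := by
      by_contra hcon
      push Not at hcon
      have hsub : (m : Set R) ⊆ ⋃ p ∈ (F : Set (Ideal R')), (p.comap ι : Ideal R) := by
        intro y hy
        obtain ⟨p, hp, hyp⟩ := hcon y hy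
        simp only [Set.mem_iUnion]
        exact ⟨p, hp, hyp⟩
      obtain ⟨p, hp, hle⟩ := (Ideal.subset_union_prime (f := fun p : Ideal R' => p.comap ι)
        ⊥ ⊥ (fun p hp _ _ => by
          have := hF1 p hp
          exact Ideal.comap_isPrime ι p)).1 hsub
      obtain ⟨x, hx, hxp⟩ := hF2 p hp
      exact hxp (Ideal.map_le_iff_le_comap.2 hle (hm x hx))
    obtain ⟨y, hym, hy⟩ := hav
    have hg := hF3 _ hy
    have hd := rs_dropLast _ _ _ hrs hg
    have hmap : (I ⊔ Ideal.span {y}).map ι = I.map ι ⊔ Ideal.span {ι y} := by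
      rw [Ideal.map_sup, Ideal.map_span, Set.image_singleton]
    rw [← hmap] at hd
    obtain ⟨l, h1, h2, h3⟩ := ih _ _ (by simp [hl]) (fun x hx => hm x (List.dropLast_subset _ hx)) hd
    refine ⟨y :: l, by simp [h1], by simpa using ⟨hym, h2⟩, ?_, h3⟩
    intro a ha
    have hn : NZI (ι y) (I.map ι) := by
      cases l' with
      | nil => simp at hl
      | cons x l => exact hg.1
    apply hc
    apply hn
    rw [← map_mul]
    exact Ideal.mem_map_of_mem _ ha

theorem rs_get {R : Type*} [CommRing R] (l : List R) : ∀ (I : Ideal R), RS I l →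
    ∀ (i : ℕ) (h : i < l.length), NZI (l.get ⟨i, h⟩) (I ⊔ Ideal.span {a | a ∈ l.take i}) := by
  induction l with
  | nil => intro I _ i h; simp at h
  | cons x l ih =>
    rintro I ⟨h1, h2⟩ i hi
    cases i with
    | zero => simpa using h1
    | succ i =>
      have := ih _ h2 i (by simpa using hi)
      have e : I ⊔ Ideal.span {a | a ∈ (x :: l).take (i+1)} =
        I ⊔ Ideal.span {x} ⊔ Ideal.span {a | a ∈ l.take i} := by
        rw [sup_assoc, ← Ideal.span_union]
        congr 2
        ext a; simp
      rw [e]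
      exact this

theorem mem_span_map_mk {R : Type*} [CommRing R] (I : Ideal R) (l : List R) (x : R) :
    Ideal.Quotient.mk I x ∈ Ideal.span {a | a ∈ l.map (Ideal.Quotient.mk I)} ↔
      x ∈ I ⊔ Ideal.span {a | a ∈ l} := by
  have : {a | a ∈ l.map (Ideal.Quotient.mk I)} = (Ideal.Quotient.mk I) '' {a | a ∈ l} := by
    ext; simp
  rw [this, ← Ideal.map_span, ← Ideal.mem_comap,
    Ideal.comap_map_of_surjective _ Ideal.Quotient.mk_surjective, sup_comm, ← RingHom.ker_eq_comap_bot,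
    Ideal.mk_ker]

theorem rs_dim {R : Type*} [CommRing R] (m : Ideal R) (hm : m ≠ ⊤) (l : List R) :
    ∀ I : Ideal R, I ≤ m → (∀ x ∈ l, x ∈ m) → RS I l →
      (l.length : WithBot ℕ∞) ≤ ringKrullDim (R ⧸ I) := by
  induction l with
  | nil =>
    intro I hI _ _
    have : Nontrivial (R ⧸ I) := Ideal.Quotient.nontrivial_iff.2 (fun h => hm (top_le_iff.1 (h ▸ hI)))
    simpa using ringKrullDim_nonneg_of_nontrivial
  | cons x l ih =>
    rintro I hI hl ⟨h1, h2⟩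
    have a1 := ih (I ⊔ Ideal.span {x})
      (sup_le hI ((Ideal.span_singleton_le_iff_mem _).2 (hl x (by simp))))
      (fun y hy => hl y (by simp [hy])) h2
    have nzd : Ideal.Quotient.mk I x ∈ nonZeroDivisors (R ⧸ I) := by
      rw [mem_nonZeroDivisors_iff_right]
      intro a ha
      obtain ⟨a, rfl⟩ := Ideal.Quotient.mk_surjective a
      rw [← map_mul, Ideal.Quotient.eq_zero_iff_mem] at ha
      rw [Ideal.Quotient.eq_zero_iff_mem]
      exact h1 a (by rwa [mul_comm])
    have a2 := ringKrullDim_quotient_succ_le_of_nonZeroDivisor nzd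
    have e := ringKrullDim_eq_of_ringEquiv (DoubleQuot.quotQuotEquivQuotSup I (Ideal.span {x}))
    rw [Ideal.map_span, Set.image_singleton] at e
    rw [e] at a2
    refine le_trans ?_ a2
    push_cast [List.length_cons]
    gcongr
end

noncomputable section

structure Core {A B Ω β : Type*} [CommRing A] [CommRing B] [Field Ω] [Fintype β]
    (ι : A →+* B) (J : Ideal B) (b : β → B) : Prop where
  span : ∀ x, ∃ c : β → A, x - ∑ j, ι (c j) * b j ∈ J
  homs : ∃ (φ : β → (B →+* Ω)) (g : A →+* Ω), Function.Injective g ∧ Function.Injective φ ∧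
    (∀ i, ∀ x ∈ J, φ i x = 0) ∧ (∀ i a, φ i (ι a) = g a)

section
variable {A B Ω β : Type*} [CommRing A] [CommRing B] [Field Ω] [Fintype β]
    {ι : A →+* B} {J : Ideal B} {b : β → B}

theorem Core.key (h : Core (Ω := Ω) ι J b) : ∃ φ : β → (B →+* Ω), (∀ i, ∀ x ∈ J, φ i x = 0) ∧
    ∀ c : β → A, (∀ i, φ i (∑ j, ι (c j) * b j) = 0) → c = 0 := by
  classical
  obtain ⟨φ, g, hg, hφ, hJ, hA⟩ := h.homs
  refine ⟨φ, hJ, fun c hc => ?_⟩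
  have hdet : (Matrix.of fun i j => φ i (b j)).det ≠ 0 := by
    intro h0
    obtain ⟨u, hu, hu0⟩ := Matrix.exists_vecMul_eq_zero_iff.2 h0
    apply hu
    have hli := linearIndependent_monoidHom B Ω
    have hinj : Function.Injective fun i => (φ i : B →* Ω) := by
      intro i j hij
      apply hφ
      ext x
      exact DFunLike.congr_fun hij x
    have hli2 := hli.comp _ hinj
    rw [Fintype.linearIndependent_iff] at hli2
    funext i
    refine hli2 u ?_ i
    funext x
    obtain ⟨d, hd⟩ := h.span x
    have e : ∀ i, φ i x = ∑ j, g (d j) * φ i (b j) := by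
      intro i
      have := hJ i _ hd
      rw [map_sub, sub_eq_zero] at this
      rw [this, map_sum]
      simp [hA]
    have e2 : ∀ j, ∑ i, u i * φ i (b j) = 0 := by
      intro j
      simpa [Matrix.vecMul, dotProduct] using congrFun hu0 j
    simp only [Function.comp, Finset.sum_apply, Pi.smul_apply, smul_eq_mul, Pi.zero_apply,
      MonoidHom.coe_coe, e, Finset.mul_sum]
    rw [Finset.sum_comm]
    apply Finset.sum_eq_zero
    intro j _
    calc _ = g (d j) * ∑ i, u i * φ i (b j) := by
          rw [Finset.mul_sum]; exact Finset.sum_congr rfl fun i _ => by ring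
      _ = 0 := by rw [e2, mul_zero]
  by_contra hne
  apply hdet
  refine Matrix.exists_mulVec_eq_zero_iff.1 ⟨fun j => g (c j), ?_, ?_⟩
  · intro h0
    apply hne
    funext j
    apply hg
    simpa using congrFun h0 j
  · funext i
    have := hc i
    simp only [map_sum, map_mul, hA] at this
    simp only [Matrix.mulVec, dotProduct, Matrix.of_apply, Pi.zero_apply]
    rw [← this]
    exact Finset.sum_congr rfl fun i _ => by ring

theorem Core.unique (h : Core (Ω := Ω) ι J b) (c d : β → A)
    (hcd : ∑ j, ι (c j) * b j - ∑ j, ι (d j) * b j ∈ J) : c = d := by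
  obtain ⟨φ, h1, h2⟩ := h.key
  rw [← sub_eq_zero]
  apply h2
  intro i
  rw [← h1 i _ hcd]
  simp [sub_mul, Finset.sum_sub_distrib]

theorem Core.radical (h : Core (Ω := Ω) ι J b) : J.IsRadical := by
  obtain ⟨φ, h1, h2⟩ := h.key
  rintro x ⟨n, hn⟩
  have hx : ∀ i, φ i x = 0 := fun i => by
    have := h1 i _ hn
    rw [map_pow] at this
    exact eq_zero_of_pow_eq_zero this
  obtain ⟨c, hc⟩ := h.span x
  have : c = 0 := h2 c fun i => by
    have := h1 i _ hc
    rw [map_sub, hx, zero_sub, neg_eq_zero] at this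
    exact this
  simpa [this] using hc

theorem Core.mem_sup (h : Core (Ω := Ω) ι J b) (I : Ideal A) (c : β → A) (x : B)
    (hx : x - ∑ j, ι (c j) * b j ∈ J) : x ∈ J ⊔ I.map ι ↔ ∀ j, c j ∈ I := by
  constructor
  · intro hm
    have key : ∀ z ∈ I.map ι, ∃ d : β → A, (∀ j, d j ∈ I) ∧ z - ∑ j, ι (d j) * b j ∈ J := by
      intro z hz
      refine Submodule.span_induction ?_ ?_ ?_ ?_ hz
      · rintro _ ⟨a, ha, rfl⟩
        obtain ⟨e, he⟩ := h.span 1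
        refine ⟨fun j => a * e j, fun j => I.mul_mem_right _ ha, ?_⟩
        have := J.mul_mem_left (ι a) he
        simpa [mul_sub, Finset.mul_sum, mul_assoc] using this
      · exact ⟨0, fun _ => I.zero_mem, by simp⟩
      · rintro p q _ _ ⟨d, hd, hd'⟩ ⟨e, he, he'⟩
        refine ⟨d + e, fun j => add_mem (hd j) (he j), ?_⟩
        have := add_mem hd' he'
        simpa [add_mul, Finset.sum_add_distrib, add_sub_add_comm] using this
      · rintro r p _ ⟨d, hd, hd'⟩
        choose e he using fun j => h.span (r * b j)
        refine ⟨fun k => ∑ j, d j * e j k, fun k => I.sum_mem fun j _ => I.mul_mem_right _ (hd j), ?_⟩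
        have h1 := J.mul_mem_left r hd'
        have h2 : ∑ j, ι (d j) * (r * b j - ∑ k, ι (e j k) * b k) ∈ J :=
          J.sum_mem fun j _ => J.mul_mem_left _ (he j)
        have := add_mem h1 h2
        convert this using 1
        simp only [smul_eq_mul, mul_sub, Finset.mul_sum, Finset.sum_sub_distrib, map_sum, map_mul,
          Finset.sum_mul]
        rw [Finset.sum_comm]
        have : ∑ i, r * (ι (d i) * b i) = ∑ i, ι (d i) * (r * b i) :=
          Finset.sum_congr rfl fun i _ => by ring
        rw [this]
        simp [mul_assoc]
    obtain ⟨p, hp, z, hz, rfl⟩ := Submodule.mem_sup.1 hm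
    obtain ⟨d, hd, hd'⟩ := key z hz
    have : d = c := h.unique _ _ (by
      have := sub_mem (sub_mem hx hd') hp
      convert this using 1
      ring)
    rw [← this]; exact hd
  · intro hc
    rw [show x = (x - ∑ j, ι (c j) * b j) + ∑ j, ι (c j) * b j by ring]
    exact add_mem (Ideal.mem_sup_left hx) (Ideal.mem_sup_right (Ideal.sum_mem _ fun j _ =>
      Ideal.mul_mem_right _ _ (Ideal.mem_map_of_mem _ (hc j))))

theorem Core.nzi (h : Core (Ω := Ω) ι J b) (I : Ideal A) (θ : A) (hθ : NZI θ I) :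
    NZI (ι θ) (J ⊔ I.map ι) := by
  intro x hx
  obtain ⟨c, hc⟩ := h.span x
  rw [h.mem_sup I c x hc]
  have h1 := (h.mem_sup I (fun j => θ * c j) (ι θ * x) (by
    have := J.mul_mem_left (ι θ) hc
    simpa [mul_sub, Finset.mul_sum, mul_assoc] using this)).1 hx
  exact fun j => hθ _ (h1 j)

theorem Core.rs (h : Core (Ω := Ω) ι J b) (l : List A) : ∀ (I : Ideal A), RS I l →
    RS (J ⊔ I.map ι) (l.map ι) := by
  induction l with
  | nil => intros; trivial
  | cons x l ih =>
    rintro I ⟨h1, h2⟩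
    refine ⟨h.nzi I x h1, ?_⟩
    have := ih _ h2
    rw [Ideal.map_sup, Ideal.map_span, Set.image_singleton, ← sup_assoc] at this
    exact this

theorem dim_le_of_integral {A B : Type*} [CommRing A] [CommRing B] (f : A →+* B)
    (hf : f.IsIntegral) : ringKrullDim B ≤ ringKrullDim A := by
  let _ := f.toAlgebra
  have : Algebra.IsIntegral A B := ⟨hf⟩
  refine Order.krullDim_le_of_strictMono (PrimeSpectrum.comap f) ?_
  intro p q hpq
  have := p.isPrime
  exact Ideal.IsIntegral.comap_lt_comap (R := A) (A := B) (I := p.asIdeal) (J := q.asIdeal) hpq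

theorem Core.dim_le (h : Core (Ω := Ω) ι J b) : ringKrullDim (B ⧸ J) ≤ ringKrullDim A := by
  classical
  refine dim_le_of_integral ((Ideal.Quotient.mk J).comp ι) ?_
  let _ := ((Ideal.Quotient.mk J).comp ι).toAlgebra
  have : Module.Finite A (B ⧸ J) := by
    refine ⟨⟨Finset.univ.image (fun j => Ideal.Quotient.mk J (b j)), ?_⟩⟩
    rw [eq_top_iff]
    rintro x -
    obtain ⟨x, rfl⟩ := Ideal.Quotient.mk_surjective x
    obtain ⟨c, hc⟩ := h.span x
    rw [← Ideal.Quotient.eq] at hc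
    rw [hc, map_sum]
    refine Submodule.sum_mem _ fun j _ => ?_
    rw [map_mul]
    exact Submodule.smul_mem _ (c j) (Submodule.subset_span (by simp))
  exact fun x => Algebra.IsIntegral.isIntegral (R := A) x
end

theorem rs_X {s k : Type*} [Field k] (l : List s) : ∀ (T : Set s), l.Nodup → (∀ v ∈ l, v ∉ T) →
    RS (Ideal.span ((X : s → MvPolynomial s k) '' T)) (l.map X) := by
  classical
  induction l with
  | nil => intros; trivial
  | cons x l ih =>
    intro T hn hT
    rw [List.nodup_cons] at hn
    refine ⟨?_, ?_⟩
    · intro a ha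
      rw [mem_ideal_span_X_image] at ha ⊢
      intro d hd
      have : d + Finsupp.single x 1 ∈ (X x * a : MvPolynomial s k).support := by
        rw [mem_support_iff, add_comm, coeff_X_mul']
        simpa using hd
      obtain ⟨i, hi, hi'⟩ := ha _ this
      refine ⟨i, hi, ?_⟩
      have hne : x ≠ i := fun e => hT x (by simp) (e ▸ hi)
      simpa [Finsupp.single_apply, hne] using hi'
    · have := ih (insert x T) hn.2 (by
        intro v hv
        rw [Set.mem_insert_iff, not_or]
        exact ⟨fun e => hn.1 (e ▸ hv), hT v (by simp [hv])⟩)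
      rwa [Set.image_insert_eq, Set.insert_eq, Ideal.span_union, sup_comm] at this
end

noncomputable section

theorem ff_mvpoly (σ K K' : Type*) [Field K] [Field K'] [Algebra K K'] :
    (MvPolynomial.map (σ := σ) (algebraMap K K')).FaithfullyFlat := by
  let _ : Algebra (MvPolynomial σ K) (MvPolynomial σ K') := algebraMvPolynomial
  have : Module.FaithfullyFlat (MvPolynomial σ K) (MvPolynomial σ K') :=
    Module.FaithfullyFlat.of_linearEquiv (MvPolynomial σ K) (TensorProduct K (MvPolynomial σ K) K')
      (Algebra.IsPushout.equiv K (MvPolynomial σ K) K' (MvPolynomial σ K')).symm.toLinearEquiv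
  exact (RingHom.faithfullyFlat_algebraMap_iff (R := MvPolynomial σ K)).2 this

theorem dim_le_ff {R S : Type*} [CommRing R] [CommRing S] (f : R →+* S) (hf : f.FaithfullyFlat)
    (J : Ideal R) : ringKrullDim (R ⧸ J) ≤ ringKrullDim (S ⧸ J.map f) := by
  let _ := f.toAlgebra
  have : Module.FaithfullyFlat R S := hf
  rw [ringKrullDim_quotient, ringKrullDim_quotient]
  refine iSup_le fun l => ?_
  let l1 : LTSeries (PrimeSpectrum R) := l.map Subtype.val (fun _ _ h => h)
  obtain ⟨P, hP, hlo⟩ := Ideal.exists_isPrime_liesOver_of_faithfullyFlat (A := R) (B := S) l1.last.asIdeal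
  obtain ⟨L, hL1, hL2, hL3⟩ := Ideal.exists_ltSeries_of_hasGoingDown (S := S) l1 P
  have hmem : ∀ i, L i ∈ PrimeSpectrum.zeroLocus (J.map f : Set S) := by
    intro i
    have h1 : PrimeSpectrum.comap (algebraMap R S) (L i) ∈ l1.toList := by
      rw [← hL3]
      exact List.mem_map_of_mem (RelSeries.mem_toList.2 ⟨i, rfl⟩)
    obtain ⟨j, hj⟩ := RelSeries.mem_toList.1 h1
    have h2 : (l j).1 = PrimeSpectrum.comap (algebraMap R S) (L i) := hj
    have h3 := (l j).2
    rw [h2] at h3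
    rw [PrimeSpectrum.mem_zeroLocus] at h3 ⊢
    exact Ideal.map_le_iff_le_comap.2 h3
  let L2 : LTSeries (PrimeSpectrum.zeroLocus (J.map f : Set S)) :=
    ⟨L.length, fun i => ⟨L i, hmem i⟩, fun i => L.step i⟩
  have : (l.length : WithBot ℕ∞) = (L2.length : WithBot ℕ∞) := by
    have : L2.length = l.length := hL1
    rw [this]
  rw [this]
  exact Order.LTSeries.length_le_krullDim L2

theorem contract_ff {R S : Type*} [CommRing R] [CommRing S] (f : R →+* S) (hf : f.FaithfullyFlat)
    (I : Ideal R) (x : R) (hx : f x ∈ I.map f) : x ∈ I := by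
  let _ := f.toAlgebra
  have : Module.FaithfullyFlat R S := hf
  rw [← Ideal.comap_map_eq_self_of_faithfullyFlat (B := S) I]
  exact hx
end

noncomputable section

theorem irr_ne_top (σ K : Type*) [Field K] :
    Ideal.span (Set.range (X : σ → MvPolynomial σ K)) ≠ ⊤ := by
  intro h
  have h1 : (1 : MvPolynomial σ K) ∈ RingHom.ker (constantCoeff (σ := σ) (R := K)) := by
    have : Ideal.span (Set.range (X : σ → MvPolynomial σ K)) ≤
        RingHom.ker (constantCoeff (σ := σ) (R := K)) := by
      rw [Ideal.span_le]
      rintro _ ⟨i, rfl⟩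
      simp
    apply this
    rw [h]; trivial
  simp at h1

theorem core_conclusion {σ s K K' Ω β : Type*} [Field K] [Field K'] [Algebra K K'] [Field Ω]
    [Fintype σ] [Fintype s] [Fintype β]
    (J : Ideal (MvPolynomial σ K)) (hJ : J ≤ Ideal.span (Set.range (X : σ → MvPolynomial σ K)))
    (ιA : MvPolynomial s K' →+* MvPolynomial σ K') (b : β → MvPolynomial σ K')
    (hθ : ∀ v, ιA (X v) ∈ Ideal.span (Set.range (X : σ → MvPolynomial σ K')))
    (h : Core (Ω := Ω) ιA (J.map (MvPolynomial.map (algebraMap K K'))) b) :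
    IsReduced (MvPolynomial σ K ⧸ J) ∧ stdCM J := by
  have hff := ff_mvpoly σ K K'
  have hmm : (Ideal.span (Set.range (X : σ → MvPolynomial σ K))).map
      (MvPolynomial.map (algebraMap K K')) = Ideal.span (Set.range (X : σ → MvPolynomial σ K')) := by
    rw [Ideal.map_span, ← Set.range_comp]
    congr 2
    funext i; simp
  refine ⟨?_, ?_⟩
  · rw [← Ideal.isRadical_iff_quotient_reduced]
    rintro x ⟨n, hn⟩
    apply contract_ff _ hff
    apply h.radical
    exact ⟨n, by rw [← map_pow]; exact Ideal.mem_map_of_mem _ hn⟩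
  · have hrs := rs_X (k := K') (Finset.univ : Finset s).toList ∅ (Finset.nodup_toList _) (by simp)
    rw [Set.image_empty, Ideal.span_empty] at hrs
    have h2 := h.rs _ _ hrs
    rw [Ideal.map_bot, sup_bot_eq] at h2
    obtain ⟨l, hl1, hl2, hl3⟩ := rs_descent _ (contract_ff _ hff)
      (Ideal.span (Set.range (X : σ → MvPolynomial σ K))) (Fintype.card s) J _ (by simp) (by
        intro x hx
        simp only [List.map_map, List.mem_map, Function.comp] at hx
        obtain ⟨v, -, rfl⟩ := hx
        rw [hmm]; exact hθ v) h2
    refine ⟨l.map (Ideal.Quotient.mk J), ?_, ⟨?_, ?_⟩, ?_⟩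
    · intro x hx
      obtain ⟨y, hy, rfl⟩ := List.mem_map.1 hx
      exact Ideal.mem_map_of_mem _ (hl2 y hy)
    · intro i hi x hx
      obtain ⟨x, rfl⟩ := Ideal.Quotient.mk_surjective x
      rw [← List.map_take] at hx ⊢
      rw [mem_span_map_mk]
      have hi' : i < l.length := by simpa using hi
      apply rs_get l J hl3 i hi'
      rw [← mem_span_map_mk, map_mul]
      simpa using hx
    · intro htop
      have h1 : Ideal.Quotient.mk J 1 ∈ Ideal.span {a | a ∈ l.map (Ideal.Quotient.mk J)} := by
        rw [htop]; trivial
      rw [mem_span_map_mk] at h1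
      apply irr_ne_top σ K
      rw [Ideal.eq_top_iff_one]
      exact (sup_le hJ (Ideal.span_le.2 hl2)) h1
    · rw [List.length_map]
      apply le_antisymm
      · exact rs_dim _ (irr_ne_top σ K) l J hJ hl2 hl3
      · refine (dim_le_ff _ hff J).trans (h.dim_le.trans ?_)
        rw [MvPolynomial.ringKrullDim_of_isNoetherianRing, hl1]
        simp
end

noncomputable section

theorem spanning {σ C A B O : Type*} [Finite σ] [CommRing A] [CommRing B] [CommRing O]
    [IsLocalRing O] [Algebra O B] (ι : A →+* B) (τ : O) (hτ : τ ∈ IsLocalRing.maximalIdeal O)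
    (hO : ∀ o : O, ∃ a, ι a = algebraMap O B o) (J : Ideal B) (ω : σ → ℕ)
    (cls : σ → Option C) (base : C → σ) (hbase : ∀ c, cls (base c) = some c) (Y : σ → B) (α : σ → A)
    (hα : ∀ v, Y v = (cls v).elim 0 (fun c => Y (base c)) + ι (α v))
    (Bs : Set (Multiset C)) [Fintype Bs]
    (h1 : ∀ S ∉ Bs, ∃ (t : ℕ) (v : Fin t → Fin t → σ) (d : Fin t → C),
      (∀ i, cls (v i i) = some (d i)) ∧ Multiset.map d Finset.univ.val ≤ S ∧
      ∏ i, Y (v i i) + algebraMap O B τ * GTail ω v (algebraMap O B τ) Y ∈ J)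
    (S : Multiset σ) :
    ∃ c : Bs → A, (S.map Y).prod - ∑ j, ι (c j) * (j.1.map (fun c => Y (base c))).prod ∈ J := by
  classical
  let z : C → B := fun c => Y (base c)
  let Yr : σ → B := fun v => (cls v).elim 0 z
  let N : Submodule O B :=
    { carrier := {x | ∃ c : Bs → A, x - ∑ j, ι (c j) * (j.1.map z).prod ∈ J}
      zero_mem' := ⟨0, by simp⟩
      add_mem' := by
        rintro p q ⟨d, hd'⟩ ⟨e, he'⟩
        refine ⟨d + e, ?_⟩
        have := add_mem hd' he'
        simpa [add_mul, Finset.sum_add_distrib, add_sub_add_comm] using this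
      smul_mem' := by
        rintro o x ⟨d, hd⟩
        obtain ⟨a, ha⟩ := hO o
        refine ⟨fun j => a * d j, ?_⟩
        have := J.mul_mem_left (ι a) hd
        rw [Algebra.smul_def, ← ha]
        simpa [mul_sub, Finset.mul_sum, mul_assoc] using this }
  have hNJ : ∀ x ∈ J, x ∈ N := fun x hx => ⟨0, by simpa using hx⟩
  have hNA : ∀ a, ∀ x ∈ N, ι a * x ∈ N := by
    rintro a x ⟨d, hd⟩
    refine ⟨fun j => a * d j, ?_⟩
    have := J.mul_mem_left (ι a) hd
    simpa [mul_sub, Finset.mul_sum, mul_assoc] using this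
  have hNb : ∀ S ∈ Bs, (S.map z).prod ∈ N := by
    intro S hS
    refine ⟨Pi.single ⟨S, hS⟩ 1, ?_⟩
    rw [Finset.sum_eq_single ⟨S, hS⟩]
    · simp
    · intro j _ hj; simp [hj]
    · simp
  suffices h : ∀ n, ∀ S : Multiset σ, S.card = n → (S.map Y).prod ∈ N from h _ S rfl
  intro n
  induction n using Nat.strong_induction_on with
  | _ n ih =>
  have hred : ∀ T : Multiset σ, (T.map Yr).prod = 0 ∨ ∃ U : Multiset C, U.card = T.card ∧
      (T.map Yr).prod = (U.map z).prod := by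
    intro T
    induction T using Multiset.induction_on with
    | empty => right; exact ⟨0, by simp, by simp⟩
    | cons v T ihT =>
      cases hc : cls v with
      | none => left; simp [Yr, hc]
      | some c =>
        rcases ihT with h | ⟨U, hU, hU'⟩
        · left; simp [h]
        · right; refine ⟨c ::ₘ U, by simp [hU], ?_⟩
          simp [Yr, hc, hU']
  have hzY : ∀ U : Multiset C, (U.map z).prod = ((U.map base).map Y).prod := by
    intro U; simp [z, Multiset.map_map]
  -- step (a)
  have stepa : ∀ S T : Multiset σ, S.card + T.card = n →
      (S.map Y).prod * (T.map Yr).prod - ((S + T).map Yr).prod ∈ N := by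
    intro S
    induction S using Multiset.induction_on with
    | empty => intro T _; simp
    | cons v S ihS =>
      intro T hT
      simp only [Multiset.card_cons] at hT
      have e1 := ihS (v ::ₘ T) (by simp; omega)
      have e2 : ι (α v) * ((S.map Y).prod * (T.map Yr).prod) ∈ N := by
        apply hNA
        rcases hred T with h | ⟨U, hU, hU'⟩
        · rw [h, mul_zero]; exact N.zero_mem
        · rw [hU', hzY, ← Multiset.prod_add, ← Multiset.map_add]
          exact ih (n-1) (by omega) _ (by simp [hU]; omega)
      have := add_mem e1 e2
      convert this using 1
      simp only [Multiset.map_cons, Multiset.prod_cons, Multiset.map_add, Multiset.prod_add]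
      rw [hα v]
      change (Yr v + _) * _ * _ - _ = _
      ring
  let W : Submodule O B := Submodule.span O (Set.range fun S : Sym σ n => (S.1.map Y).prod)
  have hW : ∀ S : Multiset σ, S.card = n → (S.map Y).prod ∈ W := fun S hS =>
    Submodule.subset_span ⟨⟨S, hS⟩, rfl⟩
  have stepb : ∀ U : Multiset C, U.card = n → (U.map z).prod ∈ N ⊔ IsLocalRing.maximalIdeal O • W := by
    intro U hU
    by_cases hB : U ∈ Bs
    · exact Submodule.mem_sup_left (hNb U hB)
    obtain ⟨t, v, d, hd, hle, hJ⟩ := h1 U hB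
    obtain ⟨U', rfl⟩ := Multiset.le_iff_exists_add.1 hle
    have hcard : t + U'.card = n := by simpa using hU
    have a1 := stepa (Multiset.map (fun i => v i i) Finset.univ.val) (U'.map base) (by simpa using hcard)
    have a2 : (((Multiset.map (fun i => v i i) Finset.univ.val).map Yr)).prod =
        ((Multiset.map d Finset.univ.val).map z).prod := by
      rw [Multiset.map_map, Multiset.map_map]
      congr 1
      refine Multiset.map_congr rfl fun i _ => ?_
      simp [Yr, hd]
    have a3 : ((U'.map base).map Yr).prod = (U'.map z).prod := by
      rw [Multiset.map_map]
      congr 1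
      refine Multiset.map_congr rfl fun i _ => ?_
      simp [Yr, hbase]
    have a4 : (((Multiset.map (fun i => v i i) Finset.univ.val).map Y)).prod = ∏ i, Y (v i i) := by
      rw [Multiset.map_map]; rfl
    rw [Multiset.map_add, Multiset.prod_add, a2, a3, a4, ← Multiset.prod_add, ← Multiset.map_add] at a1
    have a5 := hNJ _ (J.mul_mem_right (U'.map z).prod hJ)
    have a6 : GTail ω v (algebraMap O B τ) Y * (U'.map z).prod ∈ W := by
      rw [GTail, Finset.sum_mul]
      refine W.sum_mem fun π _ => ?_
      have : (∏ i, Y (v (π i) i)) * (U'.map z).prod ∈ W := by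
        have a7 : (((Multiset.map (fun i => v (π i) i) Finset.univ.val).map Y)).prod =
          ∏ i, Y (v (π i) i) := by rw [Multiset.map_map]; rfl
        rw [← a7, hzY, ← Multiset.prod_add, ← Multiset.map_add]
        exact hW _ (by simpa using hcard)
      have := W.smul_mem (((Equiv.Perm.sign π : ℤ) : O) *
        τ ^ (∑ i, ω (v (π i) i) - ∑ i, ω (v i i) - 1)) this
      rw [Algebra.smul_def] at this
      convert this using 1
      simp only [map_mul, map_pow, map_intCast]
      ring
    have a7 : algebraMap O B τ * (GTail ω v (algebraMap O B τ) Y * (U'.map z).prod) ∈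
        IsLocalRing.maximalIdeal O • W := by
      rw [← Algebra.smul_def]; exact Submodule.smul_mem_smul hτ a6
    have := sub_mem (Submodule.mem_sup_left (T := IsLocalRing.maximalIdeal O • W) (sub_mem a5 a1))
      (Submodule.mem_sup_right (S := N) a7)
    convert this using 1
    ring
  have hWN : W ≤ N := by
    apply Submodule.le_of_le_smul_of_le_jacobson_bot (I := IsLocalRing.maximalIdeal O)
    · exact Submodule.fg_span (Set.finite_range _)
    · exact (IsLocalRing.jacobson_eq_maximalIdeal _ bot_ne_top).ge
    · rw [Submodule.span_le]
      rintro _ ⟨S, rfl⟩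
      have a := stepa S.1 0 (by simp)
      simp only [Multiset.map_zero, Multiset.prod_zero, mul_one, add_zero] at a
      change (S.1.map Y).prod ∈ _
      rw [show ((S.1.map Y).prod : B) = ((S.1.map Y).prod - (S.1.map Yr).prod) +
        (S.1.map Yr).prod by ring]
      refine add_mem (Submodule.mem_sup_left a) ?_
      rcases hred S.1 with h | ⟨U, hU, hU'⟩
      · rw [h]; exact Submodule.zero_mem _
      · rw [hU']; exact stepb U (by rw [hU]; exact S.2)
  exact fun S hS => hWN (hW S hS)
end

noncomputable section

theorem ps_mvpoly_inj {s K L : Type*} [Field K] [Field L] [Algebra K L] (ξ : s → L)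
    (hξ : AlgebraicIndependent K ξ) :
    Function.Injective (eval₂Hom (PowerSeries.map (algebraMap K L))
      (fun v => (PowerSeries.C (ξ v) : PowerSeries L)) :
        MvPolynomial s (PowerSeries K) →+* PowerSeries L) := by
  classical
  rw [injective_iff_map_eq_zero]
  intro p hp
  ext d k
  have h1 : ∀ k, aeval ξ (∑ d ∈ p.support, monomial d (PowerSeries.coeff k (p.coeff d))) = 0 := by
    intro k
    have := congrArg (PowerSeries.coeff k) hp
    rw [map_zero] at this
    rw [← this, map_sum]
    conv_rhs => rw [coe_eval₂Hom, eval₂_eq, map_sum]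
    refine Finset.sum_congr rfl fun d _ => ?_
    rw [aeval_monomial]
    have : (∏ i ∈ d.support, PowerSeries.C (ξ i) ^ d i : PowerSeries L) =
      PowerSeries.C (d.prod fun i e => ξ i ^ e) := by
      simp [Finsupp.prod, map_prod]
    rw [this, PowerSeries.coeff_mul_C, PowerSeries.coeff_map]
  have h2 := (algebraicIndependent_iff.1 hξ) _ (h1 k)
  have h3 := congrArg (MvPolynomial.coeff d) h2
  rw [coeff_sum] at h3
  simp only [coeff_monomial, Finset.sum_ite_eq', coeff_zero] at h3
  by_cases hd : d ∈ p.support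
  · simpa [hd] using h3
  · simp [notMem_support_iff.1 hd]

theorem ps_mvpoly_inj' {s K L : Type*} [Field K] [Field L] [Algebra K L] (ξ : s → L)
    (hξ : AlgebraicIndependent K ξ)
    (κ : FractionRing (PowerSeries K) →+* FractionRing (PowerSeries L))
    (hκ : ∀ o, κ (algebraMap _ _ o) = algebraMap _ _ (PowerSeries.map (algebraMap K L) o)) :
    Function.Injective (eval₂Hom κ (fun v => algebraMap _ _ (PowerSeries.C (ξ v) : PowerSeries L)) :
        MvPolynomial s (FractionRing (PowerSeries K)) →+* FractionRing (PowerSeries L)) := by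
  rw [injective_iff_map_eq_zero]
  intro p hp
  let _ : Algebra (MvPolynomial s (PowerSeries K)) (MvPolynomial s (FractionRing (PowerSeries K))) :=
    algebraMvPolynomial
  obtain ⟨⟨x, m⟩, hx⟩ := IsLocalization.surj
    (Submonoid.map (C (σ := s)) (nonZeroDivisors (PowerSeries K))) p
  obtain ⟨o, ho, hom⟩ := m.2
  have hmap : ∀ q : MvPolynomial s (PowerSeries K),
      eval₂Hom κ (fun v => algebraMap _ _ (PowerSeries.C (ξ v) : PowerSeries L))
        (MvPolynomial.map (algebraMap _ _) q) = algebraMap _ _ (eval₂Hom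
        (PowerSeries.map (algebraMap K L)) (fun v => (PowerSeries.C (ξ v) : PowerSeries L)) q) := by
    intro q
    rw [coe_eval₂Hom, coe_eval₂Hom, eval₂_map, ← coe_eval₂Hom, ← coe_eval₂Hom, ← RingHom.comp_apply]
    congr 1
    apply MvPolynomial.ringHom_ext
    · intro r; simp [hκ]
    · intro i; simp
  have hx' : p * C (algebraMap _ _ o) = MvPolynomial.map (algebraMap _ _) x := by
    have hx2 : p * MvPolynomial.map (algebraMap (PowerSeries K) (FractionRing (PowerSeries K)))
      (m : MvPolynomial s (PowerSeries K)) = MvPolynomial.map (algebraMap _ _) x := hx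
    rwa [← hom, map_C] at hx2
  have h1 := hmap x
  rw [← hx', map_mul, hp, zero_mul] at h1
  have h2 : x = 0 := by
    apply ps_mvpoly_inj ξ hξ
    rw [map_zero]
    apply IsFractionRing.injective (PowerSeries L) (FractionRing (PowerSeries L))
    rw [← h1, map_zero]
  rw [h2, map_zero] at hx'
  rcases mul_eq_zero.1 hx' with h | h
  · exact h
  · exfalso
    rw [C_eq_zero] at h
    have h3 : o = 0 := by
      apply IsFractionRing.injective (PowerSeries K) (FractionRing (PowerSeries K))
      rw [h, map_zero]
    exact nonZeroDivisors.ne_zero ho h3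
end

noncomputable section
universe u

theorem main_abstract {σ Γ : Type} {K : Type u} [Field K] [Fintype σ] [Finite Γ]
    (J : Ideal (MvPolynomial σ K)) (hJ : J ≤ Ideal.span (Set.range (X : σ → MvPolynomial σ K)))
    (ω : σ → ℕ) (cls : σ → Option Γ) (base : Γ → σ) (hbase : ∀ c, cls (base c) = some c)
    (Bs : Set (Multiset Γ))
    (h1 : ∀ S ∉ Bs, ∃ (t : ℕ) (v : Fin t → Fin t → σ) (d : Fin t → Γ),
      (∀ i, cls (v i i) = some (d i)) ∧ Multiset.map d Finset.univ.val ≤ S ∧ Lead ω v ∧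
      (Matrix.of fun i j => (X (v i j) : MvPolynomial σ K)).det ∈ J)
    (f : Bs → Γ → σ) (hf : ∀ S c, cls (f S c) = some c) (hfinj : Function.Injective f)
    (h2 : ∀ (S : Bs) (L : Type u) [Field L] [Algebra K L] (ξ : σ → L),
      (∀ v v' c, cls v = some c → cls v' = some c → v ≠ v' → ξ v ≠ ξ v') →
      (∀ v, cls v = none → ξ v ≠ 0) →
      ∃ ζ : Γ → PowerSeries L, (∀ c, PowerSeries.constantCoeff (ζ c) = - ξ (f S c)) ∧
        ∀ p ∈ J, eval₂ ((PowerSeries.C (R := L)).comp (algebraMap K L)) (fun v =>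
          PowerSeries.X ^ ω v * (PowerSeries.C (ξ v) + (cls v).elim 0 ζ)) p = 0) :
    IsReduced (MvPolynomial σ K ⧸ J) ∧ stdCM J := by
  classical
  have hfinite : Finite Bs := Finite.of_injective f hfinj
  let _ : Fintype Bs := Fintype.ofFinite _
  let s := {v : σ // ∀ c, v ≠ base c}
  let K' := FractionRing (PowerSeries K)
  let L := FractionRing (MvPolynomial s K)
  let Ω := FractionRing (PowerSeries L)
  let τ : K' := algebraMap (PowerSeries K) K' PowerSeries.X
  have hτ : τ ≠ 0 := by
    intro h
    have : (PowerSeries.X : PowerSeries K) = 0 := by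
      apply IsFractionRing.injective (PowerSeries K) K'
      rw [map_zero]; exact h
    exact PowerSeries.X_ne_zero this
  let Y : σ → MvPolynomial σ K' := fun v => C ((τ ^ ω v)⁻¹) * X v
  have hXY : ∀ v, (X v : MvPolynomial σ K') = C τ ^ ω v * Y v := by
    intro v
    simp only [Y]
    rw [← mul_assoc, ← map_pow, ← map_mul, mul_inv_cancel₀ (pow_ne_zero _ hτ), map_one, one_mul]
  let θ : s → MvPolynomial σ K' := fun v => Y v - (cls v).elim 0 (fun c => Y (base c))
  let ιA : MvPolynomial s K' →+* MvPolynomial σ K' := (aeval θ : MvPolynomial s K' →ₐ[K'] _).toRingHom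
  have hιX : ∀ v, ιA (X v) = θ v := fun v => aeval_X θ v
  have hιC : ∀ a, ιA (C a) = C a := fun a => by
    simp only [ιA, AlgHom.toRingHom_eq_coe, RingHom.coe_coe, aeval_C]; rfl
  let J' := J.map (MvPolynomial.map (algebraMap K K'))
  let b : Bs → MvPolynomial σ K' := fun S => (S.1.map (fun c => Y (base c))).prod
  let α : σ → MvPolynomial s K' := fun v => if h : ∀ c, v ≠ base c then X ⟨v, h⟩ else 0
  have hYirr : ∀ v, Y v ∈ Ideal.span (Set.range (X : σ → MvPolynomial σ K')) := fun v =>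
    Ideal.mul_mem_left _ _ (Ideal.subset_span ⟨v, rfl⟩)
  refine core_conclusion (K' := K') (Ω := Ω) J hJ ιA b ?_ ⟨?_, ?_⟩
  · intro v
    rw [hιX]
    refine sub_mem (hYirr _) ?_
    cases cls v.1 with
    | none => exact Ideal.zero_mem _
    | some c => exact hYirr _
  · -- spanning
    have hsp := spanning (O := PowerSeries K) ιA PowerSeries.X
      (by rw [IsLocalRing.mem_maximalIdeal, mem_nonunits_iff, PowerSeries.isUnit_iff_constantCoeff]; simp)
      (fun o => ⟨C (algebraMap _ _ o), by rw [hιC]; rfl⟩) J' ω cls base hbase Y α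
      (by
        intro v
        by_cases h : ∀ c, v ≠ base c
        · simp only [α, dif_pos h, hιX, θ]; ring
        · simp only [α, dif_neg h, map_zero, add_zero]
          push Not at h
          obtain ⟨c, rfl⟩ := h
          simp [hbase]) Bs
      (by
        intro S hS
        obtain ⟨t, v, d, hd, hle, hl, hdet⟩ := h1 S hS
        refine ⟨t, v, d, hd, hle, ?_⟩
        have h3 := Ideal.mem_map_of_mem (MvPolynomial.map (algebraMap K K')) hdet
        rw [RingHom.map_det] at h3
        have h4 : (MvPolynomial.map (algebraMap K K')).mapMatrix
          (Matrix.of fun i j => (X (v i j) : MvPolynomial σ K)) =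
          Matrix.of fun i j => (C τ : MvPolynomial σ K') ^ ω (v i j) * Y (v i j) := by
          ext1 i j
          simp [← hXY]
        rw [h4, det_lead ω v hl] at h3
        have h5 := J'.mul_mem_left (C ((τ ^ (∑ i, ω (v i i)))⁻¹)) h3
        rw [← mul_assoc, ← map_pow C, ← map_mul, inv_mul_cancel₀ (pow_ne_zero _ hτ), map_one,
          one_mul] at h5
        exact h5)
    let N : Submodule K' (MvPolynomial σ K') :=
      { carrier := {x | ∃ c : Bs → MvPolynomial s K', x - ∑ j, ιA (c j) * b j ∈ J'}
        zero_mem' := ⟨0, by simp⟩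
        add_mem' := by
          rintro p q ⟨d, hd'⟩ ⟨e, he'⟩
          refine ⟨d + e, ?_⟩
          have := add_mem hd' he'
          simpa [add_mul, Finset.sum_add_distrib, add_sub_add_comm] using this
        smul_mem' := by
          rintro o x ⟨d, hd⟩
          refine ⟨fun j => C o * d j, ?_⟩
          have := J'.mul_mem_left (C o) hd
          rw [smul_eq_C_mul]
          simpa [mul_sub, Finset.mul_sum, mul_assoc, hιC] using this }
    intro x
    change x ∈ N
    rw [← support_sum_monomial_coeff x]
    refine N.sum_mem fun d _ => ?_
    have h3 : (monomial d (x.coeff d) : MvPolynomial σ K') =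
        (x.coeff d * ((d.toMultiset.map (fun v => τ ^ ω v)).prod)) • ((d.toMultiset.map Y).prod) := by
      rw [monomial_eq, smul_eq_C_mul, map_mul, mul_assoc]
      congr 1
      rw [map_multiset_prod, Multiset.map_map, ← Multiset.prod_map_mul]
      have : (fun v => ((C ∘ fun v => τ ^ ω v) v * Y v : MvPolynomial σ K')) = X := by
        funext v; rw [hXY v]; simp
      rw [this, Finsupp.toMultiset_map, Finsupp.prod_toMultiset]
      rw [Finsupp.prod_mapDomain_index]
      · simp
      · intros; rw [pow_add]
    rw [h3]
    exact N.smul_mem _ (hsp _)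
  · -- homs
    let ξ : σ → L := fun v => if h : ∀ c, v ≠ base c then algebraMap (MvPolynomial s K) L (X ⟨v, h⟩) else 0
    have hLinj := IsFractionRing.injective (MvPolynomial s K) L
    have hξs : ∀ v : s, ξ v.1 = algebraMap (MvPolynomial s K) L (X v) := fun v => dif_pos v.2
    have hξb : ∀ c, ξ (base c) = 0 := fun c => dif_neg (by push Not; exact ⟨c, rfl⟩)
    have hξ0 : ∀ v : s, ξ v.1 ≠ 0 := by
      intro v h
      rw [hξs] at h
      exact X_ne_zero v (hLinj (by rw [h, map_zero]))
    have hξ1 : ∀ v v' c, cls v = some c → cls v' = some c → v ≠ v' → ξ v ≠ ξ v' := by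
      intro v v' c hv hv' hne heq
      by_cases hb : ∀ c, v ≠ base c
      · by_cases hb' : ∀ c, v' ≠ base c
        · have e1 := hξs ⟨v, hb⟩
          have e2 := hξs ⟨v', hb'⟩
          simp only at e1 e2
          rw [e1, e2] at heq
          have := X_injective (hLinj heq)
          exact hne (congrArg Subtype.val this)
        · push Not at hb'
          obtain ⟨c', rfl⟩ := hb'
          rw [hξb] at heq
          exact hξ0 ⟨v, hb⟩ heq
      · push Not at hb
        obtain ⟨c1, rfl⟩ := hb
        rw [hξb] at heq
        by_cases hb' : ∀ c, v' ≠ base c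
        · exact hξ0 ⟨v', hb'⟩ heq.symm
        · push Not at hb'
          obtain ⟨c', rfl⟩ := hb'
          rw [hbase] at hv hv'
          apply hne
          rw [Option.some.inj hv, Option.some.inj hv']
    have hξ2 : ∀ v, cls v = none → ξ v ≠ 0 := by
      intro v hv
      exact hξ0 ⟨v, fun c h => by rw [h, hbase] at hv; simp at hv⟩
    have hξai : AlgebraicIndependent K (fun v : s => ξ v.1) := by
      have : (fun v : s => ξ v.1) = fun v => algebraMap (MvPolynomial s K) L (X v) := funext hξs
      rw [this, algebraicIndependent_iff_injective_aeval]
      have h5 : ∀ p : MvPolynomial s K, aeval (fun v => algebraMap (MvPolynomial s K) L (X v)) p =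
          algebraMap (MvPolynomial s K) L p := by
        intro p
        have := aeval_algebraMap_apply (R := K) L (X : s → MvPolynomial s K) p
        rw [aeval_X_left_apply] at this
        exact this
      intro p q hpq
      rw [h5, h5] at hpq
      exact hLinj hpq
    choose ζ hζ1 hζ2 using fun S => h2 S L ξ hξ1 hξ2
    let μ : PowerSeries K →+* Ω := (algebraMap (PowerSeries L) Ω).comp (PowerSeries.map (algebraMap K L))
    have hΩ := IsFractionRing.injective (PowerSeries L) Ω
    have hμ : Function.Injective μ := hΩ.comp
      (PowerSeries.map_injective _ (algebraMap K L).injective)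
    let κ : K' →+* Ω := IsFractionRing.lift hμ
    have hκ : ∀ o, κ (algebraMap _ _ o) = algebraMap _ _ (PowerSeries.map (algebraMap K L) o) :=
      fun o => IsFractionRing.lift_algebraMap hμ o
    have hκτ : κ τ = algebraMap (PowerSeries L) Ω PowerSeries.X := by
      rw [hκ, PowerSeries.map_X]
    let y : Bs → σ → PowerSeries L := fun S v => PowerSeries.C (ξ v) + (cls v).elim 0 (ζ S)
    let φ : Bs → (MvPolynomial σ K' →+* Ω) := fun S =>
      eval₂Hom κ (fun v => algebraMap _ Ω (PowerSeries.X ^ ω v * y S v))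
    have hφY : ∀ S v, φ S (Y v) = algebraMap _ Ω (y S v) := by
      intro S v
      simp only [φ, Y, map_mul, map_inv₀, map_pow, coe_eval₂Hom, eval₂_C, eval₂_X, hκτ]
      rw [← mul_assoc, inv_mul_cancel₀, one_mul]
      rw [← hκτ]
      exact pow_ne_zero _ ((map_ne_zero κ).2 hτ)
    have hyb : ∀ S c, y S (base c) = ζ S c := by
      intro S c; simp [y, hbase, hξb]
    refine ⟨φ, eval₂Hom κ (fun v : s => algebraMap _ Ω (PowerSeries.C (ξ v.1))),
      ps_mvpoly_inj' _ hξai κ hκ, ?_, ?_, ?_⟩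
    · intro S S' hSS
      apply hfinj
      funext c
      by_contra hne
      refine hξ1 _ _ c (hf S c) (hf S' c) hne ?_
      have h3 : φ S (Y (base c)) = φ S' (Y (base c)) := by rw [hSS]
      rw [hφY, hφY, hyb, hyb] at h3
      have h4 := congrArg PowerSeries.constantCoeff (hΩ h3)
      rw [hζ1, hζ1] at h4
      exact neg_injective h4
    · intro S x hx
      have hle : J' ≤ RingHom.ker (φ S) := by
        rw [Ideal.map_le_iff_le_comap]
        intro p hp
        rw [Ideal.mem_comap, RingHom.mem_ker]
        have h3 := congrArg (algebraMap (PowerSeries L) Ω) (hζ2 S p hp)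
        rw [map_zero] at h3
        rw [← h3]
        simp only [φ]
        rw [coe_eval₂Hom, eval₂_map, hom_eval₂]
        congr 1
        ext1 k
        simp only [RingHom.comp_apply]
        rw [IsScalarTower.algebraMap_apply K (PowerSeries K) K', hκ]
        congr 1
        rw [PowerSeries.algebraMap_apply, PowerSeries.map_C]
        rfl
      exact hle hx
    · intro S a
      rw [← RingHom.comp_apply]
      congr 1
      apply MvPolynomial.ringHom_ext
      · intro r
        rw [RingHom.comp_apply, hιC]
        simp [φ]
      · intro v
        rw [RingHom.comp_apply, hιX]
        simp only [θ, map_sub, hφY, coe_eval₂Hom, eval₂_X]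
        cases hc : cls v.1 with
        | none => simp [y, hc]
        | some c =>
          simp only [Option.elim_some, hφY, hyb]
          rw [← map_sub]
          simp [y, hc]
end

noncomputable section

/-! combinatorics of a side -/

def cntR (q : ℕ) (r : ℕ → ℕ) (j : ℕ) : ℕ := ((Finset.range (q + 1)).filter fun d => r d ≤ j).card
def scR (q : ℕ) (r : ℕ → ℕ) (j : ℕ) : ℕ := j + cntR q r j
def colsq (q : ℕ) (r : ℕ → ℕ) (d j : ℕ) : ℕ :=
  if j < r d then scR q r j else if j = r d then r d + d else scR q r (j - 1)

theorem cnt_le (q : ℕ) (r : ℕ → ℕ) (j : ℕ) : cntR q r j ≤ q + 1 := by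
  have := Finset.card_filter_le (Finset.range (q + 1)) fun d => r d ≤ j
  rw [Finset.card_range] at this
  exact this

theorem cnt_mono (q : ℕ) (r : ℕ → ℕ) {i j : ℕ} (h : i ≤ j) : cntR q r i ≤ cntR q r j :=
  Finset.card_le_card (Finset.monotone_filter_right _ fun d _ (hd : r d ≤ i) => hd.trans h)

theorem cnt_iff {q : ℕ} {r : ℕ → ℕ} (hr : ∀ d e, d ≤ e → e ≤ q → r d ≤ r e) (j e : ℕ) (he : e ≤ q) :
    r e ≤ j ↔ e < cntR q r j := by
  constructor
  · intro h
    have : Finset.range (e + 1) ⊆ (Finset.range (q + 1)).filter fun d => r d ≤ j := by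
      intro d hd
      simp only [Finset.mem_range, Finset.mem_filter] at hd ⊢
      exact ⟨by omega, (hr d e (by omega) he).trans h⟩
    have := Finset.card_le_card this
    rw [Finset.card_range] at this
    unfold cntR; omega
  · intro h
    by_contra hc
    have : (Finset.range (q + 1)).filter (fun d => r d ≤ j) ⊆ Finset.range e := by
      intro d hd
      simp only [Finset.mem_range, Finset.mem_filter] at hd ⊢
      by_contra hde
      exact hc ((hr e d (by omega) (by omega)).trans hd.2)
    have := Finset.card_le_card this
    rw [Finset.card_range] at this
    unfold cntR at h
    omega

theorem sc_lt (q : ℕ) (r : ℕ → ℕ) {i j : ℕ} (h : i < j) : scR q r i < scR q r j := by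
  have := cnt_mono q r h.le
  unfold scR; omega

theorem sc_cover {p q : ℕ} {r : ℕ → ℕ} (hr : ∀ d e, d ≤ e → e ≤ q → r d ≤ r e)
    (hp : ∀ d, d ≤ q → r d ≤ p) (k : ℕ) (hk : k ≤ p + q) :
    (∃ j, j < p ∧ k = scR q r j) ∨ ∃ d, d ≤ q ∧ k = r d + d := by
  classical
  by_cases hd : ∃ d, d ≤ q ∧ k = r d + d
  · exact Or.inr hd
  left
  have hex : ∃ e, e = q + 1 ∨ k ≤ r e + e := ⟨q + 1, Or.inl rfl⟩
  let e := Nat.find hex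
  have he := Nat.find_spec hex
  have hlt : ∀ d, d < e → r d + d < k := fun d hd => by
    have := Nat.find_min hex hd
    omega
  have heq : e ≤ q + 1 := Nat.find_min' hex (Or.inl rfl)
  change e = q + 1 ∨ k ≤ r e + e at he
  have hek : e ≤ k := by
    rcases Nat.eq_zero_or_pos e with h | h
    · omega
    · have := hlt (e - 1) (by omega); omega
  have hcnt : cntR q r (k - e) = e := by
    apply le_antisymm
    · by_contra hc
      have h1 := cnt_le q r (k - e)
      have h2 := (cnt_iff hr (k - e) e (by omega)).2 (by omega)
      rcases he with h | h
      · omega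
      · exact hd ⟨e, by omega, by omega⟩
    · rcases Nat.eq_zero_or_pos e with h | h
      · omega
      · have h1 := hlt (e - 1) (by omega)
        have := (cnt_iff hr (k - e) (e - 1) (by omega)).1 (by omega)
        omega
  refine ⟨k - e, ?_, ?_⟩
  · by_cases h : e = q + 1
    · omega
    · have h1 : k ≤ r e + e := by tauto
      have h2 : k ≠ r e + e := fun h2 => hd ⟨e, by omega, h2⟩
      have := hp e (by omega)
      omega
  · unfold scR; omega

theorem colsq_lt {q : ℕ} {r : ℕ → ℕ} (hr : ∀ d e, d ≤ e → e ≤ q → r d ≤ r e) (d : ℕ) (hd : d ≤ q)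
    {i j : ℕ} (h : i < j) : colsq q r d i < colsq q r d j := by
  have key1 : ∀ j, j < r d → scR q r j < r d + d := by
    intro j hj
    have := cnt_iff hr j d hd
    unfold scR; omega
  have key2 : ∀ j, r d ≤ j → r d + d < scR q r j := by
    intro j hj
    have := cnt_iff hr j d hd
    unfold scR; omega
  unfold colsq
  split_ifs with h1 h2 h3 h4 h5 h6 h7 h8
  all_goals first
    | omega
    | exact sc_lt q r (by omega)
    | exact key1 _ (by omega)
    | exact key2 _ (by omega)

theorem colsq_le {p q : ℕ} {r : ℕ → ℕ}
    (hp : ∀ d, d ≤ q → r d ≤ p) (d : ℕ) (hd : d ≤ q) (j : ℕ) (hj : j ≤ p) : colsq q r d j ≤ p + q := by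
  have h1 := cnt_le q r j
  have h2 := cnt_le q r (j - 1)
  have h3 := hp d hd
  unfold colsq scR
  split_ifs <;> omega

/-! linear algebra -/

def uvec {S : Type*} [CommRing S] (p : ℕ) (s : ℕ → ℕ) (M : ℕ → ℕ → S) (i : Fin (p + 1)) : S :=
  (-1) ^ (i : ℕ) * (Matrix.of fun a b : Fin p => M (i.succAbove a) (s b)).det

theorem uvec_dot {S : Type*} [CommRing S] (p : ℕ) (s : ℕ → ℕ) (M : ℕ → ℕ → S) (r0 : Fin (p + 1))
    (cs : ℕ → ℕ) (hcs : ∀ b : Fin p, cs (r0.succAbove b) = s b) :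
    (Matrix.of fun i j : Fin (p + 1) => M i (cs j)).det =
      (-1) ^ (r0 : ℕ) * ∑ i, uvec p s M i * M i (cs r0) := by
  rw [Matrix.det_succ_column _ r0, Finset.mul_sum]
  refine Finset.sum_congr rfl fun i _ => ?_
  have : (Matrix.of fun i j : Fin (p + 1) => M i (cs j)).submatrix i.succAbove r0.succAbove =
    Matrix.of fun a b : Fin p => M (i.succAbove a) (s b) := by
    ext a b; simp [hcs]
  rw [this, uvec, Matrix.of_apply]
  ring

theorem uvec_dot_s {S : Type*} [CommRing S] (p : ℕ) (s : ℕ → ℕ) (M : ℕ → ℕ → S) (j : ℕ) (hj : j < p) :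
    ∑ i, uvec p s M i * M i (s j) = 0 := by
  have h := uvec_dot p s M 0 (fun k => if k = 0 then s j else s (k - 1)) (by intro b; simp)
  simp only [Fin.val_zero, pow_zero, one_mul, if_true] at h
  rw [← h]
  refine Matrix.det_zero_of_column_eq (i := 0) (j := ⟨j + 1, by omega⟩) ?_ ?_
  · intro h; simpa using congrArg Fin.val h
  · intro i; simp

theorem uvec_dot_k {S : Type*} [CommRing S] (p q : ℕ) (r : ℕ → ℕ) (M : ℕ → ℕ → S)
    (d : ℕ) (hd : r d ≤ p)
    (hdet : (Matrix.of fun i j : Fin (p + 1) => M i (colsq q r d j)).det = 0) :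
    ∑ i, uvec p (scR q r) M i * M i (r d + d) = 0 := by
  have h := uvec_dot p (scR q r) M ⟨r d, by omega⟩ (colsq q r d) (by
    intro b
    by_cases hb : (b : ℕ) < r d
    · rw [Fin.succAbove_of_castSucc_lt _ _ (by rw [Fin.lt_def]; simpa using hb)]
      simp [colsq, hb]
    · rw [Fin.succAbove_of_le_castSucc _ _ (by rw [Fin.le_def]; simpa using hb)]
      simp only [colsq, Fin.val_succ]
      rw [if_neg (by omega), if_neg (by omega)]; simp)
  rw [hdet] at h
  have e : colsq q r d ((⟨r d, by omega⟩ : Fin (p + 1)) : ℕ) = r d + d := by simp [colsq]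
  rw [e] at h
  have hu : IsUnit ((-1 : S) ^ (r d)) := (IsUnit.neg isUnit_one).pow _
  exact (hu.mul_right_eq_zero.1 h.symm)

theorem minor_zero {S : Type*} [CommRing S] [IsDomain S] {t : ℕ} (M : Matrix (Fin t) (Fin t) S)
    (u : Fin t → S) (hu : u ≠ 0) (h : ∀ j, ∑ i, u i * M i j = 0) : M.det = 0 := by
  rw [← Matrix.exists_vecMul_eq_zero_iff]
  refine ⟨u, hu, funext fun j => ?_⟩
  simpa [Matrix.vecMul, dotProduct] using h j
end

noncomputable section

structure Side {σ Γ : Type*} (ω : σ → ℕ) (cls : σ → Option Γ) (p q : ℕ) (h : ℕ → ℕ → σ)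
    (cH : ℕ → Γ) : Prop where
  cinj : ∀ d e, d ≤ q → e ≤ q → cH d = cH e → d = e
  hcls : ∀ i d, i ≤ p → d ≤ q → cls (h i (i + d)) = some (cH d)
  hinj : ∀ i j d, i ≤ p → j ≤ p → d ≤ q → h i (i + d) = h j (j + d) → i = j
  wt : ∃ A B ρ κ : ℕ → ℤ, (∀ i j, i < j → j ≤ p → ρ i < ρ j) ∧
    (∀ k l, k < l → l ≤ p + q → κ k < κ l) ∧
    ∀ i k, i ≤ p → k ≤ p + q → (ω (h i k) : ℤ) = A i + B k - ρ i * κ k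

theorem perm_mono_one {t : ℕ} (π : Equiv.Perm (Fin t)) (h : StrictMono π) : π = 1 := by
  have : (h.orderIsoOfSurjective _ π.surjective) = OrderIso.refl _ := Subsingleton.elim _ _
  ext i
  have := congrArg (fun e : Fin t ≃o Fin t => (e i : ℕ)) this
  simpa using this

theorem rearr {t : ℕ} (F G : Fin t → ℤ) (hF : StrictMono F) (hG : StrictMono G)
    (π : Equiv.Perm (Fin t)) (hπ : π ≠ 1) : ∑ i, F (π i) * G i < ∑ i, F i * G i := by
  have hm : Monovary F G := hF.monotone.monovary hG.monotone
  rw [hm.sum_comp_perm_mul_lt_sum_mul_iff]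
  intro hc
  apply hπ
  apply perm_mono_one
  intro i j hij
  have h1 := hc (hG hij)
  have h2 : π i ≤ π j := hF.le_iff_le.1 h1
  exact lt_of_le_of_ne h2 fun e => hij.ne (π.injective e)

section
variable {σ Γ : Type*} {ω : σ → ℕ} {cls : σ → Option Γ} {p q : ℕ} {h : ℕ → ℕ → σ} {cH : ℕ → Γ}

theorem Side.lead (S : Side ω cls p q h cH) {t : ℕ} (a b : Fin t → ℕ) (ha : StrictMono a)
    (hb : StrictMono b) (hap : ∀ i, a i ≤ p) (hbp : ∀ i, b i ≤ p + q) :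
    Lead ω (fun i j => h (a i) (b j)) := by
  obtain ⟨A, B, ρ, κ, hρ, hκ, hw⟩ := S.wt
  intro π hπ
  have h1 := rearr (fun i => ρ (a i)) (fun i => κ (b i)) (fun i j hij => hρ _ _ (ha hij) (hap j))
    (fun i j hij => hκ _ _ (hb hij) (hbp j)) π hπ
  zify
  rw [Finset.sum_congr rfl fun i _ => hw _ _ (hap i) (hbp i),
    Finset.sum_congr rfl fun i _ => hw _ _ (hap (π i)) (hbp i)]
  simp only [Finset.sum_sub_distrib, Finset.sum_add_distrib]
  have h2 : ∑ i, A (a (π i)) = ∑ i, A (a i) := Equiv.sum_comp π fun i => A (a i)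
  linarith

theorem Side.cell_ne (S : Side ω cls p q h cH) {r : ℕ → ℕ} (hp : ∀ d, d ≤ q → r d ≤ p)
    {f : Γ → σ} (hf : ∀ c, cls (f c) = some c) (hfr : ∀ d, d ≤ q → f (cH d) = h (r d) (r d + d))
    (i e : ℕ) (hi : i ≤ p) (he : e ≤ q) (hne : i ≠ r e) (c : Γ) : h i (i + e) ≠ f c := by
  intro hc
  have h1 := S.hcls i e hi he
  rw [hc, hf] at h1
  have h2 : c = cH e := by simpa using h1
  rw [h2, hfr e he] at hc
  exact hne (S.hinj _ _ _ hi (hp e he) he hc)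

theorem Side.cell1 (S : Side ω cls p q h cH) {r : ℕ → ℕ} (hr : ∀ d e, d ≤ e → e ≤ q → r d ≤ r e)
    (hp : ∀ d, d ≤ q → r d ≤ p)
    {f : Γ → σ} (hf : ∀ c, cls (f c) = some c) (hfr : ∀ d, d ≤ q → f (cH d) = h (r d) (r d + d))
    (i d : ℕ) (hd : d ≤ q) (hi : i < r d) (c : Γ) : h i (scR q r i) ≠ f c := by
  have h1 := cnt_iff hr i d hd
  have h3 := hp d hd
  have h2 := cnt_iff hr i (cntR q r i) (by omega)
  exact S.cell_ne hp hf hfr i _ (by omega) (by omega) (by omega) c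

theorem Side.cell2 (S : Side ω cls p q h cH) {r : ℕ → ℕ} (hr : ∀ d e, d ≤ e → e ≤ q → r d ≤ r e)
    (hp : ∀ d, d ≤ q → r d ≤ p)
    {f : Γ → σ} (hf : ∀ c, cls (f c) = some c) (hfr : ∀ d, d ≤ q → f (cH d) = h (r d) (r d + d))
    (i d : ℕ) (hd : d ≤ q) (hi : r d ≤ i) (hip : i + 1 ≤ p) (c : Γ) :
    h (i + 1) (scR q r i) ≠ f c := by
  have h1 := cnt_iff hr i d hd
  have h3 := cnt_le q r i
  have h2 := cnt_iff hr i (cntR q r i - 1) (by omega)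
  have := S.cell_ne hp hf hfr (i + 1) (cntR q r i - 1) (by omega) (by omega) (by omega) c
  rwa [show i + 1 + (cntR q r i - 1) = scR q r i by unfold scR; omega] at this

theorem Side.sq_ne (S : Side ω cls p q h cH) {r : ℕ → ℕ} (hr : ∀ d e, d ≤ e → e ≤ q → r d ≤ r e)
    (hp : ∀ d, d ≤ q → r d ≤ p)
    {f : Γ → σ} (hf : ∀ c, cls (f c) = some c) (hfr : ∀ d, d ≤ q → f (cH d) = h (r d) (r d + d))
    (i d : ℕ) (hd : d ≤ q) (hi : i ≤ p) (hne : i ≠ r d) (c : Γ) : h i (colsq q r d i) ≠ f c := by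
  unfold colsq
  split_ifs with h1
  · exact S.cell1 hr hp hf hfr i d hd h1 c
  · have := S.cell2 hr hp hf hfr (i - 1) d hd (by omega) (by omega) c
    rwa [show i - 1 + 1 = i by omega] at this

theorem Side.sq_lead (S : Side ω cls p q h cH) {r : ℕ → ℕ} (hr : ∀ d e, d ≤ e → e ≤ q → r d ≤ r e)
    (hp : ∀ d, d ≤ q → r d ≤ p) (d : ℕ) (hd : d ≤ q) :
    Lead ω (fun i j : Fin (p + 1) => h i (colsq q r d j)) :=
  S.lead (fun i : Fin (p + 1) => (i : ℕ)) (fun j => colsq q r d j) (fun i j hij => hij)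
    (fun i j hij => colsq_lt hr d hd hij) (fun i => by omega)
    (fun i => colsq_le hp d hd i (by omega))

theorem Side.ker (S : Side ω cls p q h cH) {r : ℕ → ℕ} (hr : ∀ d e, d ≤ e → e ≤ q → r d ≤ r e)
    (hp : ∀ d, d ≤ q → r d ≤ p)
    {f : Γ → σ} (hf : ∀ c, cls (f c) = some c) (hfr : ∀ d, d ≤ q → f (cH d) = h (r d) (r d + d))
    {L : Type*} [Field L] (y : σ → PowerSeries L)
    (hy : ∀ s, (∀ c, s ≠ f c) → PowerSeries.constantCoeff (y s) ≠ 0) :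
    ∃ u : Fin (p + 1) → PowerSeries L, (∀ d, d ≤ q → ∀ i : Fin (p + 1), (i : ℕ) = r d → u i ≠ 0) ∧
      ∀ k, k ≤ p + q → (∀ d, d ≤ q → k = r d + d →
        (Matrix.of fun i j : Fin (p + 1) => PowerSeries.X ^ ω (h i (colsq q r d j)) *
          y (h i (colsq q r d j))).det = 0) →
        ∑ i : Fin (p + 1), u i * (PowerSeries.X ^ ω (h i k) * y (h i k)) = 0 := by
  let M : ℕ → ℕ → PowerSeries L := fun i k => PowerSeries.X ^ ω (h i k) * y (h i k)
  refine ⟨uvec p (scR q r) M, ?_, ?_⟩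
  · intro d hd i hi
    have hsc : ∀ b : Fin p, scR q r b ≤ p + q := fun b => by
      have := cnt_le q r b
      unfold scR; omega
    have hl := S.lead (fun a : Fin p => ((i.succAbove a : Fin (p + 1)) : ℕ)) (fun b => scR q r b)
      (fun a b hab => (Fin.strictMono_succAbove i hab)) (fun a b hab => sc_lt q r hab)
      (fun a => by omega) hsc
    have hdet := det_lead ω _ hl (PowerSeries.X : PowerSeries L) y
    unfold uvec
    refine mul_ne_zero (pow_ne_zero _ (by simp)) ?_
    change (Matrix.of fun a b : Fin p => PowerSeries.X ^ ω (h (i.succAbove a) (scR q r b)) *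
      y (h (i.succAbove a) (scR q r b))).det ≠ 0
    rw [hdet]
    refine mul_ne_zero (pow_ne_zero _ PowerSeries.X_ne_zero) ?_
    intro h0
    have h1 := congrArg (PowerSeries.constantCoeff (R := L)) h0
    simp only [map_add, map_mul, PowerSeries.constantCoeff_X, zero_mul, add_zero, map_zero,
      map_prod] at h1
    rw [Finset.prod_eq_zero_iff] at h1
    obtain ⟨a, -, ha⟩ := h1
    refine hy _ ?_ ha
    intro c
    by_cases hb : (a : ℕ) < i
    · rw [Fin.succAbove_of_castSucc_lt _ _ (by rw [Fin.lt_def]; simpa using hb)]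
      exact S.cell1 hr hp hf hfr a d hd (by omega) c
    · rw [Fin.succAbove_of_le_castSucc _ _ (by rw [Fin.le_def]; simpa using hb)]
      exact S.cell2 hr hp hf hfr a d hd (by omega) (by omega) c
  · intro k hk hdet
    rcases sc_cover hr hp k hk with ⟨j, hj, rfl⟩ | ⟨d, hd, rfl⟩
    · exact uvec_dot_s p (scR q r) M j hj
    · exact uvec_dot_k p q r M d (hp d hd) (hdet d hd rfl)
end
end

noncomputable section

theorem ms_pick {Γ : Type*} [DecidableEq Γ] (p q : ℕ) (cH : ℕ → Γ)
    (cinj : ∀ d e, d ≤ q → e ≤ q → cH d = cH e → d = e) (T : Multiset Γ)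
    (hT : p + 1 ≤ ∑ d ∈ Finset.range (q + 1), T.count (cH d)) :
    ∃ d : Fin (p + 1) → ℕ, Monotone d ∧ (∀ i, d i ≤ q) ∧
      Multiset.map (fun i => cH (d i)) Finset.univ.val ≤ T := by
  let U : Multiset ℕ := ∑ d ∈ Finset.range (q + 1), Multiset.replicate (T.count (cH d)) d
  have hU : U.card = ∑ d ∈ Finset.range (q + 1), T.count (cH d) := by
    simp [U]
  have hUq : ∀ d ∈ U, d ≤ q := by
    intro d hd
    rw [Multiset.mem_sum] at hd
    obtain ⟨e, he, hd⟩ := hd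
    have := Multiset.eq_of_mem_replicate hd
    simp at he; omega
  have hmap : U.map cH ≤ T := by
    have h1 : U.map cH = ∑ c ∈ (Finset.range (q + 1)).image cH, Multiset.replicate (T.count c) c := by
      rw [Finset.sum_image]
      · simp [U, ← Multiset.coe_mapAddMonoidHom, map_sum]
      · intro d hd e he hde
        simp at hd he
        exact cinj d e (by omega) (by omega) hde
    rw [h1, Multiset.le_iff_count]
    intro c
    rw [Multiset.count_sum']
    simp only [Multiset.count_replicate, Finset.sum_ite_eq']
    split_ifs <;> simp
  let l := U.sort (· ≤ ·)
  have hl : l.length = U.card := Multiset.length_sort _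
  have hlU : (l : Multiset ℕ) = U := Multiset.sort_eq _ _
  have hs : l.Pairwise (· ≤ ·) := Multiset.pairwise_sort U (· ≤ ·)
  refine ⟨fun i => l[(i : ℕ)]'(by omega), ?_, ?_, ?_⟩
  · intro i j hij
    rcases hij.eq_or_lt with rfl | hij
    · exact le_rfl
    · exact List.pairwise_iff_getElem.1 hs _ _ _ _ hij
  · intro i
    apply hUq
    rw [← hlU]
    exact List.getElem_mem _
  · refine le_trans ?_ hmap
    have h2 : (Multiset.map (fun i : Fin (p + 1) => l[(i : ℕ)]'(by omega)) Finset.univ.val) ≤ U := by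
      rw [Fin.univ_val_map, ← hlU, Multiset.coe_le]
      have : List.ofFn (fun i : Fin (p + 1) => l[(i : ℕ)]'(by omega)) = l.take (p + 1) := by
        apply List.ext_getElem
        · simp; omega
        · intro i h1 h2; rw [List.getElem_ofFn, List.getElem_take]
      rw [this]
      exact (List.take_sublist _ _).subperm
    have := Multiset.map_le_map (f := cH) h2
    rwa [Multiset.map_map] at this

def rOf (p q : ℕ) (α : ℕ → ℕ) (d : ℕ) : ℕ :=
  if d = q then p - α q else ∑ e ∈ Finset.range (d + 1), α e

theorem rOf_le {p q : ℕ} {α : ℕ → ℕ} (h : ∑ e ∈ Finset.range (q + 1), α e ≤ p) (d : ℕ) (hd : d ≤ q) :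
    rOf p q α d ≤ p := by
  unfold rOf
  split_ifs with h1
  · omega
  · refine le_trans (Finset.sum_le_sum_of_subset ?_) h
    intro x hx; simp at hx ⊢; omega

theorem rOf_mono {p q : ℕ} {α : ℕ → ℕ} (h : ∑ e ∈ Finset.range (q + 1), α e ≤ p) (d e : ℕ)
    (hde : d ≤ e) (he : e ≤ q) : rOf p q α d ≤ rOf p q α e := by
  unfold rOf
  split_ifs with h1 h2 h2
  · omega
  · omega
  · rw [Finset.sum_range_succ] at h
    have : ∑ e ∈ Finset.range (d + 1), α e ≤ ∑ e ∈ Finset.range q, α e :=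
      Finset.sum_le_sum_of_subset (by intro x hx; simp at hx ⊢; omega)
    omega
  · exact Finset.sum_le_sum_of_subset (by intro x hx; simp at hx ⊢; omega)

theorem rOf_inj {p q : ℕ} {α β : ℕ → ℕ} (h : ∑ e ∈ Finset.range (q + 1), α e ≤ p)
    (h' : ∑ e ∈ Finset.range (q + 1), β e ≤ p) (hab : ∀ d, d ≤ q → rOf p q α d = rOf p q β d)
    (d : ℕ) (hd : d ≤ q) : α d = β d := by
  rw [Finset.sum_range_succ] at h h'
  by_cases hq : d = q
  · have := hab q le_rfl
    simp only [rOf, if_true] at this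
    subst hq; omega
  · have h1 := hab d hd
    simp only [rOf, hq, if_false, Finset.sum_range_succ] at h1
    rcases Nat.eq_zero_or_pos d with h0 | h0
    · subst h0; simpa using h1
    · have h2 := hab (d - 1) (by omega)
      simp only [rOf, show d - 1 ≠ q by omega, if_false] at h2
      rw [show d - 1 + 1 = d by omega] at h2
      omega

universe u
theorem one_side {σ Γ : Type} {K : Type u} [Field K] [Fintype σ] [Finite Γ]
    (J : Ideal (MvPolynomial σ K)) (hJ : J ≤ Ideal.span (Set.range X)) (ω : σ → ℕ)
    (cls : σ → Option Γ) (p q : ℕ) (h : ℕ → ℕ → σ) (cH : ℕ → Γ) (S : Side ω cls p q h cH)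
    (hsurj : ∀ c, ∃ d, d ≤ q ∧ cH d = c)
    (hmin : ∀ cs : Fin (p + 1) → ℕ, StrictMono cs → (∀ j, cs j ≤ p + q) →
      (Matrix.of fun i j : Fin (p + 1) => (X (h i (cs j)) : MvPolynomial σ K)).det ∈ J)
    (hkill : ∀ (A : Type u) [CommRing A] [IsDomain A] (φ : K →+* A) (x : σ → A)
      (u : Fin (p + 1) → A), u ≠ 0 → (∀ k, k ≤ p + q → ∑ i : Fin (p + 1), u i * x (h i k) = 0) →
      ∀ g ∈ J, eval₂ φ x g = 0) :
    IsReduced (MvPolynomial σ K ⧸ J) ∧ stdCM J := by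
  classical
  choose D hDq hD using hsurj
  let α : Multiset Γ → ℕ → ℕ := fun T d => T.count (cH d)
  let Bs : Set (Multiset Γ) := {T | ∑ d ∈ Finset.range (q + 1), α T d ≤ p}
  let r : Multiset Γ → ℕ → ℕ := fun T => rOf p q (α T)
  have hrp : ∀ T ∈ Bs, ∀ d, d ≤ q → r T d ≤ p := fun T hT d hd => rOf_le hT d hd
  have hrm : ∀ T ∈ Bs, ∀ d e, d ≤ e → e ≤ q → r T d ≤ r T e := fun T hT => rOf_mono hT
  let f : Bs → Γ → σ := fun T c => h (r T.1 (D c)) (r T.1 (D c) + D c)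
  have hf : ∀ T c, cls (f T c) = some c := fun T c => by
    rw [S.hcls _ _ (hrp T.1 T.2 _ (hDq c)) (hDq c), hD]
  have hDc : ∀ d, d ≤ q → D (cH d) = d := fun d hd => S.cinj _ _ (hDq _) hd (hD _)
  refine main_abstract J hJ ω cls (fun c => h 0 (0 + D c)) (fun c => by
    rw [S.hcls _ _ (Nat.zero_le _) (hDq c), hD]) Bs ?_ f hf ?_ ?_
  · intro T hT
    have hT' : p + 1 ≤ ∑ d ∈ Finset.range (q + 1), T.count (cH d) := by
      by_contra hc
      exact hT (show ∑ d ∈ Finset.range (q + 1), T.count (cH d) ≤ p by omega)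
    obtain ⟨d, hdm, hdq, hle⟩ := ms_pick p q cH S.cinj T hT'
    have hsm : StrictMono fun j : Fin (p + 1) => (j : ℕ) + d j := fun i j hij => by
      have := hdm hij.le
      have h2 : (i : ℕ) < j := hij
      simp only; omega
    have hbd : ∀ j : Fin (p + 1), (j : ℕ) + d j ≤ p + q := fun j => by
      have := hdq j; omega
    refine ⟨p + 1, fun i j => h i (j + d j), fun i => cH (d i), ?_, hle, ?_, hmin _ hsm hbd⟩
    · intro i; exact S.hcls _ _ (by omega) (hdq i)
    · exact S.lead (fun i : Fin (p + 1) => (i : ℕ)) _ (fun i j hij => hij) hsm (fun i => by omega) hbd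
  · intro T T' hTT
    apply Subtype.ext
    apply Multiset.ext.2
    intro c
    have h1 : ∀ d, d ≤ q → r T.1 d = r T'.1 d := by
      intro d hd
      have h2 := congrFun hTT (cH d)
      simp only [f, hDc d hd] at h2
      exact S.hinj _ _ _ (hrp _ T.2 d hd) (hrp _ T'.2 d hd) hd h2
    have h2 := rOf_inj T.2 T'.2 h1 (D c) (hDq c)
    simpa only [α, hD] using h2
  · intro T L _ _ ξ hξ hξ0
    have hfr : ∀ d, d ≤ q → f T (cH d) = h (r T.1 d) (r T.1 d + d) := fun d hd => by
      simp only [f, hDc d hd]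
    obtain ⟨ζ, hζ1, hζ2, hζ3⟩ := ps_lift ω cls (f T) (hf T) ξ
      (fun v c hv hne => hξ v (f T c) c hv (hf T c) hne) hξ0 (fun _ => p + 1)
      (fun c i j => h i (colsq q (r T.1) (D c) j))
      (fun c => ⟨r T.1 (D c), Nat.lt_succ_of_le (hrp _ T.2 _ (hDq c))⟩)
      (fun c => S.sq_lead (hrm _ T.2) (hrp _ T.2) (D c) (hDq c))
      (fun c => by simp [colsq, f])
      (fun c i hi c' => S.sq_ne (hrm _ T.2) (hrp _ T.2) (hf T) hfr i (D c) (hDq c) (by omega)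
        (fun e => hi (Fin.ext e)) c')
    refine ⟨ζ, hζ1, ?_⟩
    obtain ⟨u, hu1, hu2⟩ := S.ker (hrm _ T.2) (hrp _ T.2) (hf T) hfr
      (fun v => PowerSeries.C (ξ v) + (cls v).elim 0 ζ) hζ3
    refine hkill _ _ _ u ?_ ?_
    · intro h0
      refine hu1 0 (Nat.zero_le _) ⟨r T.1 0, Nat.lt_succ_of_le (hrp _ T.2 _ (Nat.zero_le _))⟩ rfl ?_
      rw [h0]; rfl
    · intro k hk
      refine hu2 k hk fun d hd _ => ?_
      have := hζ2 (cH d)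
      rwa [hDc d hd] at this
end

noncomputable section
universe u

theorem two_side {σ Γ : Type} {K : Type u} [Field K] [Fintype σ] [Finite Γ]
    (J : Ideal (MvPolynomial σ K)) (hJ : J ≤ Ideal.span (Set.range X)) (ω : σ → ℕ)
    (cls : σ → Option Γ) (p q p' q' : ℕ) (h h' : ℕ → ℕ → σ) (cH cV : ℕ → Γ)
    (S : Side ω cls p q h cH) (S' : Side ω cls p' q' h' cV)
    (hpq : p + q + 1 = 2 * (p' + 1)) (hpq' : p' + q' + 1 = 2 * (p + 1))
    (hq : 1 ≤ q) (hq' : 1 ≤ q')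
    (hc0 : cH 0 = cV 0) (hc1 : cH q = cV q')
    (hsurj : ∀ c, (∃ d, d ≤ q ∧ cH d = c) ∨ ∃ d, d ≤ q' ∧ cV d = c)
    (hdisj : ∀ d e, d ≤ q → 1 ≤ e → e + 1 ≤ q' → cH d ≠ cV e)
    (hrel : ∀ e i j, e < 2 → i ≤ p → j ≤ p' → h i (e * (p' + 1) + j) = h' j (e * (p + 1) + i))
    (hmin : ∀ cs : Fin (p + 1) → ℕ, StrictMono cs → (∀ j, cs j ≤ p + q) →
      (Matrix.of fun i j : Fin (p + 1) => (X (h i (cs j)) : MvPolynomial σ K)).det ∈ J)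
    (hmin' : ∀ cs : Fin (p' + 1) → ℕ, StrictMono cs → (∀ j, cs j ≤ p' + q') →
      (Matrix.of fun i j : Fin (p' + 1) => (X (h' i (cs j)) : MvPolynomial σ K)).det ∈ J)
    (hkill : ∀ (A : Type u) [CommRing A] [IsDomain A] (φ : K →+* A) (x : σ → A),
      (∀ cs : Fin (p + 1) → ℕ, StrictMono cs → (∀ j, cs j ≤ p + q) →
        (Matrix.of fun i j : Fin (p + 1) => x (h i (cs j))).det = 0) →
      (∀ cs : Fin (p' + 1) → ℕ, StrictMono cs → (∀ j, cs j ≤ p' + q') →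
        (Matrix.of fun i j : Fin (p' + 1) => x (h' i (cs j))).det = 0) →
      ∀ g ∈ J, eval₂ φ x g = 0) :
    IsReduced (MvPolynomial σ K ⧸ J) ∧ stdCM J := by
  classical
  let α : Multiset Γ → ℕ → ℕ := fun T d => T.count (cH d)
  let β : Multiset Γ → ℕ → ℕ := fun T d => T.count (cV d)
  let Bs : Set (Multiset Γ) := {T | ∑ d ∈ Finset.range (q + 1), α T d ≤ p ∧
    ∑ d ∈ Finset.range (q' + 1), β T d ≤ p'}
  let r : Multiset Γ → ℕ → ℕ := fun T => rOf p q (α T)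
  let s : Multiset Γ → ℕ → ℕ := fun T => rOf p' q' (β T)
  have hrp : ∀ T ∈ Bs, ∀ d, d ≤ q → r T d ≤ p := fun T hT d hd => rOf_le hT.1 d hd
  have hrm : ∀ T ∈ Bs, ∀ d e, d ≤ e → e ≤ q → r T d ≤ r T e := fun T hT => rOf_mono hT.1
  have hsp : ∀ T ∈ Bs, ∀ d, d ≤ q' → s T d ≤ p' := fun T hT d hd => rOf_le hT.2 d hd
  have hsm : ∀ T ∈ Bs, ∀ d e, d ≤ e → e ≤ q' → s T d ≤ s T e := fun T hT => rOf_mono hT.2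
  have hrs0 : ∀ T, r T 0 = s T 0 := by
    intro T
    simp only [r, s, rOf, show (0 : ℕ) ≠ q by omega, show (0 : ℕ) ≠ q' by omega, if_false]
    simp [α, β, hc0]
  have hrq : ∀ T ∈ Bs, r T q + α T q = p := by
    intro T hT
    have h1 : α T q ≤ ∑ d ∈ Finset.range (q + 1), α T d :=
      Finset.single_le_sum (f := α T) (fun _ _ => Nat.zero_le _) (by simp)
    have := hT.1
    simp only [r, rOf, if_true]; omega
  have hsq : ∀ T ∈ Bs, s T q' + α T q = p' := by
    intro T hT
    have h1 : β T q' ≤ ∑ d ∈ Finset.range (q' + 1), β T d :=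
      Finset.single_le_sum (f := β T) (fun _ _ => Nat.zero_le _) (by simp)
    have := hT.2
    have h2 : α T q = β T q' := by simp only [α, β, hc1]
    simp only [s, rOf, if_true]; omega
  have hfex : ∀ T : Bs, ∃ f : Γ → σ,
      (∀ d, d ≤ q → f (cH d) = h (r T.1 d) (r T.1 d + d)) ∧
      (∀ d, d ≤ q' → f (cV d) = h' (s T.1 d) (s T.1 d + d)) := by
    intro T
    refine ⟨fun c => if hc : ∃ d, d ≤ q ∧ cH d = c then h (r T.1 hc.choose) (r T.1 hc.choose + hc.choose)
      else if hc : ∃ d, d ≤ q' ∧ cV d = c then h' (s T.1 hc.choose) (s T.1 hc.choose + hc.choose)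
      else h 0 0, ?_, ?_⟩
    · intro d hd
      have hc : ∃ e, e ≤ q ∧ cH e = cH d := ⟨d, hd, rfl⟩
      have := S.cinj _ _ hc.choose_spec.1 hd hc.choose_spec.2
      simp only
      rw [dif_pos hc, this]
    · intro d hd
      have hc' : ∃ e, e ≤ q' ∧ cV e = cV d := ⟨d, hd, rfl⟩
      have h1 := S'.cinj _ _ hc'.choose_spec.1 hd hc'.choose_spec.2
      simp only
      by_cases hc : ∃ e, e ≤ q ∧ cH e = cV d
      · rw [dif_pos hc]
        have he := hc.choose_spec
        set e := hc.choose with hedef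
        rcases Nat.eq_zero_or_pos d with h0 | h0
        · have he0 : e = 0 := S.cinj _ _ he.1 (Nat.zero_le _) (by rw [he.2, h0, hc0])
          rw [h0, he0, ← hrs0]
          have hle := hrp _ T.2 0 (Nat.zero_le _)
          have hle' := hsp _ T.2 0 (Nat.zero_le _)
          rw [← hrs0] at hle'
          simpa using hrel 0 (r T.1 0) (r T.1 0) (by omega) hle hle'
        · have hd1 : d = q' := by
            by_contra hne
            exact hdisj e d he.1 h0 (by omega) he.2
          have he0 : e = q := S.cinj _ _ he.1 le_rfl (by rw [he.2, hd1, hc1])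
          rw [hd1, he0]
          have e1 := hrq _ T.2
          have e2 := hsq _ T.2
          have := hrel 1 (r T.1 q) (s T.1 q') (by omega) (by omega) (by omega)
          rw [show 1 * (p' + 1) + s T.1 q' = r T.1 q + q by omega,
            show 1 * (p + 1) + r T.1 q = s T.1 q' + q' by omega] at this
          exact this
      · rw [dif_neg hc, dif_pos hc', h1]
  choose f hfr hfs using hfex
  have hf : ∀ T c, cls (f T c) = some c := by
    intro T c
    rcases hsurj c with ⟨d, hd, rfl⟩ | ⟨d, hd, rfl⟩
    · rw [hfr T d hd, S.hcls _ _ (hrp _ T.2 d hd) hd]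
    · rw [hfs T d hd, S'.hcls _ _ (hsp _ T.2 d hd) hd]
  have hbase : ∀ c, ∃ b, cls b = some c := by
    intro c
    rcases hsurj c with ⟨d, hd, rfl⟩ | ⟨d, hd, rfl⟩
    · exact ⟨_, S.hcls 0 d (Nat.zero_le _) hd⟩
    · exact ⟨_, S'.hcls 0 d (Nat.zero_le _) hd⟩
  choose base hbase using hbase
  have key : ∀ {p q : ℕ} {h : ℕ → ℕ → σ} {cH : ℕ → Γ} (_ : Side ω cls p q h cH)
      (_ : ∀ cs : Fin (p + 1) → ℕ, StrictMono cs → (∀ j, cs j ≤ p + q) →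
      (Matrix.of fun i j : Fin (p + 1) => (X (h i (cs j)) : MvPolynomial σ K)).det ∈ J)
      (T : Multiset Γ) (_ : ¬ ∑ d ∈ Finset.range (q + 1), T.count (cH d) ≤ p),
      ∃ (t : ℕ) (v : Fin t → Fin t → σ) (d : Fin t → Γ), (∀ i, cls (v i i) = some (d i)) ∧
        Multiset.map d Finset.univ.val ≤ T ∧ Lead ω v ∧
        (Matrix.of fun i j => (X (v i j) : MvPolynomial σ K)).det ∈ J := by
    intro p q h cH S hmin T hT
    obtain ⟨d, hdm, hdq, hle⟩ := ms_pick p q cH S.cinj T (by omega)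
    have hsm : StrictMono fun j : Fin (p + 1) => (j : ℕ) + d j := fun i j hij => by
      have := hdm hij.le
      have h2 : (i : ℕ) < j := hij
      simp only; omega
    have hbd : ∀ j : Fin (p + 1), (j : ℕ) + d j ≤ p + q := fun j => by
      have := hdq j; omega
    refine ⟨p + 1, fun i j => h i (j + d j), fun i => cH (d i), ?_, hle, ?_, hmin _ hsm hbd⟩
    · intro i; exact S.hcls _ _ (by omega) (hdq i)
    · exact S.lead (fun i : Fin (p + 1) => (i : ℕ)) _ (fun i j hij => hij) hsm (fun i => by omega) hbd
  refine main_abstract J hJ ω cls base hbase Bs ?_ f hf ?_ ?_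
  · intro T hT
    by_cases hT1 : ∑ d ∈ Finset.range (q + 1), α T d ≤ p
    · exact key S' hmin' T fun hT2 => hT ⟨hT1, hT2⟩
    · exact key S hmin T hT1
  · intro T T' hTT
    apply Subtype.ext
    apply Multiset.ext.2
    intro c
    rcases hsurj c with ⟨d, hd, rfl⟩ | ⟨d, hd, rfl⟩
    · exact rOf_inj T.2.1 T'.2.1 (fun d hd => by
        have h2 := congrFun hTT (cH d)
        rw [hfr _ d hd, hfr _ d hd] at h2
        exact S.hinj _ _ _ (hrp _ T.2 d hd) (hrp _ T'.2 d hd) hd h2) d hd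
    · exact rOf_inj T.2.2 T'.2.2 (fun d hd => by
        have h2 := congrFun hTT (cV d)
        rw [hfs _ d hd, hfs _ d hd] at h2
        exact S'.hinj _ _ _ (hsp _ T.2 d hd) (hsp _ T'.2 d hd) hd h2) d hd
  · intro T L _ _ ξ hξ hξ0
    have hsqex : ∀ c, ∃ (t : ℕ) (v : Fin t → Fin t → σ) (i0 : Fin t), Lead ω v ∧
        v i0 i0 = f T c ∧ (∀ i, i ≠ i0 → ∀ c', v i i ≠ f T c') ∧
        (∀ d, d ≤ q → cH d = c → ∀ M : σ → PowerSeries L,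
          (Matrix.of fun i j => M (v i j)).det = 0 →
          (Matrix.of fun i j : Fin (p + 1) => M (h i (colsq q (r T.1) d j))).det = 0) ∧
        (∀ d, 1 ≤ d → d + 1 ≤ q' → cV d = c → ∀ M : σ → PowerSeries L,
          (Matrix.of fun i j => M (v i j)).det = 0 →
          (Matrix.of fun i j : Fin (p' + 1) => M (h' i (colsq q' (s T.1) d j))).det = 0) := by
      intro c
      by_cases hc : ∃ d, d ≤ q ∧ cH d = c
      · obtain ⟨d, hd, rfl⟩ := hc
        refine ⟨p + 1, fun i j => h i (colsq q (r T.1) d j),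
          ⟨r T.1 d, Nat.lt_succ_of_le (hrp _ T.2 _ hd)⟩,
          S.sq_lead (hrm _ T.2) (hrp _ T.2) d hd, by simp [colsq, hfr T d hd],
          fun i hi c' => S.sq_ne (hrm _ T.2) (hrp _ T.2) (hf T) (hfr T) i d hd (by omega)
            (fun e => hi (Fin.ext e)) c', ?_, ?_⟩
        · intro e he hed M hM
          rw [S.cinj _ _ he hd hed]; exact hM
        · intro e he he' hed
          exact absurd hed.symm (hdisj d e hd he he')
      · have hc' : ∃ d, d ≤ q' ∧ cV d = c := by
          rcases hsurj c with h1 | h1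
          · exact absurd h1 hc
          · exact h1
        obtain ⟨d, hd, rfl⟩ := hc'
        refine ⟨p' + 1, fun i j => h' i (colsq q' (s T.1) d j),
          ⟨s T.1 d, Nat.lt_succ_of_le (hsp _ T.2 _ hd)⟩,
          S'.sq_lead (hsm _ T.2) (hsp _ T.2) d hd, by simp [colsq, hfs T d hd],
          fun i hi c' => S'.sq_ne (hsm _ T.2) (hsp _ T.2) (hf T) (hfs T) i d hd (by omega)
            (fun e => hi (Fin.ext e)) c', ?_, ?_⟩
        · intro e he hed
          exact absurd ⟨e, he, hed⟩ hc
        · intro e he he' hed M hM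
          rw [S'.cinj _ _ (by omega) hd hed]; exact hM
    choose t v i0 hv1 hv2 hv3 hv4 hv5 using hsqex
    obtain ⟨ζ, hζ1, hζ2, hζ3⟩ := ps_lift ω cls (f T) (hf T) ξ
      (fun v c hv hne => hξ v (f T c) c hv (hf T c) hne) hξ0 t v i0 hv1 hv2 hv3
    refine ⟨ζ, hζ1, ?_⟩
    obtain ⟨u, hu1, hu2⟩ := S.ker (hrm _ T.2) (hrp _ T.2) (hf T) (hfr T)
      (fun v => PowerSeries.C (ξ v) + (cls v).elim 0 ζ) hζ3
    obtain ⟨w, hw1, hw2⟩ := S'.ker (hsm _ T.2) (hsp _ T.2) (hf T) (hfs T)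
      (fun v => PowerSeries.C (ξ v) + (cls v).elim 0 ζ) hζ3
    let x : σ → PowerSeries L := fun v =>
      PowerSeries.X ^ ω v * (PowerSeries.C (ξ v) + (cls v).elim 0 ζ)
    have hux : ∀ k, k ≤ p + q → ∑ i : Fin (p + 1), u i * x (h i k) = 0 := by
      intro k hk
      exact hu2 k hk fun d hd _ => hv4 (cH d) d hd rfl x (hζ2 (cH d))
    have hwx0 : ∀ l, l ≤ p' + q' → l ≠ s T.1 0 → l ≠ s T.1 q' + q' →
        ∑ j : Fin (p' + 1), w j * x (h' j l) = 0 := by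
      intro l hl h1 h2
      refine hw2 l hl fun d hd hld => ?_
      have hd0 : d ≠ 0 := by rintro rfl; exact h1 hld
      have hd1 : d ≠ q' := by rintro rfl; exact h2 hld
      exact hv5 (cV d) d (by omega) (by omega) rfl x (hζ2 (cV d))
    have hdbl : ∀ e, e < 2 → ∑ i : Fin (p + 1), u i *
        ∑ j : Fin (p' + 1), w j * x (h' j (e * (p + 1) + i)) = 0 := by
      intro e he
      simp only [Finset.mul_sum]
      rw [Finset.sum_comm]
      refine Finset.sum_eq_zero fun j _ => ?_
      have h1 := hux (e * (p' + 1) + j) (by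
        have := j.2
        rcases (show e = 0 ∨ e = 1 by omega) with rfl | rfl <;> omega)
      have h2 : ∑ i : Fin (p + 1), u i * (w j * x (h' j (e * (p + 1) + i))) =
          w j * ∑ i : Fin (p + 1), u i * x (h i (e * (p' + 1) + j)) := by
        rw [Finset.mul_sum]
        refine Finset.sum_congr rfl fun i _ => ?_
        rw [hrel e i j he (by omega) (by omega)]; ring
      rw [h2, h1, mul_zero]
    have hexc : ∀ e, e < 2 → ∀ i0 : Fin (p + 1), u i0 ≠ 0 →
        (∀ i : Fin (p + 1), i ≠ i0 → e * (p + 1) + i ≠ s T.1 0 ∧ e * (p + 1) + i ≠ s T.1 q' + q') →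
        ∑ j : Fin (p' + 1), w j * x (h' j (e * (p + 1) + i0)) = 0 := by
      intro e he i0 hu0 hi
      have h1 := hdbl e he
      rw [Finset.sum_eq_single i0 (fun i _ hne => by
        rw [hwx0 _ (by
          have := i.2
          rcases (show e = 0 ∨ e = 1 by omega) with rfl | rfl <;> omega) (hi i hne).1 (hi i hne).2,
          mul_zero]) (fun hh => absurd (Finset.mem_univ _) hh)] at h1
      exact (mul_eq_zero.1 h1).resolve_left hu0
    have e0 := hrs0 T.1
    have e1 := hrq _ T.2
    have e2 := hsq _ T.2
    have e3 := hrp _ T.2 0 (Nat.zero_le _)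
    have hwx : ∀ l, l ≤ p' + q' → ∑ j : Fin (p' + 1), w j * x (h' j l) = 0 := by
      intro l hl
      by_cases hl0 : l = s T.1 0
      · have := hexc 0 (by omega) ⟨r T.1 0, by omega⟩ (hu1 0 (Nat.zero_le _) _ rfl) (by
          intro i hi
          have h1 : (i : ℕ) ≠ r T.1 0 := fun hh => hi (Fin.ext hh)
          have := i.2
          constructor <;> omega)
        simpa [hl0, ← hrs0] using this
      · by_cases hl1 : l = s T.1 q' + q'
        · have := hexc 1 (by omega) ⟨r T.1 q, by omega⟩ (hu1 q le_rfl _ rfl) (by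
            intro i hi
            have h1 : (i : ℕ) ≠ r T.1 q := fun hh => hi (Fin.ext hh)
            have := i.2
            constructor <;> omega)
          rw [hl1, show s T.1 q' + q' = 1 * (p + 1) + r T.1 q by omega]
          exact this
        · exact hwx0 l hl hl0 hl1
    refine hkill _ _ x ?_ ?_
    · intro cs _ hcs
      refine minor_zero _ u ?_ fun j => hux _ (hcs j)
      intro h0
      exact hu1 0 (Nat.zero_le _) ⟨r T.1 0, by omega⟩ rfl (by rw [h0]; rfl)
    · intro cs _ hcs
      refine minor_zero _ w ?_ fun j => hwx _ (hcs j)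
      intro h0
      exact hw1 q' le_rfl ⟨s T.1 q', by omega⟩ rfl (by rw [h0]; rfl)
end

noncomputable section
universe u

def hH (a b i k : ℕ) : Fin 2 × Fin (a + 1) × Fin (b + 1) :=
  (⟨(k / (b + 1)) % 2, Nat.mod_lt _ (by omega)⟩, ⟨i % (a + 1), Nat.mod_lt _ (by omega)⟩,
    ⟨k % (b + 1), Nat.mod_lt _ (by omega)⟩)

def hT (a b j l : ℕ) : Fin 2 × Fin (a + 1) × Fin (b + 1) :=
  (⟨(l / (a + 1)) % 2, Nat.mod_lt _ (by omega)⟩, ⟨l % (a + 1), Nat.mod_lt _ (by omega)⟩,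
    ⟨j % (b + 1), Nat.mod_lt _ (by omega)⟩)

theorem divmod_split (n k : ℕ) (hk : k < 2 * n) :
    (k < n ∧ k / n = 0 ∧ k % n = k) ∨ (n ≤ k ∧ k / n = 1 ∧ k % n = k - n) := by
  by_cases h : k < n
  · exact Or.inl ⟨h, Nat.div_eq_of_lt h, Nat.mod_eq_of_lt h⟩
  · refine Or.inr ⟨by omega, Nat.div_eq_of_lt_le (by omega) (by omega), ?_⟩
    rw [Nat.mod_eq_sub_mod (by omega), Nat.mod_eq_of_lt (by omega)]

theorem hrel_HT (a b e i j : ℕ) (he : e < 2) (hi : i ≤ a) (hj : j ≤ b) :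
    hH a b i (e * (b + 1) + j) = hT a b j (e * (a + 1) + i) := by
  have h1 : (e * (b + 1) + j) / (b + 1) = e := by
    rw [Nat.add_comm, Nat.add_mul_div_right _ _ (by omega), Nat.div_eq_of_lt (by omega)]; omega
  have h2 : (e * (a + 1) + i) / (a + 1) = e := by
    rw [Nat.add_comm, Nat.add_mul_div_right _ _ (by omega), Nat.div_eq_of_lt (by omega)]; omega
  have h3 : (e * (b + 1) + j) % (b + 1) = j % (b + 1) := by
    rw [Nat.add_comm, Nat.add_mul_mod_self_right]
  have h4 : (e * (a + 1) + i) % (a + 1) = i % (a + 1) := by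
    rw [Nat.add_comm, Nat.add_mul_mod_self_right]
  unfold hH hT
  simp only [h1, h2, h3, h4]

def wtf (a b : ℕ) (v : Fin 2 × Fin (a + 1) × Fin (b + 1)) : ℕ :=
  if (v.1 : ℕ) = 0 then (2 * (a + 1) - v.2.1) * (2 * (b + 1) + v.2.2)
  else (a + 1 - v.2.1) * (3 * (b + 1) + v.2.2)

theorem wt_H (a b q : ℕ) (hq : a + q + 1 = 2 * (b + 1)) :
    ∃ A B ρ κ : ℕ → ℤ, (∀ i j, i < j → j ≤ a → ρ i < ρ j) ∧
    (∀ k l, k < l → l ≤ a + q → κ k < κ l) ∧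
    ∀ i k, i ≤ a → k ≤ a + q → (wtf a b (hH a b i k) : ℤ) = A i + B k - ρ i * κ k := by
  refine ⟨fun _ => 0, fun k => (2 * (b + 1) + k) * (if k < b + 1 then 2 * (a + 1) else a + 1),
    fun i => i, fun k => 2 * (b + 1) + k, fun i j hij _ => by simpa using hij,
    fun k l hkl _ => by simpa using hkl, ?_⟩
  intro i k hi hk
  have hi' : i % (a + 1) = i := Nat.mod_eq_of_lt (by omega)
  rcases divmod_split (b + 1) k (by omega) with ⟨h1, h2, h3⟩ | ⟨h1, h2, h3⟩
  · simp only [wtf, hH, h2, h3, hi', Nat.zero_mod, if_true, if_pos h1]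
    push_cast [Nat.cast_sub (show i ≤ 2 * (a + 1) by omega)]
    ring
  · simp only [wtf, hH, h2, h3, hi', if_neg (show ¬ k < b + 1 by omega)]
    rw [if_neg (by norm_num)]
    push_cast [Nat.cast_sub (show i ≤ a + 1 by omega), Nat.cast_sub h1]
    ring

theorem wt_T (a b q : ℕ) (hq : b + q + 1 = 2 * (a + 1)) :
    ∃ A B ρ κ : ℕ → ℤ, (∀ i j, i < j → j ≤ b → ρ i < ρ j) ∧
    (∀ k l, k < l → l ≤ b + q → κ k < κ l) ∧
    ∀ i k, i ≤ b → k ≤ b + q → (wtf a b (hT a b i k) : ℤ) = A i + B k - ρ i * κ k := by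
  refine ⟨fun j => 2 * (a + 1) * (2 * (b + 1) + j),
    fun l => (if l < a + 1 then 0 else (b + 1) * (2 * (a + 1) - l)) - 2 * (b + 1) * l,
    fun i => i, fun k => k, fun i j hij _ => by simpa using hij,
    fun k l hkl _ => by simpa using hkl, ?_⟩
  intro j l hj hl
  have hj' : j % (b + 1) = j := Nat.mod_eq_of_lt (by omega)
  rcases divmod_split (a + 1) l (by omega) with ⟨h1, h2, h3⟩ | ⟨h1, h2, h3⟩
  · simp only [wtf, hT, h2, h3, hj', Nat.zero_mod, if_true, if_pos h1]
    push_cast [Nat.cast_sub (show l ≤ 2 * (a + 1) by omega)]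
    ring
  · simp only [wtf, hT, h2, h3, hj', if_neg (show ¬ l < a + 1 by omega)]
    rw [if_neg (by norm_num), show a + 1 - (l - (a + 1)) = 2 * (a + 1) - l by omega]
    push_cast [Nat.cast_sub (show l ≤ 2 * (a + 1) by omega)]
    ring

def cls1 {σ : Type*} (q : ℕ) (row col : σ → ℕ) (v : σ) : Option (Fin (q + 1)) :=
  if row v ≤ col v ∧ col v - row v ≤ q then
    some ⟨(col v - row v) % (q + 1), Nat.mod_lt _ (by omega)⟩ else none

theorem side_of {σ : Type*} (ω : σ → ℕ) (p q : ℕ) (h : ℕ → ℕ → σ) (row col : σ → ℕ)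
    (hrow : ∀ i k, i ≤ p → k ≤ p + q → row (h i k) = i)
    (hcol : ∀ i k, i ≤ p → k ≤ p + q → col (h i k) = k)
    (wt : ∃ A B ρ κ : ℕ → ℤ, (∀ i j, i < j → j ≤ p → ρ i < ρ j) ∧
      (∀ k l, k < l → l ≤ p + q → κ k < κ l) ∧
      ∀ i k, i ≤ p → k ≤ p + q → (ω (h i k) : ℤ) = A i + B k - ρ i * κ k) :
    Side ω (cls1 q row col) p q h (fun d => ⟨d % (q + 1), Nat.mod_lt _ (by omega)⟩) where
  cinj := by
    intro d e hd he hde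
    have := congrArg Fin.val hde
    simpa [Nat.mod_eq_of_lt (show d < q + 1 by omega),
      Nat.mod_eq_of_lt (show e < q + 1 by omega)] using this
  hcls := by
    intro i d hi hd
    unfold cls1
    have h1 := hrow i (i + d) hi (by omega)
    have h2 := hcol i (i + d) hi (by omega)
    have h3 : col (h i (i + d)) - row (h i (i + d)) = d := by omega
    rw [if_pos (by omega)]
    simp only [h3]
  hinj := by
    intro i j d hi hj hd hh
    rw [← hrow i (i + d) hi (by omega), hh, hrow j (j + d) hj (by omega)]
  wt := wt

theorem fin_strictMono_eq_id {t : ℕ} (f : Fin t → Fin t) (hf : StrictMono f) : f = id := by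
  have hb : Function.Bijective f := Finite.injective_iff_bijective.1 hf.injective
  have := perm_mono_one (Equiv.ofBijective f hb) hf
  funext i
  simpa using congrArg (fun e : Equiv.Perm (Fin t) => e i) this

theorem det_mem_of {R : Type*} [CommRing R] (I : Ideal R) {t : ℕ} (M : Matrix (Fin (t + 1)) (Fin (t + 1)) R)
    (h : ∀ i j, M i j ∈ I) : M.det ∈ I := by
  rw [Matrix.det_succ_column_zero]
  exact Ideal.sum_mem _ fun i _ => I.mul_mem_right _ (I.mul_mem_left _ (h _ _))

section
variable (K : Type u) [Field K] (a b : ℕ)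

abbrev Jd : Ideal (MvPolynomial (Fin 2 × Fin (a + 1) × Fin (b + 1)) K) :=
  doubleDetIdeal K 2 (a + 1) (b + 1) (a + 1) (b + 1) (Nat.succ_pos a) (Nat.succ_pos b)

theorem varH_eq (i : Fin (a + 1)) (k : Fin (2 * (b + 1))) :
    varH 2 (a + 1) (b + 1) (Nat.succ_pos b) i k = hH a b i k := by
  have h1 : (k : ℕ) / (b + 1) < 2 := (Nat.div_lt_iff_lt_mul (Nat.succ_pos b)).mpr k.2
  unfold varH hH
  ext
  · simp [Nat.mod_eq_of_lt h1]
  · simp [Nat.mod_eq_of_lt i.2]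
  · simp

theorem varV_eq (k : Fin (2 * (a + 1))) (j : Fin (b + 1)) :
    varV 2 (a + 1) (b + 1) (Nat.succ_pos a) k j = hT a b j k := by
  have h1 : (k : ℕ) / (a + 1) < 2 := (Nat.div_lt_iff_lt_mul (Nat.succ_pos a)).mpr k.2
  unfold varV hT
  ext
  · simp [Nat.mod_eq_of_lt h1]
  · simp
  · simp [Nat.mod_eq_of_lt j.2]

theorem Jd_le : Jd K a b ≤ Ideal.span (Set.range X) := by
  refine Ideal.span_le.2 ?_
  rintro g (⟨rs, cs, -, -, rfl⟩ | ⟨rs, cs, -, -, rfl⟩)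
  · exact det_mem_of _ _ fun i j => Ideal.subset_span ⟨_, rfl⟩
  · exact det_mem_of _ _ fun i j => Ideal.subset_span ⟨_, rfl⟩

theorem Jd_H (cs : Fin (a + 1) → ℕ) (hcs : StrictMono cs) (hb : ∀ j, cs j < 2 * (b + 1)) :
    (Matrix.of fun i j : Fin (a + 1) => (X (hH a b i (cs j)) :
      MvPolynomial (Fin 2 × Fin (a + 1) × Fin (b + 1)) K)).det ∈ Jd K a b := by
  refine Ideal.subset_span (Or.inl ⟨id, fun j => ⟨cs j, hb j⟩, (fun _ _ hij => hij), fun i j hij => hcs hij, ?_⟩)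
  congr 1
  ext1 i j
  simp [Hmat, varH_eq]

theorem Jd_T (cs : Fin (b + 1) → ℕ) (hcs : StrictMono cs) (hb : ∀ j, cs j < 2 * (a + 1)) :
    (Matrix.of fun i j : Fin (b + 1) => (X (hT a b i (cs j)) :
      MvPolynomial (Fin 2 × Fin (a + 1) × Fin (b + 1)) K)).det ∈ Jd K a b := by
  refine Ideal.subset_span (Or.inr ⟨fun j => ⟨cs j, hb j⟩, id, fun i j hij => hcs hij, (fun _ _ hij => hij), ?_⟩)
  rw [← Matrix.det_transpose]
  congr 1
  ext1 i j
  simp [Vmat, varV_eq]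

theorem Jd_kill {A : Type*} [CommRing A] (φ : K →+* A)
    (x : Fin 2 × Fin (a + 1) × Fin (b + 1) → A)
    (h1 : ∀ cs : Fin (a + 1) → ℕ, StrictMono cs → (∀ j, cs j < 2 * (b + 1)) →
        (Matrix.of fun i j : Fin (a + 1) => x (hH a b i (cs j))).det = 0)
    (h2 : ∀ cs : Fin (b + 1) → ℕ, StrictMono cs → (∀ j, cs j < 2 * (a + 1)) →
        (Matrix.of fun i j : Fin (b + 1) => x (hT a b i (cs j))).det = 0) :
    ∀ g ∈ Jd K a b, eval₂ φ x g = 0 := by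
  have : Jd K a b ≤ RingHom.ker (eval₂Hom φ x) := by
    refine Ideal.span_le.2 ?_
    rintro g (⟨rs, cs, hrs, hcs, rfl⟩ | ⟨rs, cs, hrs, hcs, rfl⟩)
    · have := fin_strictMono_eq_id rs hrs
      subst this
      change eval₂Hom φ x _ = 0
      rw [RingHom.map_det]
      rw [← h1 (fun j => cs j) (fun i j hij => hcs hij) (fun j => (cs j).2)]
      congr 1
      ext1 i j
      simp [Hmat, varH_eq]
    · have := fin_strictMono_eq_id cs hcs
      subst this
      change eval₂Hom φ x _ = 0
      rw [RingHom.map_det]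
      rw [← h2 (fun j => rs j) (fun i j hij => hrs hij) (fun j => (rs j).2), ← Matrix.det_transpose]
      congr 1
      ext1 i j
      simp [Vmat, varV_eq]
  intro g hg
  exact this hg
end

theorem kill_other {A : Type*} [CommRing A] [IsDomain A] (m n : ℕ) (hmn : 2 * m ≤ n + 1)
    (P Q : ℕ → ℕ → A)
    (hPQ : ∀ e i j, e < 2 → i < m → j < n → P i (e * n + j) = Q j (e * m + i))
    (u : Fin m → A) (hu0 : u ≠ 0) (hu : ∀ k, k < 2 * n → ∑ i : Fin m, u i * P i k = 0)
    (cs : Fin n → ℕ) (hcs : StrictMono cs) (hb : ∀ j, cs j < 2 * m) :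
    (Matrix.of fun i j : Fin n => Q i (cs j)).det = 0 := by
  classical
  have hex : ∃ e, e < 2 ∧ ∀ i : Fin m, ∃ j, cs j = e * m + i := by
    by_contra hc
    push Not at hc
    obtain ⟨i0, h0⟩ := hc 0 (by omega)
    obtain ⟨i1, h1⟩ := hc 1 (by omega)
    have hsub : Finset.univ.image cs ⊆ ((Finset.range (2 * m)).erase i0).erase (m + i1) := by
      intro y hy
      simp only [Finset.mem_image, Finset.mem_univ, true_and] at hy
      obtain ⟨j, rfl⟩ := hy
      simp only [Finset.mem_erase, Finset.mem_range]
      have a0 := h0 j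
      have a1 := h1 j
      exact ⟨by omega, by omega, hb j⟩
    have h3 := Finset.card_le_card hsub
    rw [Finset.card_image_of_injective _ hcs.injective, Finset.card_univ, Fintype.card_fin,
      Finset.card_erase_of_mem, Finset.card_erase_of_mem, Finset.card_range] at h3
    · have := i0.2; omega
    · simp; omega
    · simp; omega
  obtain ⟨e, he, hJ⟩ := hex
  choose Jf hJf using hJ
  have hinj : Function.Injective Jf := by
    intro i j hij
    have h1 := hJf i
    rw [hij, hJf j] at h1
    exact Fin.ext (by omega)
  rw [← Matrix.det_transpose]
  obtain ⟨i0, hi0⟩ := Function.ne_iff.1 hu0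
  refine minor_zero _ (fun j => ∑ i, if Jf i = j then u i else 0) ?_ ?_
  · intro h0
    apply hi0
    have := congrFun h0 (Jf i0)
    simpa [hinj.eq_iff] using this
  · intro k
    simp only [Finset.sum_mul, Matrix.transpose_apply, Matrix.of_apply]
    rw [Finset.sum_comm]
    simp only [ite_mul, zero_mul, Finset.sum_ite_eq, Finset.mem_univ, if_true]
    have h1 := hu (e * n + k) (by
      have := k.2
      rcases (show e = 0 ∨ e = 1 by omega) with rfl | rfl <;> omega)
    rw [← h1]
    refine Finset.sum_congr rfl fun i _ => ?_
    rw [hJf, hPQ e i k he i.2 k.2]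
end

noncomputable section
universe u

theorem row_hH (a b i k : ℕ) (hi : i ≤ a) : ((hH a b i k).2.1 : ℕ) = i := by
  simp [hH, Nat.mod_eq_of_lt (show i < a + 1 by omega)]

theorem col_hH (a b i k : ℕ) (hk : k < 2 * (b + 1)) :
    ((hH a b i k).1 : ℕ) * (b + 1) + (hH a b i k).2.2 = k := by
  rcases divmod_split (b + 1) k hk with ⟨h1, h2, h3⟩ | ⟨h1, h2, h3⟩
  · simp [hH, h2, h3]
  · simp [hH, h2, h3]; omega

theorem row_hT (a b j l : ℕ) (hj : j ≤ b) : ((hT a b j l).2.2 : ℕ) = j := by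
  simp [hT, Nat.mod_eq_of_lt (show j < b + 1 by omega)]

theorem col_hT (a b j l : ℕ) (hl : l < 2 * (a + 1)) :
    ((hT a b j l).1 : ℕ) * (a + 1) + (hT a b j l).2.1 = l := by
  rcases divmod_split (a + 1) l hl with ⟨h1, h2, h3⟩ | ⟨h1, h2, h3⟩
  · simp [hT, h2, h3]
  · simp [hT, h2, h3]; omega

theorem caseII (K : Type u) [Field K] (a b : ℕ) (hab : 2 * (a + 1) ≤ b + 1 + 1) :
    IsReduced (MvPolynomial (Fin 2 × Fin (a + 1) × Fin (b + 1)) K ⧸ Jd K a b) ∧ stdCM (Jd K a b) := by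
  obtain ⟨q, hq⟩ : ∃ q, a + q + 1 = 2 * (b + 1) := ⟨2 * (b + 1) - a - 1, by omega⟩
  have S := side_of (wtf a b) a q (hH a b) (fun v => v.2.1) (fun v => v.1 * (b + 1) + v.2.2)
    (fun i k hi _ => row_hH a b i k hi) (fun i k _ hk => col_hH a b i k (by omega)) (wt_H a b q hq)
  refine one_side (Jd K a b) (Jd_le K a b) _ _ a q (hH a b) _ S ?_ ?_ ?_
  · intro c
    exact ⟨c, by omega, Fin.ext (Nat.mod_eq_of_lt c.2)⟩
  · intro cs hcs hb
    exact Jd_H K a b cs hcs fun j => by have := hb j; omega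
  · intro A _ _ φ x u hu0 hu
    refine Jd_kill K a b φ x ?_ ?_
    · intro cs _ hb
      exact minor_zero _ u hu0 fun j => hu _ (by have := hb j; omega)
    · intro cs hcs hb
      exact kill_other (a + 1) (b + 1) hab (fun i k => x (hH a b i k)) (fun j l => x (hT a b j l))
        (fun e i j he hi hj => by rw [hrel_HT a b e i j he (by omega) (by omega)]) u hu0
        (fun k hk => hu k (by omega)) cs hcs hb

theorem caseIII (K : Type u) [Field K] (a b : ℕ) (hab : 2 * (b + 1) ≤ a + 1 + 1) :
    IsReduced (MvPolynomial (Fin 2 × Fin (a + 1) × Fin (b + 1)) K ⧸ Jd K a b) ∧ stdCM (Jd K a b) := by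
  obtain ⟨q, hq⟩ : ∃ q, b + q + 1 = 2 * (a + 1) := ⟨2 * (a + 1) - b - 1, by omega⟩
  have S := side_of (wtf a b) b q (hT a b) (fun v => v.2.2) (fun v => v.1 * (a + 1) + v.2.1)
    (fun i k hi _ => row_hT a b i k hi) (fun i k _ hk => col_hT a b i k (by omega)) (wt_T a b q hq)
  refine one_side (Jd K a b) (Jd_le K a b) _ _ b q (hT a b) _ S ?_ ?_ ?_
  · intro c
    exact ⟨c, by omega, Fin.ext (Nat.mod_eq_of_lt c.2)⟩
  · intro cs hcs hb
    exact Jd_T K a b cs hcs fun j => by have := hb j; omega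
  · intro A _ _ φ x u hu0 hu
    refine Jd_kill K a b φ x ?_ ?_
    · intro cs hcs hb
      exact kill_other (b + 1) (a + 1) hab (fun j l => x (hT a b j l)) (fun i k => x (hH a b i k))
        (fun e i j he hi hj => by rw [hrel_HT a b e j i he (by omega) (by omega)]) u hu0
        (fun k hk => hu k (by omega)) cs hcs hb
    · intro cs _ hb
      exact minor_zero _ u hu0 fun j => hu _ (by have := hb j; omega)

def toRes (a b k : ℕ) : Fin (a + b + 2) := ⟨k % (a + b + 2), Nat.mod_lt _ (by omega)⟩

def clsI (a b : ℕ) (v : Fin 2 × Fin (a + 1) × Fin (b + 1)) : Option (Fin (a + b + 2)) :=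
  some (toRes a b (v.1 * (b + 1) + v.2.2 + (a + b + 2) - v.2.1))

theorem toRes_inj (a b k l : ℕ) (h : toRes a b k = toRes a b l) : k % (a + b + 2) = l % (a + b + 2) :=
  congrArg Fin.val h

theorem caseI (K : Type u) [Field K] (a b : ℕ) (h1 : b + 1 + 1 < 2 * (a + 1)) (h2 : a + 1 + 1 < 2 * (b + 1)) :
    IsReduced (MvPolynomial (Fin 2 × Fin (a + 1) × Fin (b + 1)) K ⧸ Jd K a b) ∧ stdCM (Jd K a b) := by
  obtain ⟨q, hq⟩ : ∃ q, a + q + 1 = 2 * (b + 1) := ⟨2 * (b + 1) - a - 1, by omega⟩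
  obtain ⟨q', hq'⟩ : ∃ q, b + q + 1 = 2 * (a + 1) := ⟨2 * (a + 1) - b - 1, by omega⟩
  have S : Side (wtf a b) (clsI a b) a q (hH a b) (toRes a b) :=
    { cinj := by
        intro d e hd he hde
        have := toRes_inj _ _ _ _ hde
        rwa [Nat.mod_eq_of_lt (by omega), Nat.mod_eq_of_lt (by omega)] at this
      hcls := by
        intro i d hi hd
        have r1 := row_hH a b i (i + d) hi
        have r2 := col_hH a b i (i + d) (by omega)
        unfold clsI
        rw [r2, r1, show i + d + (a + b + 2) - i = d + (a + b + 2) by omega]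
        simp [toRes]
      hinj := by
        intro i j d hi hj hd hh
        rw [← row_hH a b i (i + d) hi, hh, row_hH a b j (j + d) hj]
      wt := wt_H a b q hq }
  have S' : Side (wtf a b) (clsI a b) b q' (hT a b) (fun d => toRes a b (a + b + 2 - d)) :=
    { cinj := by
        intro d e hd he hde
        have := toRes_inj _ _ _ _ hde
        rcases Nat.eq_zero_or_pos d with h | h <;> rcases Nat.eq_zero_or_pos e with h' | h'
        · omega
        · subst h
          rw [Nat.sub_zero, Nat.mod_self, Nat.mod_eq_of_lt (by omega)] at this; omega
        · subst h'
          rw [Nat.sub_zero, Nat.mod_self, Nat.mod_eq_of_lt (by omega)] at this; omega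
        · rw [Nat.mod_eq_of_lt (by omega), Nat.mod_eq_of_lt (by omega)] at this; omega
      hcls := by
        intro j d hj hd
        have r1 := row_hT a b j (j + d) hj
        have r2 := col_hT a b j (j + d) (by omega)
        have r3 := (hT a b j (j + d)).1.2
        have r4 := (hT a b j (j + d)).2.1.2
        unfold clsI
        congr 1
        apply Fin.ext
        simp only [toRes]
        rw [r1]
        rcases (show ((hT a b j (j + d)).1 : ℕ) = 0 ∨ ((hT a b j (j + d)).1 : ℕ) = 1 by omega) with e | e
        · rw [e] at r2 ⊢
          congr 1; omega
        · rw [e] at r2 ⊢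
          rw [show 1 * (b + 1) + j + (a + b + 2) - ((hT a b j (j + d)).2.1 : ℕ) =
            a + b + 2 - d + (a + b + 2) by omega, Nat.add_mod_right]
      hinj := by
        intro i j d hi hj hd hh
        rw [← row_hT a b i (i + d) hi, hh, row_hT a b j (j + d) hj]
      wt := wt_T a b q' hq' }
  refine two_side (Jd K a b) (Jd_le K a b) _ _ a q b q' (hH a b) (hT a b) _ _ S S' hq hq'
    (by omega) (by omega) ?_ ?_ ?_ ?_ ?_ ?_ ?_ ?_
  · simp [toRes]
  · congr 1; omega
  · intro c
    by_cases hc : (c : ℕ) ≤ q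
    · exact Or.inl ⟨c, hc, Fin.ext (Nat.mod_eq_of_lt c.2)⟩
    · refine Or.inr ⟨a + b + 2 - c, by omega, Fin.ext ?_⟩
      simp only [toRes]
      rw [Nat.mod_eq_of_lt (by omega)]; omega
  · intro d e hd he he' hde
    have := toRes_inj _ _ _ _ hde
    rw [Nat.mod_eq_of_lt (by omega), Nat.mod_eq_of_lt (by omega)] at this
    omega
  · intro e i j he hi hj
    exact hrel_HT a b e i j he hi hj
  · intro cs hcs hb
    exact Jd_H K a b cs hcs fun j => by have := hb j; omega
  · intro cs hcs hb
    exact Jd_T K a b cs hcs fun j => by have := hb j; omega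
  · intro A _ _ φ x hx hx'
    exact Jd_kill K a b φ x (fun cs hcs hb => hx cs hcs fun j => by have := hb j; omega)
      (fun cs hcs hb => hx' cs hcs fun j => by have := hb j; omega)

theorem main_final (K : Type u) [Field K] (m n : ℕ) (hm : 0 < m) (hn : 0 < n) :
    IsReduced (MvPolynomial (Fin 2 × Fin m × Fin n) K ⧸ doubleDetIdeal K 2 m n m n hm hn) ∧
    stdCM (doubleDetIdeal K 2 m n m n hm hn) := by
  obtain ⟨a, rfl⟩ : ∃ a, m = a + 1 := ⟨m - 1, by omega⟩
  obtain ⟨b, rfl⟩ : ∃ b, n = b + 1 := ⟨n - 1, by omega⟩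
  by_cases h1 : 2 * (a + 1) ≤ b + 1 + 1
  · exact caseII K a b h1
  by_cases h2 : 2 * (b + 1) ≤ a + 1 + 1
  · exact caseIII K a b h2
  exact caseI K a b (by omega) (by omega)
end

theorem two_matrix_maximal_minors_reduced_CM (K : Type*) [Field K] (m n : ℕ)
    (hm : 0 < m) (hn : 0 < n) :
    IsReduced (MvPolynomial (Fin 2 × Fin m × Fin n) K ⧸ doubleDetIdeal K 2 m n m n hm hn) ∧
    stdCM (doubleDetIdeal K 2 m n m n hm hn) := by
  exact main_final K m n hm hn

end
end

section
/- Fix r, m, n ≥ 1 and s ≤ m, t ≤ n. Let X_1, …, X_r be m × n matrices of distinct indeterminates, H their m × rn horizontal concatenation and V their rm × n vertical concatenation, and let J = I_s(H) + I_t(V) be the double determinantal ideal. Then with respect to any diagonal term order, the s-minors of H together with the t-minors of V form a Gröbner basis of J. -/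
/-!
Statement 9: the s-minors of the horizontal concatenation H of r generic m × n
matrices together with the t-minors of their vertical concatenation V form a
Gröbner basis of the double determinantal ideal J = I_s(H) + I_t(V) with respect
to any diagonal term order.
-/

open MvPolynomial

noncomputable section

/-! ### Heights -/

section Heights

variable {σ : Type*}

theorem ddg_exists_height [Finite σ] (P : Set σ) (R : σ → σ → Prop)
    (htr : ∀ a b c, R a b → R b c → R a c) (hir : ∀ a, ¬ R a a) :
    ∃ h : σ → ℕ, (∀ w ∈ P, ∀ u, R w u → h w < h u) ∧
      (∀ u, ∀ c < h u, ∃ w ∈ P, R w u ∧ h w = c) := by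
  classical
  have := Fintype.ofFinite σ
  have : IsTrans σ R := ⟨htr⟩
  have : Std.Irrefl R := ⟨hir⟩
  have wf : WellFounded R := Finite.wellFounded_of_trans_of_irrefl R
  let F : ∀ u : σ, (∀ w, R w u → ℕ) → ℕ := fun u ih =>
    Finset.univ.sup (fun w : σ => if hw : w ∈ P ∧ R w u then ih w hw.2 + 1 else 0)
  have hfix : ∀ u, wf.fix F u = Finset.univ.sup
      (fun w : σ => if w ∈ P ∧ R w u then wf.fix F w + 1 else 0) := by
    intro u
    rw [wf.fix_eq]
    simp only [F, dite_eq_ite]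
  refine ⟨wf.fix F, ?_, ?_⟩
  · intro w hw u hwu
    rw [hfix u]
    have := Finset.le_sup (f := fun w : σ => if w ∈ P ∧ R w u then wf.fix F w + 1 else 0)
      (Finset.mem_univ w)
    simp only [hw, hwu, and_self, if_true] at this
    omega
  · intro u
    induction u using wf.induction with
    | _ u ih =>
      intro c hc
      rw [hfix u, Finset.lt_sup_iff] at hc
      obtain ⟨w, -, hw⟩ := hc
      split_ifs at hw with h
      · rcases Nat.lt_succ_iff_lt_or_eq.mp hw with h1 | h1
        · obtain ⟨w', hw', hr, he⟩ := ih w h.2 c h1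
          exact ⟨w', hw', htr _ _ _ hr h.2, he⟩
        · exact ⟨w, h.1, h.2, h1.symm⟩
      · omega

/-- The two properties of a height function. -/
def DDGIsHeight (P : Set σ) (R : σ → σ → Prop) (h : σ → ℕ) : Prop :=
  (∀ w ∈ P, ∀ u, R w u → h w < h u) ∧ (∀ u, ∀ c < h u, ∃ w ∈ P, R w u ∧ h w = c)

theorem DDGIsHeight.mono {P : Set σ} {R : σ → σ → Prop} {h : σ → ℕ} (H : DDGIsHeight P R h)
    {x y : σ} (hxy : ∀ w, R w x → R w y) : h x ≤ h y := by
  by_contra hc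
  push Not at hc
  obtain ⟨w, hw, hr, he⟩ := H.2 x _ hc
  have := H.1 w hw y (hxy w hr)
  omega

theorem DDGIsHeight.chain {P : Set σ} {R : σ → σ → Prop} {h : σ → ℕ} (H : DDGIsHeight P R h)
    (htr : ∀ a b c, R a b → R b c → R a c) (c : ℕ) : ∀ u ∈ P, c ≤ h u →
    ∃ f : Fin (c + 1) → σ, (∀ i, f i ∈ P) ∧ (∀ i j, i < j → R (f i) (f j)) ∧
      f (Fin.last c) = u := by
  induction c with
  | zero =>
    intro u hu _
    exact ⟨fun _ => u, fun _ => hu, fun i j hij => by omega, rfl⟩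
  | succ c ih =>
    intro u hu hc
    obtain ⟨w, hw, hr, he⟩ := H.2 u c (by omega)
    obtain ⟨f, hf1, hf2, hf3⟩ := ih w hw he.ge
    refine ⟨Fin.snoc f u, ?_, ?_, by simp⟩
    · intro i
      refine Fin.lastCases ?_ (fun i => ?_) i
      · simpa using hu
      · simpa using hf1 i
    · intro i j
      refine Fin.lastCases ?_ (fun i => ?_) i
      · intro hlt
        exact absurd hlt (not_lt.mpr (Fin.le_last _))
      · refine Fin.lastCases ?_ (fun j => ?_) j
        · intro _
          simp only [Fin.snoc_castSucc, Fin.snoc_last]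
          rcases (Fin.le_last i).lt_or_eq with h1 | h1
          · exact htr _ _ _ (hf3 ▸ hf2 i _ h1) hr
          · rw [h1, hf3]; exact hr
        · intro hlt
          simp only [Fin.snoc_castSucc]
          exact hf2 i j (by simpa using hlt)

end Heights

/-! ### The two chain relations -/

section Rel

variable {r m n : ℕ}

/-- Chains in the horizontal concatenation. -/
def DDGHL (x y : Fin r × Fin m × Fin n) : Prop :=
  x.2.1 < y.2.1 ∧ (x.1 < y.1 ∨ x.1 = y.1 ∧ x.2.2 < y.2.2)

/-- Chains in the vertical concatenation. -/
def DDGVL (x y : Fin r × Fin m × Fin n) : Prop :=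
  x.2.2 < y.2.2 ∧ (x.1 < y.1 ∨ x.1 = y.1 ∧ x.2.1 < y.2.1)

theorem DDGHL.trans' (a b c : Fin r × Fin m × Fin n) (h1 : DDGHL a b) (h2 : DDGHL b c) :
    DDGHL a c := by
  unfold DDGHL at *
  grind

theorem DDGHL.irrefl' (a : Fin r × Fin m × Fin n) : ¬ DDGHL a a := by
  unfold DDGHL
  grind

theorem DDGVL.trans' (a b c : Fin r × Fin m × Fin n) (h1 : DDGVL a b) (h2 : DDGVL b c) :
    DDGVL a c := by
  unfold DDGVL at *
  grind

theorem DDGVL.irrefl' (a : Fin r × Fin m × Fin n) : ¬ DDGVL a a := by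
  unfold DDGVL
  grind

theorem ddg_lemmaN {P : Set (Fin r × Fin m × Fin n)} {H V : Fin r × Fin m × Fin n → ℕ}
    (hH : DDGIsHeight P DDGHL H) (hV : DDGIsHeight P DDGVL V) (c : ℕ) :
    ∀ f u : Fin r × Fin m × Fin n, H f = c → f.1 = u.1 → u.2.1 ≤ f.2.1 → f.2.2 ≤ u.2.2 →
      H f < H u → V u ≤ V f → False := by
  induction c using Nat.strong_induction_on with
  | _ c ih =>
    intro f u hc hq hi hj hk hl
    obtain ⟨a, ha, har, hae⟩ := hH.2 u _ hk
    have h1 : ¬ DDGHL a f := fun h => by have := hH.1 a ha f h; omega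
    unfold DDGHL at h1 har
    have h2 : a.1 = u.1 := by grind
    have h3 : f.2.2 ≤ a.2.2 := by grind
    have h4 : DDGVL a u := by unfold DDGVL; grind
    have h5 := hV.1 a ha u h4
    obtain ⟨b, hb, hbr, hbe⟩ := hV.2 f (V a) (by omega)
    have h6 : ¬ DDGVL b a := fun h => by have := hV.1 b hb a h; omega
    unfold DDGVL at h6 hbr
    have h7 : b.1 = f.1 := by grind
    have h8 : a.2.1 ≤ b.2.1 := by grind
    have h9 : DDGHL b f := by unfold DDGHL; grind
    have h10 := hH.1 b hb f h9
    exact ih (H b) (by omega) b a rfl (by grind) h8 (by grind) (by omega) hbe.ge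

theorem ddg_lemmaN' {P : Set (Fin r × Fin m × Fin n)} {H V : Fin r × Fin m × Fin n → ℕ}
    (hH : DDGIsHeight P DDGHL H) (hV : DDGIsHeight P DDGVL V) (c : ℕ) :
    ∀ u f : Fin r × Fin m × Fin n, V u = c → f.1 = u.1 → u.2.1 ≤ f.2.1 → f.2.2 ≤ u.2.2 →
      V u < V f → H f ≤ H u → False := by
  induction c using Nat.strong_induction_on with
  | _ c ih =>
    intro f u hc hq hi hj hk hl
    obtain ⟨a, ha, har, hae⟩ := hV.2 u _ hk
    have h1 : ¬ DDGVL a f := fun h => by have := hV.1 a ha f h; omega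
    unfold DDGVL at h1 har
    have h2 : a.1 = u.1 := by grind
    have h3 : f.2.1 ≤ a.2.1 := by grind
    have h4 : DDGHL a u := by unfold DDGHL; grind
    have h5 := hH.1 a ha u h4
    obtain ⟨b, hb, hbr, hbe⟩ := hH.2 f (H a) (by omega)
    have h6 : ¬ DDGHL b a := fun h => by have := hH.1 b hb a h; omega
    unfold DDGHL at h6 hbr
    have h7 : b.1 = f.1 := by grind
    have h8 : a.2.2 ≤ b.2.2 := by grind
    have h9 : DDGVL b f := by unfold DDGVL; grind
    have h10 := hV.1 b hb f h9
    exact ih (V b) (by omega) b a rfl (by grind) (by grind) h8 (by omega) hbe.ge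

end Rel

/-! ### Counting -/

section Count

variable {T T' : Type} [Fintype T] [Fintype T']

/-- The number of indices satisfying a predicate. -/
def ddgCnt (p : T → Prop) : ℕ := by
  classical exact (Finset.univ.filter p).card

theorem ddgCnt_eq [inst : DecidablePred (α := T) p] : ddgCnt p = (Finset.univ.filter p).card := by
  unfold ddgCnt
  congr

/-- The distribution of a function. -/
def ddgDist {α : Type*} (f : T → α) : Multiset α := (Finset.univ : Finset T).val.map f

theorem ddgDist_cnt {α : Type*} {f : T → α} {f' : T' → α} (h : ddgDist f = ddgDist f')
    (p : α → Prop) : ddgCnt (fun t => p (f t)) = ddgCnt (fun t => p (f' t)) := by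
  classical
  have h1 : (ddgDist f).countP p = (ddgDist f').countP p := by rw [h]
  unfold ddgDist at h1
  rw [Multiset.countP_map, Multiset.countP_map] at h1
  rw [ddgCnt_eq, ddgCnt_eq]
  exact h1

theorem ddgDist_sum {α β : Type*} [AddCommMonoid β] {f : T → α} {f' : T' → α}
    (h : ddgDist f = ddgDist f') (g : α → β) : ∑ t, g (f t) = ∑ t, g (f' t) := by
  have h1 : ((ddgDist f).map g).sum = ((ddgDist f').map g).sum := by rw [h]
  unfold ddgDist at h1
  rw [Multiset.map_map, Multiset.map_map] at h1
  exact h1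

theorem ddgDist_comp {α β : Type*} {f : T → α} {f' : T' → α}
    (h : ddgDist f = ddgDist f') (g : α → β) :
    ddgDist (fun t => g (f t)) = ddgDist (fun t => g (f' t)) := by
  have h1 : ((ddgDist f).map g) = ((ddgDist f').map g) := by rw [h]
  unfold ddgDist at h1
  rw [Multiset.map_map, Multiset.map_map] at h1
  exact h1

theorem ddgDist_equiv {α : Type*} (f : T → α) (e : T ≃ T) :
    ddgDist (fun t => f (e t)) = ddgDist f := by
  unfold ddgDist
  have : (fun t => f (e t)) = f ∘ e := rfl
  rw [this, ← Multiset.map_map, Multiset.map_univ_val_equiv]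

/-- The monomial of a family. -/
def ddgMono {α : Type*} (f : T → α) : α →₀ ℕ := ∑ t, Finsupp.single (f t) 1

theorem ddgMono_eq_iff {α : Type*} {f : T → α} {f' : T' → α} :
    ddgMono f = ddgMono f' ↔ ddgDist f = ddgDist f' := by
  classical
  constructor
  · intro h
    have key : ∀ {S : Type} [Fintype S] (g : S → α),
        Finsupp.toMultiset (ddgMono g) = ddgDist g := by
      intro S _ g
      unfold ddgMono
      rw [map_sum]
      simp only [Finsupp.toMultiset_single, one_smul]
      unfold ddgDist
      rw [Finset.sum_eq_multiset_sum]
      have h2 := Multiset.sum_map_singleton (Multiset.map g Finset.univ.val)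
      rw [Multiset.map_map] at h2
      exact h2
    rw [← key, ← key, h]
  · intro h
    exact ddgDist_sum h (fun x => Finsupp.single x 1)

theorem ddgCnt_nested {p p' : T → Prop} (h : (∀ t, p t → p' t) ∨ (∀ t, p' t → p t)) :
    ddgCnt (fun t => p t ∧ p' t) = min (ddgCnt p) (ddgCnt p') := by
  classical
  simp only [ddgCnt_eq]
  rcases h with h | h
  · rw [min_eq_left (Finset.card_le_card (Finset.monotone_filter_right _ (fun t _ => h t)))]
    congr 1; ext t; simp; exact h t
  · rw [min_eq_right (Finset.card_le_card (Finset.monotone_filter_right _ (fun t _ => h t)))]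
    congr 1; ext t; simp; exact h t

theorem ddgCnt_mono {p p' : T → Prop} (h : ∀ t, p t → p' t) : ddgCnt p ≤ ddgCnt p' := by
  classical
  simp only [ddgCnt_eq]
  exact Finset.card_le_card (Finset.monotone_filter_right _ (fun t _ => h t))

theorem ddgCnt_or_and (p p' : T → Prop) :
    ddgCnt (fun t => p t ∨ p' t) + ddgCnt (fun t => p t ∧ p' t) = ddgCnt p + ddgCnt p' := by
  classical
  simp only [ddgCnt_eq]
  rw [Finset.filter_or, Finset.filter_and]
  exact Finset.card_union_add_card_inter _ _

theorem ddgCnt_split (p p' : T → Prop) :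
    ddgCnt (fun t => p t ∧ p' t) + ddgCnt (fun t => p t ∧ ¬ p' t) = ddgCnt p := by
  classical
  simp only [ddgCnt_eq]
  rw [← Finset.filter_filter, ← Finset.filter_filter]
  exact Finset.card_filter_add_card_filter_not _

theorem ddgCnt_eq_of_le {p p' : T → Prop} (h : ∀ t, p t → p' t) (hc : ddgCnt p' ≤ ddgCnt p) :
    ∀ t, p' t → p t := by
  classical
  simp only [ddgCnt_eq] at hc
  have := Finset.eq_of_subset_of_card_le (Finset.monotone_filter_right _ (fun t _ => h t)) hc
  intro t ht
  have h2 : t ∈ Finset.univ.filter p' := by simpa using ht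
  rw [← this] at h2
  simpa using h2

/-- per-block counts for one label -/
theorem ddg_block1 {q i κ : T → ℕ} {q' i' κ' : T' → ℕ}
    (d1 : ddgDist (fun t => (i t, κ t)) = ddgDist (fun t => (i' t, κ' t)))
    (d2 : ddgDist (fun t => (q t, κ t)) = ddgDist (fun t => (q' t, κ' t)))
    (hf : ∀ s t, κ s = κ t → i s < i t → q s < q t → False)
    (hf' : ∀ s t, κ' s = κ' t → i' s < i' t → q' s < q' t → False) (q0 i0 k0 : ℕ) :
    ddgCnt (fun t => q t = q0 ∧ i t ≤ i0 ∧ κ t = k0) =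
      ddgCnt (fun t => q' t = q0 ∧ i' t ≤ i0 ∧ κ' t = k0) := by
  have key : ∀ {S : Type} [Fintype S] (q i κ : S → ℕ)
      (hf : ∀ s t, κ s = κ t → i s < i t → q s < q t → False) (q0 : ℕ),
      ddgCnt (fun t => (κ t = k0 ∧ i t ≤ i0) ∧ (κ t = k0 ∧ q0 ≤ q t)) =
      min (ddgCnt (fun t => (κ t = k0 ∧ i t ≤ i0))) (ddgCnt (fun t => (κ t = k0 ∧ q0 ≤ q t))) := by
    intro S _ q i κ hf q0
    apply ddgCnt_nested
    by_contra hc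
    push Not at hc
    obtain ⟨⟨s, hs, hs'⟩, ⟨t, ht, ht'⟩⟩ := hc
    exact hf s t (by omega) (by have := ht' ht.1; omega) (by have := hs' hs.1; omega)
  have key2 : ∀ {S : Type} [Fintype S] (q i κ : S → ℕ),
      ddgCnt (fun t => q t = q0 ∧ i t ≤ i0 ∧ κ t = k0) +
      ddgCnt (fun t => (κ t = k0 ∧ i t ≤ i0) ∧ (κ t = k0 ∧ q0 + 1 ≤ q t)) =
      ddgCnt (fun t => (κ t = k0 ∧ i t ≤ i0) ∧ (κ t = k0 ∧ q0 ≤ q t)) := by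
    intro S _ q i κ
    rw [← ddgCnt_split (fun t => (κ t = k0 ∧ i t ≤ i0) ∧ (κ t = k0 ∧ q0 ≤ q t))
      (fun t => q t = q0)]
    congr 1 <;> congr 1 <;> ext t <;> grind
  have e1 := ddgDist_cnt d1 (fun x => x.2 = k0 ∧ x.1 ≤ i0)
  have e2 := ddgDist_cnt d2 (fun x => x.2 = k0 ∧ q0 ≤ x.1)
  have e3 := ddgDist_cnt d2 (fun x => x.2 = k0 ∧ q0 + 1 ≤ x.1)
  have a1 := key2 q i κ
  have a2 := key2 q' i' κ'
  rw [key q i κ hf, key q i κ hf] at a1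
  rw [key q' i' κ' hf', key q' i' κ' hf'] at a2
  simp only at e1 e2 e3
  rw [e1, e2, e3] at a1
  omega

theorem ddg_block2 {q i κ : T → ℕ} {q' i' κ' : T' → ℕ}
    (d1 : ddgDist (fun t => (i t, κ t)) = ddgDist (fun t => (i' t, κ' t)))
    (d2 : ddgDist (fun t => (q t, κ t)) = ddgDist (fun t => (q' t, κ' t)))
    (hf : ∀ s t, κ s = κ t → i s < i t → q s < q t → False)
    (hf' : ∀ s t, κ' s = κ' t → i' s < i' t → q' s < q' t → False) (q0 i0 k0 : ℕ) :
    ddgCnt (fun t => q t = q0 ∧ i t ≤ i0 ∧ κ t < k0) =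
      ddgCnt (fun t => q' t = q0 ∧ i' t ≤ i0 ∧ κ' t < k0) := by
  induction k0 with
  | zero =>
    have h1 : ∀ {S : Type} [Fintype S] (q i κ : S → ℕ),
      ddgCnt (fun t => q t = q0 ∧ i t ≤ i0 ∧ κ t < 0) = 0 := by
      intro S _ q i κ
      classical
      rw [ddgCnt_eq]
      simp
    rw [h1, h1]
  | succ k0 ih =>
    have h1 : ∀ {S : Type} [Fintype S] (q i κ : S → ℕ),
      ddgCnt (fun t => q t = q0 ∧ i t ≤ i0 ∧ κ t < k0 + 1) =
      ddgCnt (fun t => q t = q0 ∧ i t ≤ i0 ∧ κ t = k0) + 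
      ddgCnt (fun t => q t = q0 ∧ i t ≤ i0 ∧ κ t < k0) := by
      intro S _ q i κ
      rw [← ddgCnt_split (fun t => q t = q0 ∧ i t ≤ i0 ∧ κ t < k0 + 1)
        (fun t => κ t = k0)]
      congr 1 <;> congr 1 <;> ext t <;> grind
    rw [h1, h1, ih, ddg_block1 d1 d2 hf hf']

theorem ddg_block3 {q i κ : T → ℕ} {q' i' κ' : T' → ℕ}
    (d1 : ddgDist (fun t => (i t, κ t)) = ddgDist (fun t => (i' t, κ' t)))
    (d2 : ddgDist (fun t => (q t, κ t)) = ddgDist (fun t => (q' t, κ' t)))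
    (hf : ∀ s t, κ s = κ t → i s < i t → q s < q t → False)
    (hf' : ∀ s t, κ' s = κ' t → i' s < i' t → q' s < q' t → False) (q0 i0 : ℕ) :
    ddgCnt (fun t => q t = q0 ∧ i t ≤ i0) =
      ddgCnt (fun t => q' t = q0 ∧ i' t ≤ i0) := by
  have h1 := ddg_block2 d1 d2 hf hf' q0 i0
    (Finset.univ.sup κ + Finset.univ.sup κ' + 1)
  have h2 : ∀ t, κ t ≤ Finset.univ.sup κ := fun t => Finset.le_sup (Finset.mem_univ t)
  have h3 : ∀ t, κ' t ≤ Finset.univ.sup κ' := fun t => Finset.le_sup (Finset.mem_univ t)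
  convert h1 using 2 <;> ext t
  · have := h2 t; grind
  · have := h3 t; grind

theorem ddg_block4 {q i κ : T → ℕ} {q' i' κ' : T' → ℕ}
    (d1 : ddgDist (fun t => (i t, κ t)) = ddgDist (fun t => (i' t, κ' t)))
    (d2 : ddgDist (fun t => (q t, κ t)) = ddgDist (fun t => (q' t, κ' t)))
    (hf : ∀ s t, κ s = κ t → i s < i t → q s < q t → False)
    (hf' : ∀ s t, κ' s = κ' t → i' s < i' t → q' s < q' t → False) :
    ddgDist (fun t => (q t, i t)) = ddgDist (fun t => (q' t, i' t)) := by
  classical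
  ext ⟨q0, i0⟩
  have h : ∀ {S : Type} [Fintype S] (q i : S → ℕ),
      Multiset.count (q0, i0) (ddgDist (fun t => (q t, i t))) =
        ddgCnt (fun t => q t = q0 ∧ i t = i0) := by
    intro S _ q i
    unfold ddgDist
    rw [Multiset.count_map, ddgCnt_eq]
    rw [Finset.card_def, Finset.filter_val]
    congr 2
    ext t; grind
  rw [h, h]
  rcases i0 with _ | i0
  · have := ddg_block3 d1 d2 hf hf' q0 0
    simpa using this
  · have e1 := ddg_block3 d1 d2 hf hf' q0 i0
    have e2 := ddg_block3 d1 d2 hf hf' q0 (i0 + 1)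
    have h : ∀ {S : Type} [Fintype S] (q i : S → ℕ),
        ddgCnt (fun t => q t = q0 ∧ i t ≤ i0 + 1) = 
        ddgCnt (fun t => q t = q0 ∧ i t = i0 + 1) + ddgCnt (fun t => q t = q0 ∧ i t ≤ i0) := by
      intro S _ q i
      rw [← ddgCnt_split (fun t => q t = q0 ∧ i t ≤ i0 + 1) (fun t => i t = i0 + 1)]
      congr 1 <;> congr 1 <;> ext t <;> grind
    rw [h, h, e1] at e2
    omega

end Count

/-! ### Dominance -/

section Dom

set_option linter.unusedSectionVars false

variable {r m n : ℕ} {T T' : Type} [Fintype T] [Fintype T']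

/-- Two labelled families have the same data. -/
def DDGSame (w : T → Fin r × Fin m × Fin n) (κ l : T → ℕ)
    (w' : T' → Fin r × Fin m × Fin n) (κ' l' : T' → ℕ) : Prop :=
  ddgDist (fun t => ((w t).2.1, κ t)) = ddgDist (fun t => ((w' t).2.1, κ' t)) ∧
  ddgDist (fun t => ((w t).1, κ t, l t)) = ddgDist (fun t => ((w' t).1, κ' t, l' t)) ∧
  ddgDist (fun t => ((w t).2.2, l t)) = ddgDist (fun t => ((w' t).2.2, l' t))

/-- No two elements with the same label form a chain. -/
def DDGFree (w : T → Fin r × Fin m × Fin n) (κ l : T → ℕ) : Prop :=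
  (∀ s t, κ s = κ t → ¬ DDGHL (w s) (w t)) ∧ (∀ s t, l s = l t → ¬ DDGVL (w s) (w t))

theorem DDGFree.hf1 {w : T → Fin r × Fin m × Fin n} {κ l : T → ℕ} (h : DDGFree w κ l) :
    ∀ s t, κ s = κ t → (w s).2.1.val < (w t).2.1.val → (w s).1.val < (w t).1.val → False :=
  fun s t h1 h2 h3 => h.1 s t h1 ⟨h2, Or.inl h3⟩

theorem DDGFree.hf2 {w : T → Fin r × Fin m × Fin n} {κ l : T → ℕ} (h : DDGFree w κ l) :
    ∀ s t, l s = l t → (w s).2.2.val < (w t).2.2.val → (w s).1.val < (w t).1.val → False :=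
  fun s t h1 h2 h3 => h.2 s t h1 ⟨h2, Or.inl h3⟩

variable {w : T → Fin r × Fin m × Fin n} {κ l : T → ℕ}
    {w' : T' → Fin r × Fin m × Fin n} {κ' l' : T' → ℕ}

theorem DDGSame.n1 (h : DDGSame w κ l w' κ' l') :
    ddgDist (fun t => ((w t).2.1.val, κ t)) = ddgDist (fun t => ((w' t).2.1.val, κ' t)) :=
  ddgDist_comp h.1 (fun x => (x.1.val, x.2))

theorem DDGSame.n2 (h : DDGSame w κ l w' κ' l') :
    ddgDist (fun t => ((w t).2.2.val, l t)) = ddgDist (fun t => ((w' t).2.2.val, l' t)) :=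
  ddgDist_comp h.2.2 (fun x => (x.1.val, x.2))

theorem DDGSame.n3 (h : DDGSame w κ l w' κ' l') :
    ddgDist (fun t => ((w t).1.val, κ t)) = ddgDist (fun t => ((w' t).1.val, κ' t)) :=
  ddgDist_comp h.2.1 (fun x => (x.1.val, x.2.1))

theorem DDGSame.n4 (h : DDGSame w κ l w' κ' l') :
    ddgDist (fun t => ((w t).1.val, l t)) = ddgDist (fun t => ((w' t).1.val, l' t)) :=
  ddgDist_comp h.2.1 (fun x => (x.1.val, x.2.2))

theorem ddg_free_height {H V : Fin r × Fin m × Fin n → ℕ}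
    (hH : DDGIsHeight (Set.range w) DDGHL H) (hV : DDGIsHeight (Set.range w) DDGVL V) :
    DDGFree w (fun t => H (w t)) (fun t => V (w t)) := by
  constructor
  · intro s t h1 h2
    have := hH.1 (w s) ⟨s, rfl⟩ _ h2
    simp only at h1; omega
  · intro s t h1 h2
    have := hV.1 (w s) ⟨s, rfl⟩ _ h2
    simp only at h1; omega

/-- The north-west region. -/
def DDGNW (x y : Fin r × Fin m × Fin n) : Prop :=
  y.1 = x.1 ∧ y.2.1 ≤ x.2.1 ∧ y.2.2 ≤ x.2.2

theorem ddg_dom {H V : Fin r × Fin m × Fin n → ℕ}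
    (hH : DDGIsHeight (Set.range w) DDGHL H) (hV : DDGIsHeight (Set.range w) DDGVL V)
    (hs : DDGSame w (fun t => H (w t)) (fun t => V (w t)) w' κ' l')
    (hf : DDGFree w' κ' l') (x : Fin r × Fin m × Fin n) :
    ddgCnt (fun t => DDGNW x (w t)) ≤ ddgCnt (fun t => DDGNW x (w' t)) ∧
    (ddgCnt (fun t => DDGNW x (w' t)) ≤ ddgCnt (fun t => DDGNW x (w t)) →
      ∀ t, DDGNW x (w' t) → κ' t ≤ H x ∧ l' t ≤ V x) := by
  classical
  by_cases hne : ∃ t, DDGNW x (w t)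
  swap
  · have h0 : ddgCnt (fun t => DDGNW x (w t)) = 0 := by
      rw [ddgCnt_eq]
      push Not at hne
      simp [hne]
    refine ⟨by omega, fun h1 t ht => ?_⟩
    exfalso
    rw [h0, ddgCnt_eq] at h1
    have : t ∈ Finset.univ.filter (fun t => DDGNW x (w' t)) := by simpa using ht
    have := Finset.card_pos.mpr ⟨t, this⟩
    omega
  have hne' : (Finset.univ.filter (fun t => DDGNW x (w t))).Nonempty := by
    obtain ⟨t, ht⟩ := hne
    exact ⟨t, by simpa using ht⟩
  obtain ⟨a, ha, hamax⟩ := Finset.exists_max_image _ (fun t => H (w t)) hne'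
  obtain ⟨b, hb, hbmax⟩ := Finset.exists_max_image _ (fun t => V (w t)) hne'
  simp only [Finset.mem_filter, Finset.mem_univ, true_and] at ha hamax hb hbmax
  have hfr := ddg_free_height hH hV
  have eX := ddg_block2 hs.n1 hs.n3 hfr.hf1 hf.hf1 x.1.val x.2.1.val (H (w a) + 1)
  have eY := ddg_block2 hs.n2 hs.n4 hfr.hf2 hf.hf2 x.1.val x.2.2.val (V (w b) + 1)
  have eW := ddgDist_cnt hs.2.1 (fun y => y.1 = x.1 ∧ (y.2.1 ≤ H (w a) ∨ y.2.2 ≤ V (w b)))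
  simp only at eW
  have o1 := ddgCnt_or_and (fun t => (w t).1.val = x.1.val ∧ (w t).2.1.val ≤ x.2.1.val ∧
    H (w t) < H (w a) + 1) (fun t => (w t).1.val = x.1.val ∧ (w t).2.2.val ≤ x.2.2.val ∧
    V (w t) < V (w b) + 1)
  have o2 := ddgCnt_or_and (fun t => (w' t).1.val = x.1.val ∧ (w' t).2.1.val ≤ x.2.1.val ∧
    κ' t < H (w a) + 1) (fun t => (w' t).1.val = x.1.val ∧ (w' t).2.2.val ≤ x.2.2.val ∧
    l' t < V (w b) + 1)
  have i1 : ddgCnt (fun t => DDGNW x (w t)) ≤ _ := ddgCnt_mono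
    (p' := fun t => ((w t).1.val = x.1.val ∧ (w t).2.1.val ≤ x.2.1.val ∧
    H (w t) < H (w a) + 1) ∧ ((w t).1.val = x.1.val ∧ (w t).2.2.val ≤ x.2.2.val ∧
    V (w t) < V (w b) + 1)) (by
      intro t ht
      have h1 := hamax t ht
      have h2 := hbmax t ht
      unfold DDGNW at ht
      grind)
  have i2s : ∀ t, (((w' t).1.val = x.1.val ∧ (w' t).2.1.val ≤ x.2.1.val ∧
    κ' t < H (w a) + 1) ∧ ((w' t).1.val = x.1.val ∧ (w' t).2.2.val ≤ x.2.2.val ∧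
    l' t < V (w b) + 1)) → DDGNW x (w' t) := by
    intro t ht
    unfold DDGNW
    refine ⟨Fin.ext ht.1.1, ht.1.2.1, ht.2.2.1⟩
  have i2 := ddgCnt_mono i2s
  have i3 : _ ≤ ddgCnt (fun t => (w' t).1 = x.1 ∧ (κ' t ≤ H (w a) ∨ l' t ≤ V (w b))) := ddgCnt_mono
    (p := fun t => ((w' t).1.val = x.1.val ∧ (w' t).2.1.val ≤ x.2.1.val ∧
    κ' t < H (w a) + 1) ∨ ((w' t).1.val = x.1.val ∧ (w' t).2.2.val ≤ x.2.2.val ∧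
    l' t < V (w b) + 1)) (by
      intro t ht
      rcases ht with ht | ht
      · exact ⟨Fin.ext ht.1, Or.inl (by omega)⟩
      · exact ⟨Fin.ext ht.1, Or.inr (by omega)⟩)
  have i4 : ddgCnt (fun t => (w t).1 = x.1 ∧ (H (w t) ≤ H (w a) ∨ V (w t) ≤ V (w b))) ≤ _ :=
    ddgCnt_mono
    (p' := fun t => ((w t).1.val = x.1.val ∧ (w t).2.1.val ≤ x.2.1.val ∧
    H (w t) < H (w a) + 1) ∨ ((w t).1.val = x.1.val ∧ (w t).2.2.val ≤ x.2.2.val ∧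
    V (w t) < V (w b) + 1)) (by
      rintro t ⟨hq, ht⟩
      by_contra hc
      rw [not_or] at hc
      have hqv : (w t).1.val = x.1.val := by rw [hq]
      obtain ⟨haq, hai, haj⟩ := ha
      obtain ⟨hbq, hbi, hbj⟩ := hb
      have nH : H (w t) ≤ H (w a) → ¬ DDGHL (w a) (w t) := fun h1 h2 => by
        have := hH.1 (w a) ⟨a, rfl⟩ _ h2
        omega
      have nV : V (w t) ≤ V (w b) → ¬ DDGVL (w b) (w t) := fun h1 h2 => by
        have := hV.1 (w b) ⟨b, rfl⟩ _ h2
        omega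
      have hVab : V (w a) ≤ V (w b) := hbmax a ⟨haq, hai, haj⟩
      have hHab : H (w b) ≤ H (w a) := hamax b ⟨hbq, hbi, hbj⟩
      by_cases c1 : H (w t) ≤ H (w a)
      · have c2 : x.2.1 < (w t).2.1 := by
          by_contra h
          exact hc.1 ⟨hqv, by simpa using h, by omega⟩
        have n1 := nH c1
        have n1' : (w t).2.2 ≤ (w a).2.2 := by
          by_contra h
          exact n1 ⟨lt_of_le_of_lt hai c2, Or.inr ⟨by rw [haq, hq], by simpa using h⟩⟩
        have c3 : V (w b) < V (w t) := by
          by_contra h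
          exact hc.2 ⟨hqv, n1'.trans haj, by omega⟩
        exact ddg_lemmaN' hH hV _ (w a) (w t) rfl (by rw [haq, hq]) (hai.trans c2.le)
          n1' (by omega) c1
      · have c1' : V (w t) ≤ V (w b) := by tauto
        have c2 : x.2.2 < (w t).2.2 := by
          by_contra h
          exact hc.2 ⟨hqv, by simpa using h, by omega⟩
        have n1 := nV c1'
        have n1' : (w t).2.1 ≤ (w b).2.1 := by
          by_contra h
          exact n1 ⟨lt_of_le_of_lt hbj c2, Or.inr ⟨by rw [hbq, hq], by simpa using h⟩⟩
        exact ddg_lemmaN hH hV _ (w b) (w t) rfl (by rw [hbq, hq]) n1'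
          (hbj.trans c2.le) (by omega) c1')
  refine ⟨by omega, fun hle t ht => ?_⟩
  have h5 := ddgCnt_eq_of_le i2s (by omega) t ht
  have h6 : H (w a) ≤ H x := hH.mono (fun y hy => by
    unfold DDGHL at hy ⊢
    obtain ⟨haq, hai, haj⟩ := ha
    grind)
  have h7 : V (w b) ≤ V x := hV.mono (fun y hy => by
    unfold DDGVL at hy ⊢
    obtain ⟨hbq, hbi, hbj⟩ := hb
    grind)
  omega

end Dom

/-! ### From dominance to the term order -/

section Abel

theorem ddg_tel {G : Type*} [AddCommGroup G] (f : ℕ → G) (i M : ℕ) (h : i ≤ M) :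
    ∑ a ∈ Finset.range M, (if i ≤ a then f a - f (a + 1) else 0) = f i - f M := by
  induction M, h using Nat.le_induction with
  | base =>
    rw [sub_self]
    apply Finset.sum_eq_zero
    intro a ha
    rw [if_neg]
    simpa using ha
  | succ M hM ih =>
    rw [Finset.sum_range_succ, ih, if_pos hM]
    abel

theorem ddg_tel2 {G : Type*} [AddCommGroup G] (g : ℕ → ℕ → G) (i j M N : ℕ) (h : i ≤ M)
    (h' : j ≤ N) :
    ∑ a ∈ Finset.range M, ∑ b ∈ Finset.range N, (if i ≤ a ∧ j ≤ b then
      (g a b - g a (b + 1)) - (g (a + 1) b - g (a + 1) (b + 1)) else 0) =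
      (g i j - g i N) - (g M j - g M N) := by
  rw [← ddg_tel (fun a => g a j - g a N) i M h]
  apply Finset.sum_congr rfl
  intro a _
  by_cases hi : i ≤ a
  · simp only [hi, true_and, if_true]
    rw [← ddg_tel (g a) j N h', ← ddg_tel (g (a + 1)) j N h', ← Finset.sum_sub_distrib]
    apply Finset.sum_congr rfl
    intro b _
    split_ifs <;> simp
  · simp [hi]

variable {r m n : ℕ}

/-- Integer version of an exponent vector. -/
def ddgI (a : Fin r × Fin m × Fin n →₀ ℕ) : Fin r × Fin m × Fin n → ℤ := fun x => (a x : ℤ)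

theorem ddgI_add (a b : Fin r × Fin m × Fin n →₀ ℕ) : ddgI (a + b) = ddgI a + ddgI b := by
  ext x; simp [ddgI]

theorem ddgI_inj {a b : Fin r × Fin m × Fin n →₀ ℕ} (h : ddgI a = ddgI b) : a = b := by
  ext x
  have := congrFun h x
  simpa [ddgI] using this

theorem ddgI_sum {T : Type} (s : Finset T) (f : T → (Fin r × Fin m × Fin n →₀ ℕ)) :
    ddgI (∑ t ∈ s, f t) = ∑ t ∈ s, ddgI (f t) := by
  ext x; simp [ddgI]

/-- unit vectors, extended by zero -/
def ddgG (q : Fin r) (a b : ℕ) : Fin r × Fin m × Fin n → ℤ :=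
  if h : a < m ∧ b < n then ddgI (Finsupp.single (q, ⟨a, h.1⟩, ⟨b, h.2⟩) 1) else 0

/-- second differences -/
def ddgDelta (x : Fin r × Fin m × Fin n) : Fin r × Fin m × Fin n → ℤ :=
  (ddgG x.1 x.2.1 x.2.2 - ddgG x.1 x.2.1 (x.2.2 + 1)) -
    (ddgG x.1 (x.2.1 + 1) x.2.2 - ddgG x.1 (x.2.1 + 1) (x.2.2 + 1))

theorem ddg_expand1 (y : Fin r × Fin m × Fin n) :
    haveI : DecidablePred (fun x => DDGNW x y) := Classical.decPred _
    ddgI (Finsupp.single y 1) = ∑ x, if DDGNW x y then ddgDelta x else 0 := by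
  classical
  obtain ⟨q, i, j⟩ := y
  have h := ddg_tel2 (fun a b => (ddgG q a b : Fin r × Fin m × Fin n → ℤ)) i.val j.val m n
    i.isLt.le j.isLt.le
  rw [Fintype.sum_prod_type, Finset.sum_eq_single q, Fintype.sum_prod_type]
  · rw [Finset.sum_range] at h
    simp only [Finset.sum_range] at h
    have e1 : (ddgG q i.val j.val : Fin r × Fin m × Fin n → ℤ) =
        ddgI (Finsupp.single (q, i, j) 1) := by
      unfold ddgG
      rw [dif_pos ⟨i.isLt, j.isLt⟩]
    have e2 : (ddgG q i.val n : Fin r × Fin m × Fin n → ℤ) = 0 := by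
      unfold ddgG
      rw [dif_neg (by omega)]
    have e3 : ∀ b, (ddgG q m b : Fin r × Fin m × Fin n → ℤ) = 0 := by
      intro b
      unfold ddgG
      rw [dif_neg (by omega)]
    rw [e1, e2, e3, e3] at h
    simp only [sub_zero] at h
    rw [← h]
    apply Finset.sum_congr rfl
    intro a _
    apply Finset.sum_congr rfl
    intro b _
    have : (i.val ≤ a.val ∧ j.val ≤ b.val) ↔ DDGNW (q, a, b) (q, i, j) := by
      simp [DDGNW]
    by_cases hh : DDGNW (q, a, b) (q, i, j)
    · rw [if_pos hh, if_pos (this.mpr hh)]; rfl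
    · rw [if_neg hh, if_neg (fun h => hh (this.mp h))]
  · intro q' _ hq
    apply Finset.sum_eq_zero
    intro x _
    rw [if_neg]
    intro hx
    exact hq hx.1.symm
  · simp

theorem ddg_expand {T : Type} [Fintype T] (w : T → Fin r × Fin m × Fin n) :
    ddgI (ddgMono w) = ∑ x, ddgCnt (fun t => DDGNW x (w t)) • ddgDelta x := by
  classical
  unfold ddgMono
  rw [ddgI_sum]
  simp_rw [ddg_expand1]
  rw [Finset.sum_comm]
  apply Finset.sum_congr rfl
  intro x _
  rw [ddgCnt_eq, ← Finset.sum_filter, Finset.sum_const]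

/-- nonnegative differences for the term order -/
def DDGQ (tord : TermOrder (Fin r × Fin m × Fin n)) (x : Fin r × Fin m × Fin n → ℤ) : Prop :=
  ∃ a b, x = ddgI a - ddgI b ∧ (a = b ∨ tord.lt b a)

variable {tord : TermOrder (Fin r × Fin m × Fin n)}

theorem DDGQ.zero : DDGQ tord 0 := ⟨0, 0, by simp, Or.inl rfl⟩

theorem DDGQ.add {x y : Fin r × Fin m × Fin n → ℤ} (hx : DDGQ tord x) (hy : DDGQ tord y) :
    DDGQ tord (x + y) := by
  obtain ⟨a, b, rfl, h⟩ := hx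
  obtain ⟨c, d, rfl, h'⟩ := hy
  refine ⟨a + c, b + d, by rw [ddgI_add, ddgI_add]; abel, ?_⟩
  rcases h with rfl | h <;> rcases h' with rfl | h'
  · exact Or.inl rfl
  · right; rw [add_comm a d, add_comm a c]; exact tord.add_right _ _ _ h'
  · right; exact tord.add_right _ _ _ h
  · right
    refine tord.trans (tord.add_right _ _ d h) ?_
    rw [add_comm a d, add_comm a c]; exact tord.add_right _ _ _ h'

theorem DDGQ.nsmul {x : Fin r × Fin m × Fin n → ℤ} (hx : DDGQ tord x) (k : ℕ) :
    DDGQ tord (k • x) := by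
  induction k with
  | zero => rw [zero_smul]; exact DDGQ.zero
  | succ k ih => rw [succ_nsmul]; exact ih.add hx

theorem DDGQ.sum {ι : Type*} (s : Finset ι) (f : ι → Fin r × Fin m × Fin n → ℤ)
    (h : ∀ i ∈ s, DDGQ tord (f i)) : DDGQ tord (∑ i ∈ s, f i) :=
  Finset.sum_induction f (DDGQ tord) (fun _ _ => DDGQ.add) DDGQ.zero h

theorem DDGQ.not_lt {a b : Fin r × Fin m × Fin n →₀ ℕ} (h : DDGQ tord (ddgI a - ddgI b)) :
    ¬ tord.lt a b := by
  intro hlt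
  obtain ⟨c, d, he, hcd⟩ := h
  have h1 : a + d = b + c := by
    apply ddgI_inj
    rw [ddgI_add, ddgI_add]
    have := sub_eq_sub_iff_add_eq_add.mp he
    rw [this, add_comm]
  have h2 := tord.add_right _ _ d hlt
  rw [h1] at h2
  rcases hcd with rfl | hcd
  · exact tord.irrefl _ h2
  · have h3 := tord.add_right _ _ b hcd
    rw [add_comm d, add_comm c] at h3
    exact tord.irrefl _ (tord.trans h2 h3)

/-- exchange property for the horizontal relation -/
def DDGExH (tord : TermOrder (Fin r × Fin m × Fin n)) : Prop :=
  ∀ x y, DDGHL x y → tord.lt (Finsupp.single (x.1, y.2.1, x.2.2) 1 +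
    Finsupp.single (y.1, x.2.1, y.2.2) 1) (Finsupp.single x 1 + Finsupp.single y 1)

/-- exchange property for the vertical relation -/
def DDGExV (tord : TermOrder (Fin r × Fin m × Fin n)) : Prop :=
  ∀ x y, DDGVL x y → tord.lt (Finsupp.single (x.1, x.2.1, y.2.2) 1 +
    Finsupp.single (y.1, y.2.1, x.2.2) 1) (Finsupp.single x 1 + Finsupp.single y 1)

theorem DDGQ.delta (ex : DDGExH tord) (x : Fin r × Fin m × Fin n) (h1 : x.2.1.val + 1 < m)
    (h2 : x.2.2.val + 1 < n) : DDGQ tord (ddgDelta x) := by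
  obtain ⟨q, i, j⟩ := x
  simp only at h1 h2
  have hlt := ex (q, i, j) (q, ⟨i.val + 1, h1⟩, ⟨j.val + 1, h2⟩)
    ⟨by simp [Fin.lt_def], Or.inr ⟨rfl, by simp [Fin.lt_def]⟩⟩
  refine ⟨_, _, ?_, Or.inr hlt⟩
  unfold ddgDelta ddgG
  simp only
  rw [dif_pos ⟨i.isLt, j.isLt⟩, dif_pos ⟨i.isLt, h2⟩, dif_pos ⟨h1, j.isLt⟩, dif_pos ⟨h1, h2⟩,
    ddgI_add, ddgI_add]
  simp only [Fin.eta]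
  abel

variable {T T' : Type} [Fintype T] [Fintype T'] {w : T → Fin r × Fin m × Fin n}
    {w' : T' → Fin r × Fin m × Fin n} {κ' l' : T' → ℕ}

theorem ddg_core_free (ex : DDGExH tord) {H V : Fin r × Fin m × Fin n → ℕ}
    (hH : DDGIsHeight (Set.range w) DDGHL H) (hV : DDGIsHeight (Set.range w) DDGVL V)
    (hs : DDGSame w (fun t => H (w t)) (fun t => V (w t)) w' κ' l')
    (hf : DDGFree w' κ' l') :
    ¬ tord.lt (ddgMono w') (ddgMono w) ∧
      (ddgMono w' = ddgMono w → ∀ t, κ' t = H (w' t) ∧ l' t = V (w' t)) := by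
  have hfr := ddg_free_height hH hV
  constructor
  · apply DDGQ.not_lt
    rw [ddg_expand, ddg_expand, ← Finset.sum_sub_distrib]
    apply DDGQ.sum
    intro x _
    have hd := (ddg_dom hH hV hs hf x).1
    obtain ⟨c, hc⟩ := Nat.exists_eq_add_of_le hd
    rw [hc, add_smul, add_sub_cancel_left]
    by_cases hx : x.2.1.val + 1 < m ∧ x.2.2.val + 1 < n
    · exact (DDGQ.delta ex x hx.1 hx.2).nsmul c
    · have hc0 : c = 0 := by
        rw [not_and_or] at hx
        have e : ddgCnt (fun t => DDGNW x (w t)) = ddgCnt (fun t => DDGNW x (w' t)) := by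
          rcases hx with hx | hx
          · have := ddg_block3 hs.n2 hs.n4 hfr.hf2 hf.hf2 x.1.val x.2.2.val
            convert this using 2 <;> ext t <;> unfold DDGNW
            · have := (w t).2.1.isLt
              simp only [Fin.ext_iff, Fin.le_def]
              constructor
              · intro h; exact ⟨h.1, h.2.2⟩
              · intro h; exact ⟨h.1, by omega, h.2⟩
            · have := (w' t).2.1.isLt
              simp only [Fin.ext_iff, Fin.le_def]
              constructor
              · intro h; exact ⟨h.1, h.2.2⟩
              · intro h; exact ⟨h.1, by omega, h.2⟩
          · have := ddg_block3 hs.n1 hs.n3 hfr.hf1 hf.hf1 x.1.val x.2.1.val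
            convert this using 2 <;> ext t <;> unfold DDGNW
            · have := (w t).2.2.isLt
              simp only [Fin.ext_iff, Fin.le_def]
              constructor
              · intro h; exact ⟨h.1, h.2.1⟩
              · intro h; exact ⟨h.1, h.2, by omega⟩
            · have := (w' t).2.2.isLt
              simp only [Fin.ext_iff, Fin.le_def]
              constructor
              · intro h; exact ⟨h.1, h.2.1⟩
              · intro h; exact ⟨h.1, h.2, by omega⟩
        omega
      rw [hc0, zero_smul]
      exact DDGQ.zero
  · intro heq
    have hdist := ddgMono_eq_iff.mp heq
    have hle : ∀ t, κ' t ≤ H (w' t) ∧ l' t ≤ V (w' t) := fun t =>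
      (ddg_dom hH hV hs hf (w' t)).2 (ddgDist_cnt hdist (DDGNW (w' t))).le t
        ⟨rfl, le_rfl, le_rfl⟩
    have s1 : ∑ t, κ' t = ∑ t, H (w' t) := by
      rw [ddgDist_sum hdist H]
      exact (ddgDist_sum hs.1 (fun x => x.2)).symm
    have s2 : ∑ t, l' t = ∑ t, V (w' t) := by
      rw [ddgDist_sum hdist V]
      exact (ddgDist_sum hs.2.2 (fun x => x.2)).symm
    have r1 := (Finset.sum_eq_sum_iff_of_le (fun t _ => (hle t).1)).mp s1
    have r2 := (Finset.sum_eq_sum_iff_of_le (fun t _ => (hle t).2)).mp s2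
    exact fun t => ⟨r1 t (Finset.mem_univ t), r2 t (Finset.mem_univ t)⟩

theorem ddg_two_change {α : Type*} (w1 w2 : T → α) (tord : TermOrder α) (s t : T) (hst : s ≠ t)
    (h : ∀ u, u ≠ s → u ≠ t → w1 u = w2 u)
    (hlt : tord.lt (Finsupp.single (w1 s) 1 + Finsupp.single (w1 t) 1)
      (Finsupp.single (w2 s) 1 + Finsupp.single (w2 t) 1)) :
    tord.lt (ddgMono w1) (ddgMono w2) := by
  classical
  have key : ∀ w : T → α, ddgMono w = Finsupp.single (w s) 1 + Finsupp.single (w t) 1 +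
      ∑ u ∈ (Finset.univ.erase s).erase t, Finsupp.single (w u) 1 := by
    intro w
    unfold ddgMono
    rw [← Finset.add_sum_erase _ _ (Finset.mem_univ s),
      ← Finset.add_sum_erase _ _ (show t ∈ Finset.univ.erase s by simp [hst.symm]), add_assoc]
  rw [key w1, key w2]
  have : ∑ u ∈ (Finset.univ.erase s).erase t, Finsupp.single (w1 u) 1 =
      ∑ u ∈ (Finset.univ.erase s).erase t, Finsupp.single (w2 u) 1 := by
    apply Finset.sum_congr rfl
    intro u hu
    simp only [Finset.mem_erase] at hu
    rw [h u hu.2.1 hu.1]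
  rw [this]
  exact tord.add_right _ _ _ hlt

theorem ddg_core (ex : DDGExH tord) (ex' : DDGExV tord) {H V : Fin r × Fin m × Fin n → ℕ}
    (hH : DDGIsHeight (Set.range w) DDGHL H) (hV : DDGIsHeight (Set.range w) DDGVL V)
    (hs : DDGSame w (fun t => H (w t)) (fun t => V (w t)) w' κ' l') :
    ¬ tord.lt (ddgMono w') (ddgMono w) ∧
      (ddgMono w' = ddgMono w → ∀ t, κ' t = H (w' t) ∧ l' t = V (w' t)) := by
  classical
  have htr : IsTrans (T' → Fin r × Fin m × Fin n) (fun a b => tord.lt (ddgMono a) (ddgMono b)) :=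
    ⟨fun _ _ _ => tord.trans⟩
  have hir : Std.Irrefl (fun a b : T' → Fin r × Fin m × Fin n => tord.lt (ddgMono a) (ddgMono b)) :=
    ⟨fun _ => tord.irrefl _⟩
  have wf := Finite.wellFounded_of_trans_of_irrefl
    (fun a b : T' → Fin r × Fin m × Fin n => tord.lt (ddgMono a) (ddgMono b))
  induction w' using wf.induction with
  | _ w' ih =>
    by_cases hf : DDGFree w' κ' l'
    · exact ddg_core_free ex hH hV hs hf
    · suffices h : ∃ w'' : T' → Fin r × Fin m × Fin n, tord.lt (ddgMono w'') (ddgMono w') ∧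
          DDGSame w (fun t => H (w t)) (fun t => V (w t)) w'' κ' l' by
        obtain ⟨w'', h1, h2⟩ := h
        have h3 := (ih w'' h1 h2).1
        refine ⟨fun h4 => h3 (tord.trans h1 h4), fun h4 => ?_⟩
        rw [h4] at h1
        exact absurd h1 h3
      unfold DDGFree at hf
      rw [not_and_or] at hf
      push Not at hf
      rcases hf with ⟨s, t, hk, hl⟩ | ⟨s, t, hk, hl⟩
      · have hst : s ≠ t := by rintro rfl; exact DDGHL.irrefl' _ hl
        refine ⟨fun u => ((w' u).1, (w' (Equiv.swap s t u)).2.1, (w' u).2.2), ?_, ?_, hs.2.1, hs.2.2⟩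
        · apply ddg_two_change _ _ _ s t hst
          · intro u h1 h2
            simp only [Equiv.swap_apply_of_ne_of_ne h1 h2]
          · simpa using ex _ _ hl
        · rw [hs.1]
          have := ddgDist_equiv (fun u => ((w' u).2.1, κ' u)) (Equiv.swap s t)
          rw [← this]
          congr 1
          ext u
          · rfl
          · simp only
            by_cases h1 : u = s
            · rw [h1, Equiv.swap_apply_left, hk]
            by_cases h2 : u = t
            · rw [h2, Equiv.swap_apply_right, hk]
            rw [Equiv.swap_apply_of_ne_of_ne h1 h2]
      · have hst : s ≠ t := by rintro rfl; exact DDGVL.irrefl' _ hl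
        refine ⟨fun u => ((w' u).1, (w' u).2.1, (w' (Equiv.swap s t u)).2.2), ?_, hs.1, hs.2.1, ?_⟩
        · apply ddg_two_change _ _ _ s t hst
          · intro u h1 h2
            simp only [Equiv.swap_apply_of_ne_of_ne h1 h2]
          · simpa using ex' _ _ hl
        · rw [hs.2.2]
          have := ddgDist_equiv (fun u => ((w' u).2.2, l' u)) (Equiv.swap s t)
          rw [← this]
          congr 1
          ext u
          · rfl
          · simp only
            by_cases h1 : u = s
            · rw [h1, Equiv.swap_apply_left, hk]
            by_cases h2 : u = t
            · rw [h2, Equiv.swap_apply_right, hk]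
            rw [Equiv.swap_apply_of_ne_of_ne h1 h2]

end Abel

/-! ### Exchange from the diagonal hypothesis -/

section Exch

theorem ddg_exch {K : Type*} [Field K] {σ : Type*} {tord : TermOrder σ} {a b : ℕ}
    {v : Fin a → Fin b → σ} (h : IsDiagonalFor K tord v) (i i' : Fin a) (k k' : Fin b)
    (hi : i < i') (hk : k < k') (n1 : v i k ≠ v i k') (n2 : v i k ≠ v i' k) :
    tord.lt (Finsupp.single (v i k') 1 + Finsupp.single (v i' k) 1)
      (Finsupp.single (v i k) 1 + Finsupp.single (v i' k') 1) := by
  classical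
  have h2 := h 2 ![i, i'] ![k, k'] (by
      intro x y hxy
      fin_cases x <;> fin_cases y <;> simp_all) (by
      intro x y hxy
      fin_cases x <;> fin_cases y <;> simp_all) (by norm_num)
  rw [Fin.sum_univ_two] at h2
  simp only [Matrix.cons_val_zero, Matrix.cons_val_one] at h2
  have hne : (Finsupp.single (v i k') 1 + Finsupp.single (v i' k) 1 : σ →₀ ℕ) ≠
      Finsupp.single (v i k) 1 + Finsupp.single (v i' k') 1 := by
    intro he
    have := DFunLike.congr_fun he (v i k)
    simp [Finsupp.single_apply, n1.symm, n2.symm] at this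
    omega
  apply h2.2 _ _ hne
  rw [Matrix.det_fin_two, mem_support_iff]
  simp only [Matrix.of_apply, Matrix.cons_val_zero, Matrix.cons_val_one]
  have hX : ∀ x y : σ, (X x * X y : MvPolynomial σ K) =
      monomial (Finsupp.single x 1 + Finsupp.single y 1) 1 := by
    intro x y
    simp [X, monomial_mul]
  rw [hX, hX, coeff_sub, coeff_monomial, coeff_monomial, if_neg hne.symm, if_pos rfl]
  simp

variable {r m n : ℕ}

theorem ddg_colidx {q j r n : ℕ} (hq : q < r) (hj : j < n) : q * n + j < r * n := by
  calc q * n + j < q * n + n := by omega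
    _ = (q + 1) * n := by ring
    _ ≤ r * n := Nat.mul_le_mul_right _ hq

/-- column index in the horizontal concatenation -/
def ddgCol (x : Fin r × Fin m × Fin n) : Fin (r * n) :=
  ⟨x.1.val * n + x.2.2.val, ddg_colidx x.1.isLt x.2.2.isLt⟩

/-- row index in the vertical concatenation -/
def ddgRow (x : Fin r × Fin m × Fin n) : Fin (r * m) :=
  ⟨x.1.val * m + x.2.1.val, ddg_colidx x.1.isLt x.2.1.isLt⟩

theorem ddg_varH (hn : 0 < n) (i : Fin m) (x : Fin r × Fin m × Fin n) :
    varH r m n hn i (ddgCol x) = (x.1, i, x.2.2) := by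
  have := x.2.2.isLt
  unfold varH ddgCol
  refine Prod.ext (Fin.ext ?_) (Prod.ext rfl (Fin.ext ?_))
  · simp only
    rw [mul_comm, Nat.mul_add_div hn, Nat.div_eq_of_lt this, add_zero]
  · simp only
    rw [mul_comm, Nat.mul_add_mod, Nat.mod_eq_of_lt this]

theorem ddg_varV (hm : 0 < m) (j : Fin n) (x : Fin r × Fin m × Fin n) :
    varV r m n hm (ddgRow x) j = (x.1, x.2.1, j) := by
  have := x.2.1.isLt
  unfold varV ddgRow
  refine Prod.ext (Fin.ext ?_) (Prod.ext (Fin.ext ?_) rfl)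
  · simp only
    rw [mul_comm, Nat.mul_add_div hm, Nat.div_eq_of_lt this, add_zero]
  · simp only
    rw [mul_comm, Nat.mul_add_mod, Nat.mod_eq_of_lt this]

theorem ddg_idx_lt {q q' j j' n : ℕ} (hj : j < n) (h : q < q' ∨ q = q' ∧ j < j') :
    q * n + j < q' * n + j' := by
  rcases h with h | ⟨rfl, h⟩
  · have : (q + 1) * n ≤ q' * n := Nat.mul_le_mul_right _ h
    nlinarith
  · omega

theorem ddg_col_lt {x y : Fin r × Fin m × Fin n} (h : DDGHL x y) : ddgCol x < ddgCol y :=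
  ddg_idx_lt x.2.2.isLt (by
    rcases h.2 with h1 | ⟨h1, h2⟩
    · exact Or.inl h1
    · exact Or.inr ⟨by rw [h1], h2⟩)

theorem ddg_row_lt {x y : Fin r × Fin m × Fin n} (h : DDGVL x y) : ddgRow x < ddgRow y :=
  ddg_idx_lt x.2.1.isLt (by
    rcases h.2 with h1 | ⟨h1, h2⟩
    · exact Or.inl h1
    · exact Or.inr ⟨by rw [h1], h2⟩)

variable {K : Type*} [Field K] {tord : TermOrder (Fin r × Fin m × Fin n)}

theorem ddg_exH (hn : 0 < n) (h : IsDiagonalFor K tord (fun i k => varH r m n hn i k)) :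
    DDGExH tord := by
  intro x y hxy
  have h1 := ddg_exch h x.2.1 y.2.1 (ddgCol x) (ddgCol y) hxy.1 (ddg_col_lt hxy)
    (by
      simp only [ddg_varH]
      intro he
      simp only [Prod.mk.injEq, true_and] at he
      have := hxy.2
      rw [he.1, he.2] at this
      simp at this)
    (by
      simp only [ddg_varH]
      intro he
      simp only [Prod.mk.injEq, true_and, and_true] at he
      exact absurd he hxy.1.ne)
  simp only [ddg_varH] at h1
  rw [add_comm (Finsupp.single (x.1, y.2.1, x.2.2) 1)]
  exact h1

theorem ddg_exV (hm : 0 < m) (h : IsDiagonalFor K tord (fun k j => varV r m n hm k j)) :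
    DDGExV tord := by
  intro x y hxy
  have h1 := ddg_exch h (ddgRow x) (ddgRow y) x.2.2 y.2.2 (ddg_row_lt hxy) hxy.1
    (by
      simp only [ddg_varV]
      intro he
      simp only [Prod.mk.injEq, true_and] at he
      exact absurd he hxy.1.ne)
    (by
      simp only [ddg_varV]
      intro he
      simp only [Prod.mk.injEq, and_true] at he
      have := hxy.2
      rw [he.1, he.2] at this
      simp at this)
  simp only [ddg_varV] at h1
  exact h1

end Exch

/-! ### The parametrization -/

section Param

theorem ddg_det_zero {R : Type*} [CommRing R] {a : ℕ} (M : Matrix (Fin (a + 1)) (Fin (a + 1)) R)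
    (P : Fin (a + 1) → Fin a → R) (Q : Fin a → Fin (a + 1) → R)
    (h : ∀ i j, M i j = ∑ k, P i k * Q k j) : M.det = 0 := by
  have hM : M = (Matrix.of fun i => (Fin.snoc (P i) 0 : Fin (a + 1) → R)) *
      (Matrix.of (Fin.snoc Q 0 : Fin (a + 1) → Fin (a + 1) → R)) := by
    ext i j
    rw [Matrix.mul_apply, Fin.sum_univ_castSucc, h]
    simp
  rw [hM, Matrix.det_mul, Matrix.det_eq_zero_of_column_eq_zero (Fin.last a), zero_mul]
  intro i
  simp

variable {r m n : ℕ}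

/-- exponent vectors of the parametrization -/
def ddgD {a b : ℕ} (v : Fin r × Fin m × Fin n) (c : Fin a × Fin b) :
    (Fin m × Fin a) ⊕ (Fin r × Fin a × Fin b) ⊕ (Fin n × Fin b) →₀ ℕ :=
  Finsupp.single (Sum.inl (v.2.1, c.1)) 1 + Finsupp.single (Sum.inr (Sum.inl (v.1, c.1, c.2))) 1 +
    Finsupp.single (Sum.inr (Sum.inr (v.2.2, c.2))) 1

/-- the parametrization -/
def ddgPhi (K : Type*) [Field K] (r m n a b : ℕ) : MvPolynomial (Fin r × Fin m × Fin n) K →ₐ[K]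
    MvPolynomial ((Fin m × Fin a) ⊕ (Fin r × Fin a × Fin b) ⊕ (Fin n × Fin b)) K :=
  aeval (fun v => ∑ c : Fin a × Fin b, monomial (ddgD v c) 1)

variable {K : Type*} [Field K] {a b : ℕ}

theorem ddgPhi_X (v : Fin r × Fin m × Fin n) : ddgPhi K r m n a b (X v) =
    ∑ k, ∑ l, X (Sum.inl (v.2.1, k)) * X (Sum.inr (Sum.inl (v.1, k, l))) *
      X (Sum.inr (Sum.inr (v.2.2, l))) := by
  unfold ddgPhi
  rw [aeval_X, Fintype.sum_prod_type]
  refine Finset.sum_congr rfl fun k _ => Finset.sum_congr rfl fun l _ => ?_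
  simp [ddgD, X, monomial_mul]

theorem ddgPhi_J (hm : 0 < m) (hn : 0 < n) :
    ∀ f ∈ doubleDetIdeal K r m n (a + 1) (b + 1) hm hn, ddgPhi K r m n a b f = 0 := by
  intro f hf
  have : doubleDetIdeal K r m n (a + 1) (b + 1) hm hn ≤
      RingHom.ker (ddgPhi K r m n a b).toRingHom := by
    unfold doubleDetIdeal
    rw [Ideal.span_le]
    rintro g (⟨rs, cs, -, -, rfl⟩ | ⟨rs, cs, -, -, rfl⟩)
    · change (ddgPhi K r m n a b) _ = 0
      rw [AlgHom.map_det]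
      apply ddg_det_zero _ (fun i k => X (Sum.inl (rs i, k)))
        (fun k j => ∑ l, X (Sum.inr (Sum.inl ((varH r m n hn (rs 0) (cs j)).1, k, l))) *
          X (Sum.inr (Sum.inr ((varH r m n hn (rs 0) (cs j)).2.2, l))))
      intro i j
      simp only [AlgHom.mapMatrix_apply, Matrix.map_apply, Matrix.submatrix_apply, Hmat,
        Matrix.of_apply, ddgPhi_X, Finset.mul_sum, mul_assoc]
      rfl
    · change (ddgPhi K r m n a b) _ = 0
      rw [AlgHom.map_det]
      apply ddg_det_zero _ (fun i l => ∑ k, X (Sum.inl ((varV r m n hm (rs i) (cs 0)).2.1, k)) *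
          X (Sum.inr (Sum.inl ((varV r m n hm (rs i) (cs 0)).1, k, l))))
          (fun l j => X (Sum.inr (Sum.inr (cs j, l))))
      intro i j
      simp only [AlgHom.mapMatrix_apply, Matrix.map_apply, Matrix.submatrix_apply, Vmat,
        Matrix.of_apply, ddgPhi_X, Finset.sum_mul]
      rw [Finset.sum_comm]
      rfl
  exact this hf

theorem ddgPhi_mono {T : Type} [Fintype T] [DecidableEq T] (w : T → Fin r × Fin m × Fin n) :
    ddgPhi K r m n a b (monomial (ddgMono w) 1) =
      ∑ p : T → Fin a × Fin b, monomial (∑ t, ddgD (w t) (p t)) 1 := by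
  have h1 : (monomial (ddgMono w) (1 : K)) = ∏ t, X (w t) := by
    unfold ddgMono
    rw [monomial_sum_one]
    rfl
  rw [h1, map_prod]
  unfold ddgPhi
  simp only [aeval_X]
  rw [Finset.prod_univ_sum, Fintype.piFinset_univ]
  refine Finset.sum_congr rfl fun p _ => ?_
  rw [monomial_sum_one]

theorem ddg_same_of {T T' : Type} [Fintype T] [Fintype T'] {w : T → Fin r × Fin m × Fin n}
    {w' : T' → Fin r × Fin m × Fin n} {p : T → Fin a × Fin b} {p' : T' → Fin a × Fin b}
    (h : ∑ t, ddgD (w t) (p t) = ∑ t, ddgD (w' t) (p' t)) :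
    DDGSame w (fun t => (p t).1.val) (fun t => (p t).2.val)
      w' (fun t => (p' t).1.val) (fun t => (p' t).2.val) := by
  classical
  have e1 : ∀ {S : Type} [Fintype S] (w : S → Fin r × Fin m × Fin n) (p : S → Fin a × Fin b) x,
      ddgMono (fun t => ((w t).2.1, (p t).1)) x = (∑ t, ddgD (w t) (p t)) (Sum.inl x) := by
    intro S _ w p x
    unfold ddgMono ddgD
    simp [Finsupp.finsetSum_apply, Finsupp.single_apply]
  have e2 : ∀ {S : Type} [Fintype S] (w : S → Fin r × Fin m × Fin n) (p : S → Fin a × Fin b) x,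
      ddgMono (fun t => ((w t).1, (p t).1, (p t).2)) x =
        (∑ t, ddgD (w t) (p t)) (Sum.inr (Sum.inl x)) := by
    intro S _ w p x
    unfold ddgMono ddgD
    simp [Finsupp.finsetSum_apply, Finsupp.single_apply]
  have e3 : ∀ {S : Type} [Fintype S] (w : S → Fin r × Fin m × Fin n) (p : S → Fin a × Fin b) x,
      ddgMono (fun t => ((w t).2.2, (p t).2)) x =
        (∑ t, ddgD (w t) (p t)) (Sum.inr (Sum.inr x)) := by
    intro S _ w p x
    unfold ddgMono ddgD
    simp [Finsupp.finsetSum_apply, Finsupp.single_apply]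
  refine ⟨?_, ?_, ?_⟩
  · refine ddgDist_comp (f := fun t => ((w t).2.1, (p t).1))
      (f' := fun t => ((w' t).2.1, (p' t).1)) (ddgMono_eq_iff.mp ?_) (fun x => (x.1, x.2.val))
    ext x; rw [e1, e1, h]
  · refine ddgDist_comp (f := fun t => ((w t).1, (p t).1, (p t).2))
      (f' := fun t => ((w' t).1, (p' t).1, (p' t).2)) (ddgMono_eq_iff.mp ?_)
      (fun x => (x.1, x.2.1.val, x.2.2.val))
    ext x; rw [e2, e2, h]
  · refine ddgDist_comp (f := fun t => ((w t).2.2, (p t).2))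
      (f' := fun t => ((w' t).2.2, (p' t).2)) (ddgMono_eq_iff.mp ?_) (fun x => (x.1, x.2.val))
    ext x; rw [e3, e3, h]

theorem ddg_exists_family {σ : Type*} (M : σ →₀ ℕ) :
    ∃ (N : ℕ) (w : Fin N → σ), ddgMono w = M := by
  induction M using Finsupp.induction_linear with
  | zero => exact ⟨0, Fin.elim0, by simp [ddgMono]⟩
  | add f g hf hg =>
    obtain ⟨N, w, rfl⟩ := hf
    obtain ⟨N', w', rfl⟩ := hg
    refine ⟨N + N', Fin.append w w', ?_⟩
    unfold ddgMono
    rw [Fin.sum_univ_add]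
    simp
  | single x k =>
    refine ⟨k, fun _ => x, ?_⟩
    unfold ddgMono
    simp

theorem ddg_no_lead {tord : TermOrder (Fin r × Fin m × Fin n)} (ex : DDGExH tord)
    (ex' : DDGExV tord) {f : MvPolynomial (Fin r × Fin m × Fin n) K}
    (hf : ddgPhi K r m n a b f = 0) {N : ℕ} {w : Fin N → Fin r × Fin m × Fin n}
    (hlead : IsLeadMono tord f (ddgMono w)) {H V : Fin r × Fin m × Fin n → ℕ}
    (hH : DDGIsHeight (Set.range w) DDGHL H) (hV : DDGIsHeight (Set.range w) DDGVL V)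
    (ha : ∀ t, H (w t) < a) (hb : ∀ t, V (w t) < b) : False := by
  classical
  let p0 : Fin N → Fin a × Fin b := fun t => (⟨H (w t), ha t⟩, ⟨V (w t), hb t⟩)
  have key : ∀ M' ∈ f.support, coeff (∑ t, ddgD (w t) (p0 t))
      (ddgPhi K r m n a b (monomial M' 1)) = if M' = ddgMono w then 1 else 0 := by
    intro M' hM'
    split_ifs with he
    · rw [he, ddgPhi_mono, coeff_sum, Finset.sum_eq_single p0]
      · rw [coeff_monomial, if_pos rfl]
      · intro p _ hp
        rw [coeff_monomial, if_neg]
        intro hpe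
        have h1 := (ddg_core ex ex' hH hV (ddg_same_of hpe.symm)).2 rfl
        apply hp
        ext t
        · exact (h1 t).1
        · exact (h1 t).2
      · simp
    · obtain ⟨N', w', rfl⟩ := ddg_exists_family M'
      rw [ddgPhi_mono, coeff_sum]
      apply Finset.sum_eq_zero
      intro p _
      rw [coeff_monomial, if_neg]
      intro hpe
      exact (ddg_core ex ex' hH hV (ddg_same_of hpe.symm)).1 (hlead.2 _ hM' he)
  have h2 : coeff (∑ t, ddgD (w t) (p0 t)) (ddgPhi K r m n a b f) = coeff (ddgMono w) f := by
    conv_lhs => rw [f.as_sum]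
    rw [map_sum, coeff_sum]
    have h3 : ∀ M' ∈ f.support, coeff (∑ t, ddgD (w t) (p0 t))
        (ddgPhi K r m n a b (monomial M' (coeff M' f))) =
          if M' = ddgMono w then coeff M' f else 0 := by
      intro M' hM'
      have : (monomial M' (coeff M' f)) = (coeff M' f) • monomial M' (1 : K) := by
        rw [smul_monomial, smul_eq_mul, mul_one]
      rw [this, map_smul, coeff_smul, key M' hM']
      simp
    rw [Finset.sum_congr rfl h3, Finset.sum_ite_eq', if_pos hlead.1]
  rw [hf, coeff_zero] at h2
  exact (mem_support_iff.mp hlead.1) h2.symm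

end Param

/-! ### Conclusion -/

section Final

theorem ddg_mono_le {σ : Type*} {S T : Type} [Fintype S] [Fintype T] (f : S → σ) (w : T → σ)
    (hf : Function.Injective f) (h : ∀ i, f i ∈ Set.range w) : ddgMono f ≤ ddgMono w := by
  classical
  choose g hg using h
  have hginj : Function.Injective g := by
    intro i j hij
    apply hf
    rw [← hg i, ← hg j, hij]
  unfold ddgMono
  calc ∑ t, Finsupp.single (f t) 1 = ∑ t, Finsupp.single (w (g t)) 1 := by simp_rw [hg]
    _ = ∑ t ∈ Finset.univ.map ⟨g, hginj⟩, Finsupp.single (w t) 1 := by rw [Finset.sum_map]; rfl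
    _ ≤ ∑ t, Finsupp.single (w t) 1 :=
      Finset.sum_le_sum_of_subset (Finset.subset_univ _)

theorem ddg_inj_of_chain {σ : Type*} {c : ℕ} {R : σ → σ → Prop} (hir : ∀ x, ¬ R x x)
    {f : Fin c → σ} (h : ∀ i j, i < j → R (f i) (f j)) : Function.Injective f := by
  intro i j hij
  by_contra hne
  rcases lt_or_gt_of_ne hne with h1 | h1
  · have := h _ _ h1
    rw [hij] at this
    exact hir _ this
  · have := h _ _ h1
    rw [hij] at this
    exact hir _ this

theorem ddg_mem_of_le {σ K : Type*} [Field K] {tord : TermOrder σ} {G : Set (MvPolynomial σ K)}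
    {g : MvPolynomial σ K} (hg : g ∈ G) {D M : σ →₀ ℕ} (hD : IsLeadMono tord g D) (h : D ≤ M) :
    monomial M (1 : K) ∈
      Ideal.span {g | ∃ f ∈ G, ∃ m, IsLeadMono tord f m ∧ g = monomial m (1 : K)} := by
  obtain ⟨E, rfl⟩ := exists_add_of_le h
  have : monomial (D + E) (1 : K) = monomial E 1 * monomial D 1 := by
    rw [monomial_mul, one_mul, add_comm]
  rw [this]
  exact Ideal.mul_mem_left _ _ (Ideal.subset_span ⟨g, hg, D, hD, rfl⟩)

theorem ddg_one_lead {σ K : Type*} [Field K] (tord : TermOrder σ) :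
    IsLeadMono tord (1 : MvPolynomial σ K) 0 := by
  classical
  constructor
  · rw [mem_support_iff]
    simp
  · intro m' hm' hne
    rw [mem_support_iff, coeff_one, if_neg hne.symm] at hm'
    exact absurd rfl hm'

end Final

theorem double_determinantal_groebner (K : Type*) [Field K] (r m n s t : ℕ)
    (hr : 1 ≤ r) (hm : 0 < m) (hn : 0 < n) (hs : s ≤ m) (ht : t ≤ n)
    (tord : TermOrder (Fin r × Fin m × Fin n))
    (hdiag : IsDiagonalTermOrder K r m n hm hn tord) :
    IsGroebnerBasis tord (doubleDetIdeal K r m n s t hm hn)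
      (minorsSet s m (r * n) (Hmat K r m n hn) ∪ minorsSet t (r * m) n (Vmat K r m n hm)) := by
  refine ⟨Ideal.subset_span, rfl, le_antisymm ?_ ?_⟩
  swap
  · apply Ideal.span_mono
    rintro g ⟨f, hf, M, hM, rfl⟩
    exact ⟨f, Ideal.subset_span hf, M, hM, rfl⟩
  unfold initialIdeal
  rw [Ideal.span_le]
  rintro g ⟨f, hf, M, hM, rfl⟩
  rcases s with _ | a
  · refine ddg_mem_of_le (g := 1) (Or.inl ⟨Fin.elim0, Fin.elim0, fun i => i.elim0,
      fun i => i.elim0, ?_⟩) (ddg_one_lead tord) (zero_le)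
    simp
  rcases t with _ | b
  · refine ddg_mem_of_le (g := 1) (Or.inr ⟨Fin.elim0, Fin.elim0, fun i => i.elim0,
      fun i => i.elim0, ?_⟩) (ddg_one_lead tord) (zero_le)
    simp
  obtain ⟨N, w, rfl⟩ := ddg_exists_family M
  obtain ⟨H, hH⟩ := ddg_exists_height (Set.range w) DDGHL DDGHL.trans' DDGHL.irrefl'
  obtain ⟨V, hV⟩ := ddg_exists_height (Set.range w) DDGVL DDGVL.trans' DDGVL.irrefl'
  by_cases hHa : ∃ t, a ≤ H (w t)
  · obtain ⟨t0, ht0⟩ := hHa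
    obtain ⟨c, hc1, hc2, -⟩ := DDGIsHeight.chain hH DDGHL.trans' a (w t0) ⟨t0, rfl⟩ ht0
    have h1 : StrictMono (fun i => (c i).2.1) := fun i j hij => (hc2 i j hij).1
    have h2 : StrictMono (fun i => ddgCol (c i)) := fun i j hij => ddg_col_lt (hc2 i j hij)
    have hl := hdiag.1 (a + 1) _ _ h1 h2 (Nat.succ_pos a)
    simp only [ddg_varH] at hl
    refine ddg_mem_of_le (Or.inl ⟨_, _, h1, h2, rfl⟩) (D := ddgMono c) ?_
      (ddg_mono_le _ _ (ddg_inj_of_chain DDGHL.irrefl' hc2) hc1)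
    convert hl using 2
    · ext i j
      simp [Hmat, ddg_varH]
    · rfl
  by_cases hVb : ∃ t, b ≤ V (w t)
  · obtain ⟨t0, ht0⟩ := hVb
    obtain ⟨c, hc1, hc2, -⟩ := DDGIsHeight.chain hV DDGVL.trans' b (w t0) ⟨t0, rfl⟩ ht0
    have h1 : StrictMono (fun i => (c i).2.2) := fun i j hij => (hc2 i j hij).1
    have h2 : StrictMono (fun i => ddgRow (c i)) := fun i j hij => ddg_row_lt (hc2 i j hij)
    have hl := hdiag.2 (b + 1) _ _ h2 h1 (Nat.succ_pos b)
    simp only [ddg_varV] at hl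
    refine ddg_mem_of_le (Or.inr ⟨_, _, h2, h1, rfl⟩) (D := ddgMono c) ?_
      (ddg_mono_le _ _ (ddg_inj_of_chain DDGVL.irrefl' hc2) hc1)
    convert hl using 2
    · ext i j
      simp [Vmat, ddg_varV]
    · rfl
  push Not at hHa hVb
  exact (ddg_no_lead (ddg_exH hn hdiag.1) (ddg_exV hm hdiag.2) (ddgPhi_J hm hn f hf) hM hH hV
    hHa hVb).elim

end
end
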